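/- arXiv:math/0701266 — 2 statements merged into one kernel-verified Lean document; each statement's English description precedes it below -/
import Mathlib

section
/- Let G ⊂ GL(V) be an irreducible complex reflection group, where V is a vector space over the field of definition K of G, and let χ_V be the character of the representation V. Then the characters of the faithful irreducible representations of G in which every reflection of G acts as a reflection are exactly the characters γ ∘ χ_V for γ ∈ Gal(K/ℚ). -/
open Module LinearMap

section Defs

variable {𝕜 V : Type*} [Field 𝕜] [AddCommGroup V] [Module 𝕜 V]

/-- A (pseudo)reflection: a nontrivial finite-order linear automorphism
whose fixed subspace is a hyperplane. -/
def IsPseudoReflection (g : V ≃ₗ[𝕜] V) : Prop :=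
  IsOfFinOrder g ∧ g ≠ 1 ∧
    Module.finrank 𝕜 (LinearMap.ker ((g : V →ₗ[𝕜] V) - LinearMap.id)) + 1 = Module.finrank 𝕜 V

/-- The set of reflections of a linear group. -/
def reflectionsOf (G : Subgroup (V ≃ₗ[𝕜] V)) : Set (V ≃ₗ[𝕜] V) :=
  {g | g ∈ G ∧ IsPseudoReflection g}

/-- A reflection group: a finite linear group generated by its reflections. -/
def IsReflectionGroup (G : Subgroup (V ≃ₗ[𝕜] V)) : Prop :=
  Finite G ∧ Subgroup.closure (reflectionsOf G) = G

/-- The group `G` acts irreducibly on `V`. -/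
def ActsIrreducibly (G : Subgroup (V ≃ₗ[𝕜] V)) : Prop :=
  Nontrivial V ∧
    ∀ W : Submodule 𝕜 V, (∀ g ∈ G, W.map ((g : V ≃ₗ[𝕜] V) : V →ₗ[𝕜] V) ≤ W) → W = ⊥ ∨ W = ⊤

/-- A central automorphism: `α g ∈ g · Z(H)` for every `g`. -/
def IsCentralAut {H : Type*} [Group H] (α : MulAut H) : Prop :=
  ∀ g : H, g⁻¹ * α g ∈ Subgroup.center H

/-- An automorphism of `G` preserving the set of reflections of `G`. -/
def PreservesReflections (G : Subgroup (V ≃ₗ[𝕜] V)) (α : MulAut ↥G) : Prop :=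
  ∀ g : ↥G, IsPseudoReflection ((g : V ≃ₗ[𝕜] V)) ↔ IsPseudoReflection ((α g : V ≃ₗ[𝕜] V))

end Defs

/-- A representation (homomorphism to linear automorphisms) is irreducible. -/
def IsIrreducibleRep {H W 𝕜 : Type*} [Group H] [Field 𝕜] [AddCommGroup W] [Module 𝕜 W]
    (ρ : H →* (W ≃ₗ[𝕜] W)) : Prop :=
  Nontrivial W ∧
    ∀ U : Submodule 𝕜 W, (∀ h : H, U.map ((ρ h : W ≃ₗ[𝕜] W) : W →ₗ[𝕜] W) ≤ U) → U = ⊥ ∨ U = ⊤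

/-- The field of definition of `G ⊂ GL(V)`: the subfield of `ℂ` generated by the traces. -/
noncomputable def fieldOfDefinition {V : Type*} [AddCommGroup V] [Module ℂ V]
    (G : Subgroup (V ≃ₗ[ℂ] V)) : Subfield ℂ :=
  Subfield.closure (Set.range fun g : G => LinearMap.trace ℂ V ((g : V ≃ₗ[ℂ] V) : V →ₗ[ℂ] V))

/-- The character of the reflection representation, with values in the field of definition. -/
noncomputable def reflChar {V : Type*} [AddCommGroup V] [Module ℂ V]
    (G : Subgroup (V ≃ₗ[ℂ] V)) (g : ↥G) : ↥(fieldOfDefinition G) :=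
  ⟨LinearMap.trace ℂ V ((g : V ≃ₗ[ℂ] V) : V →ₗ[ℂ] V), Subfield.subset_closure ⟨g, rfl⟩⟩

section Steinberg

open MvPolynomial

variable {ι : Type*} [Fintype ι]

/-- The linear form `α` as a polynomial. -/
noncomputable def linPoly (α : (ι → ℂ) →ₗ[ℂ] ℂ) : MvPolynomial ι ℂ :=
  open Classical in ∑ j, C (α (Pi.single j 1)) * X j

lemma eval_linPoly (α : (ι → ℂ) →ₗ[ℂ] ℂ) (v : ι → ℂ) : eval v (linPoly α) = α v := by
  classical
  rw [linPoly, map_sum, LinearMap.pi_apply_eq_sum_univ α v]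
  refine Finset.sum_congr rfl fun j _ => ?_
  simp only [map_mul, eval_C, eval_X, smul_eq_mul, mul_comm (v j)]
  congr 2
  ext k
  simp [Pi.single_apply, eq_comm]

/-- Substitution of a linear endomorphism into a polynomial. -/
noncomputable def pull (f : (ι → ℂ) →ₗ[ℂ] (ι → ℂ)) : MvPolynomial ι ℂ →ₐ[ℂ] MvPolynomial ι ℂ :=
  aeval fun i => linPoly (LinearMap.proj i ∘ₗ f)

lemma eval_pull (f : (ι → ℂ) →ₗ[ℂ] (ι → ℂ)) (v : ι → ℂ) (p : MvPolynomial ι ℂ) :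
    eval v (pull f p) = eval (f v) p := by
  induction p using MvPolynomial.induction_on with
  | C a => simp [pull]
  | add p q hp hq => simp [hp, hq]
  | mul_X p i hp => rw [map_mul, map_mul, hp, map_mul, pull, aeval_X, eval_linPoly, eval_X]; rfl

lemma pull_mul (f g : Module.End ℂ (ι → ℂ)) (p : MvPolynomial ι ℂ) :
    pull (f * g) p = pull g (pull f p) :=
  MvPolynomial.funext fun v => by simp [eval_pull]

lemma pull_one (p : MvPolynomial ι ℂ) : pull (1 : Module.End ℂ (ι → ℂ)) p = p :=
  MvPolynomial.funext fun v => by simp [eval_pull]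

lemma totalDegree_linPoly_le (α : (ι → ℂ) →ₗ[ℂ] ℂ) : (linPoly α).totalDegree ≤ 1 := by
  classical
  refine totalDegree_finsetSum_le fun j _ => (totalDegree_mul _ _).trans ?_
  simp

lemma totalDegree_pull_le (f : (ι → ℂ) →ₗ[ℂ] (ι → ℂ)) (p : MvPolynomial ι ℂ) :
    (pull f p).totalDegree ≤ p.totalDegree := by
  rw [pull, aeval_def, eval₂_eq]
  refine totalDegree_finsetSum_le fun d hd => (totalDegree_mul _ _).trans ?_
  rw [algebraMap_eq, totalDegree_C, zero_add]
  refine (totalDegree_finsetProd _ _).trans (le_trans (Finset.sum_le_sum (g := d) fun i _ => ?_)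
    (le_totalDegree hd))
  refine (totalDegree_pow _ _).trans ?_
  have := Nat.mul_le_mul_left (d i) (totalDegree_linPoly_le (LinearMap.proj i ∘ₗ f))
  simpa using this

lemma one_le_totalDegree_linPoly {α : (ι → ℂ) →ₗ[ℂ] ℂ} (hα : α ≠ 0) :
    1 ≤ (linPoly α).totalDegree := by
  by_contra! h
  have h0 : (linPoly α).totalDegree = 0 := by omega
  rw [totalDegree_eq_zero_iff_eq_C] at h0
  refine hα (LinearMap.ext fun v => ?_)
  have h1 := eval_linPoly α v
  have h2 := eval_linPoly α 0
  rw [h0, eval_C] at h1 h2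
  rw [← h1, h2, map_zero, LinearMap.zero_apply]

lemma linPoly_ne_zero {α : (ι → ℂ) →ₗ[ℂ] ℂ} (hα : α ≠ 0) : linPoly α ≠ 0 := by
  intro h
  have := one_le_totalDegree_linPoly hα
  simp [h] at this

lemma linPoly_dvd_sub_pull {f : (ι → ℂ) →ₗ[ℂ] (ι → ℂ)} {α : (ι → ℂ) →ₗ[ℂ] ℂ} {a : ι → ℂ}
    (hf : ∀ v, f v = v - α v • a) (p : MvPolynomial ι ℂ) : linPoly α ∣ p - pull f p := by
  induction p using MvPolynomial.induction_on with
  | C c => simp [pull]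
  | add p q hp hq => rw [map_add, add_sub_add_comm]; exact dvd_add hp hq
  | mul_X p i hp =>
    have hX : (X i : MvPolynomial ι ℂ) - pull f (X i) = linPoly α * C (a i) :=
      MvPolynomial.funext fun v => by simp [eval_pull, eval_linPoly, hf]
    have : p * X i - pull f (p * X i) = (p - pull f p) * X i + pull f p * (X i - pull f (X i)) := by
      rw [map_mul]; ring
    rw [this, hX]
    exact dvd_add (hp.mul_right _) (Dvd.intro _ (by ring : linPoly α * (pull f p * C (a i)) = _))

lemma ideal_sup_eq_top_of_no_common_zero {I J : Ideal (MvPolynomial ι ℂ)}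
    (h : ∀ z, (∃ p ∈ I, eval z p ≠ 0) ∨ ∃ p ∈ J, eval z p ≠ 0) : I ⊔ J = ⊤ := by
  by_contra hne
  obtain ⟨M, hM, hle⟩ := Ideal.exists_le_maximal _ hne
  obtain ⟨z, rfl⟩ := isMaximal_iff_eq_vanishingIdeal_singleton.1 hM
  rcases h z with ⟨p, hp, hz⟩ | ⟨p, hp, hz⟩
  · exact hz (by simpa using (mem_vanishingIdeal_singleton_iff z p).1 (hle (le_sup_left (a := I) hp)))
  · exact hz (by simpa using (mem_vanishingIdeal_singleton_iff z p).1 (hle (le_sup_right (a := I) hp)))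

variable {G : Type*} [Group G] (ρ : Representation ℂ G (ι → ℂ))

/-- The ideal generated by the polynomials that are invariant under `M` and vanish at `y`. -/
noncomputable def invIdeal (M : Subgroup G) (y : ι → ℂ) : Ideal (MvPolynomial ι ℂ) :=
  Ideal.span {p | (∀ m ∈ M, pull (ρ m) p = p) ∧ eval y p = 0}

variable {ρ}

lemma mem_invIdeal_of_inv {M : Subgroup G} {y : ι → ℂ} {p : MvPolynomial ι ℂ}
    (h : ∀ m ∈ M, pull (ρ m) p = p) (hy : eval y p = 0) : p ∈ invIdeal ρ M y :=
  Ideal.subset_span ⟨h, hy⟩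

lemma pull_rho_mul (g h : G) (p : MvPolynomial ι ℂ) :
    pull (ρ (g * h)) p = pull (ρ h) (pull (ρ g) p) := by
  rw [map_mul, pull_mul]

lemma pull_mem_invIdeal {M M' : Subgroup G} {y : ι → ℂ} {g : G}
    (hMM : ∀ m ∈ M, g * m * g⁻¹ ∈ M') {p : MvPolynomial ι ℂ}
    (hp : p ∈ invIdeal ρ M' (ρ g y)) : pull (ρ g) p ∈ invIdeal ρ M y := by
  induction hp using Submodule.span_induction with
  | mem q hq =>
    refine mem_invIdeal_of_inv (fun m hm => ?_) (by rw [eval_pull, hq.2])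
    rw [← pull_rho_mul, show g * m = (g * m * g⁻¹) * g by group, pull_rho_mul, hq.1 _ (hMM m hm)]
  | zero => simp
  | add p q _ _ hp hq => rw [map_add]; exact add_mem hp hq
  | smul c p _ hp => rw [smul_eq_mul, map_mul]; exact Ideal.mul_mem_left _ _ hp

lemma exists_mem_invIdeal_eval_ne_zero [Finite G] {M : Subgroup G} {y z : ι → ℂ}
    (hM : ∀ m ∈ M, ρ m y = y) (hz : z ≠ y) : ∃ p ∈ invIdeal ρ M y, eval z p ≠ 0 := by
  classical
  have := Fintype.ofFinite M
  have hinj : ∀ m : M, ρ m z - y ≠ 0 := by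
    intro m h
    apply hz
    have h1 : ρ m z = ρ m y := by rw [hM m m.2]; exact sub_eq_zero.1 h
    have h2 := congrArg (ρ (m⁻¹ : M)) h1
    simpa [← Module.End.mul_apply, ← map_mul] using h2
  obtain ⟨ℓ, hℓ⟩ := Module.exists_dual_forall_apply_ne_zero (K := ℂ) (fun m : M => ρ m z - y) hinj
  refine ⟨∏ m : M, (pull (ρ m) (linPoly ℓ - C (ℓ y))), mem_invIdeal_of_inv (fun g hg => ?_) ?_, ?_⟩
  · rw [map_prod]
    simp_rw [← pull_rho_mul]
    exact Fintype.prod_equiv (Equiv.mulRight (⟨g, hg⟩ : M)) _ _ fun m => rfl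
  · rw [map_prod]
    refine Finset.prod_eq_zero (Finset.mem_univ 1) ?_
    simp [eval_pull, eval_linPoly]
  · rw [map_prod]
    refine Finset.prod_ne_zero_iff.2 fun m _ => ?_
    simpa [eval_pull, eval_linPoly, map_sub] using hℓ m

end Steinberg

section Steinberg

open MvPolynomial

variable {ι : Type*} [Fintype ι] {G : Type*} [Group G] {ρ : Representation ℂ G (ι → ℂ)}

variable (ρ) in
/-- The subgroup generated by the elements of `R` fixing the vector `v`. -/
def fixedClosure (R : Set G) (v : ι → ℂ) : Subgroup G :=
  Subgroup.closure {s | s ∈ R ∧ ρ s v = v}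

omit [Fintype ι] in
lemma fixedClosure_apply {R : Set G} {v : ι → ℂ} {g : G} (hg : g ∈ fixedClosure ρ R v) :
    ρ g v = v := by
  induction hg using Subgroup.closure_induction with
  | mem x hx => exact hx.2
  | one => simp
  | mul x y _ _ hx hy => rw [map_mul, Module.End.mul_apply, hy, hx]
  | inv x _ hx =>
    have : ρ x⁻¹ (ρ x v) = v := by simp [← Module.End.mul_apply, ← map_mul]
    rwa [hx] at this

omit [Fintype ι] in
lemma conj_mem_fixedClosure {R : Set G} (hconj : ∀ g, ∀ s ∈ R, g * s * g⁻¹ ∈ R) {v : ι → ℂ} {g m : G}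
    (hm : m ∈ fixedClosure ρ R v) : g * m * g⁻¹ ∈ fixedClosure ρ R (ρ g v) := by
  induction hm using Subgroup.closure_induction with
  | mem x hx =>
    refine Subgroup.subset_closure ⟨hconj g x hx.1, ?_⟩
    rw [← Module.End.mul_apply, ← map_mul, inv_mul_cancel_right, map_mul, Module.End.mul_apply, hx.2]
  | one => simp
  | mul x y _ _ hx hy => simpa [mul_assoc] using mul_mem hx hy
  | inv x _ hx => simpa [mul_assoc] using inv_mem hx

lemma exists_quotient_mem_invIdeal {M : Subgroup G} {s : G} (hs : s ∈ M) {α : (ι → ℂ) →ₗ[ℂ] ℂ}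
    {a : ι → ℂ} (hρ : ∀ v, ρ s v = v - α v • a) {y : ι → ℂ} {f : MvPolynomial ι ℂ}
    (hf : f ∈ invIdeal ρ M y) : ∃ q ∈ invIdeal ρ M y, f - pull (ρ s) f = linPoly α * q := by
  induction hf using Submodule.span_induction with
  | mem q hq => exact ⟨0, zero_mem _, by rw [hq.1 s hs]; simp⟩
  | zero => exact ⟨0, zero_mem _, by simp⟩
  | add p q _ _ hp hq =>
    obtain ⟨p', hp', hp⟩ := hp
    obtain ⟨q', hq', hq⟩ := hq
    exact ⟨p' + q', add_mem hp' hq', by rw [map_add, mul_add, ← hp, ← hq]; ring⟩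
  | smul c p hp h =>
    obtain ⟨p', hp', h⟩ := h
    obtain ⟨c', hc⟩ := linPoly_dvd_sub_pull hρ c
    refine ⟨c' * p + pull (ρ s) c * p',
      add_mem (Ideal.mul_mem_left _ _ hp) (Ideal.mul_mem_left _ _ hp'), ?_⟩
    rw [smul_eq_mul, map_mul, mul_add, ← mul_assoc, ← hc, mul_left_comm, ← h]
    ring

lemma mem_of_mul_mem_of_sup_eq_top {A : Type*} [CommRing A] {I : Ideal A} {x q : A}
    (h : I ⊔ Ideal.span {x} = ⊤) (hq : x * q ∈ I) : q ∈ I := by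
  have h1 : (1 : A) ∈ I ⊔ Ideal.span {x} := h ▸ Submodule.mem_top
  obtain ⟨i, hi, j, hj, hij⟩ := Submodule.mem_sup.1 h1
  obtain ⟨c, rfl⟩ := Ideal.mem_span_singleton'.1 hj
  have : q = q * i + c * (x * q) := by linear_combination (-q) * hij
  rw [this]
  exact add_mem (Ideal.mul_mem_left _ _ hi) (Ideal.mul_mem_left _ _ hq)

variable [Finite G] {R : Set G} {α : G → ((ι → ℂ) →ₗ[ℂ] ℂ)} {a : G → (ι → ℂ)}

lemma quotient_mem_invIdeal (hρ : ∀ s ∈ R, ∀ v, ρ s v = v - α s v • a s) (hα : ∀ s ∈ R, α s ≠ 0)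
    (hconj : ∀ g, ∀ s ∈ R, g * s * g⁻¹ ∈ R) {s : G} (hs : s ∈ R) {y : ι → ℂ}
    {h q : MvPolynomial ι ℂ} (hy : h ∈ invIdeal ρ (fixedClosure ρ R y) y)
    (hsy : h ∈ invIdeal ρ (fixedClosure ρ R (ρ s y)) (ρ s y))
    (hq : h - pull (ρ s) h = linPoly (α s) * q) : q ∈ invIdeal ρ (fixedClosure ρ R y) y := by
  by_cases hfix : ρ s y = y
  · obtain ⟨q', hq', h'⟩ := exists_quotient_mem_invIdeal
      (Subgroup.subset_closure ⟨hs, hfix⟩ : s ∈ fixedClosure ρ R y) (hρ s hs) hy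
    rw [hq] at h'
    rwa [mul_left_cancel₀ (linPoly_ne_zero (hα s hs)) h']
  · refine mem_of_mul_mem_of_sup_eq_top (x := linPoly (α s))
      (ideal_sup_eq_top_of_no_common_zero fun z => ?_) ?_
    · by_cases hz : z = y
      · refine Or.inr ⟨_, Ideal.mem_span_singleton_self _, ?_⟩
        rw [eval_linPoly, hz]
        intro h0
        apply hfix
        rw [hρ s hs, h0, zero_smul, sub_zero]
      · exact Or.inl (exists_mem_invIdeal_eval_ne_zero (fun m hm => fixedClosure_apply hm) hz)
    · rw [← hq]
      exact sub_mem hy (pull_mem_invIdeal (fun m hm => conj_mem_fixedClosure hconj hm) hsy)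

/-- Averaging over a subgroup. -/
noncomputable def avg (ρ : Representation ℂ G (ι → ℂ)) (H : Subgroup G) (p : MvPolynomial ι ℂ) :
    MvPolynomial ι ℂ :=
  C (Nat.card H : ℂ)⁻¹ * ∑ᶠ h : H, pull (ρ h) p

lemma sub_avg_mem {I : Ideal (MvPolynomial ι ℂ)} {H : Subgroup G} {p : MvPolynomial ι ℂ}
    (h : ∀ g ∈ H, p - pull (ρ g) p ∈ I) : p - avg ρ H p ∈ I := by
  have := Fintype.ofFinite H
  have h0 : (Nat.card H : ℂ) ≠ 0 := by exact_mod_cast Nat.card_pos.ne'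
  have : p - avg ρ H p = C (Nat.card H : ℂ)⁻¹ * ∑ h : H, (p - pull (ρ h) p) := by
    rw [Finset.sum_sub_distrib, avg, finsum_eq_sum_of_fintype, mul_sub, Finset.sum_const,
      Finset.card_univ, ← Nat.card_eq_fintype_card, nsmul_eq_mul, ← mul_assoc,
      ← map_natCast (C : ℂ →+* MvPolynomial ι ℂ), ← map_mul, inv_mul_cancel₀ h0, map_one, one_mul]
  rw [this]
  exact Ideal.mul_mem_left _ _ (Ideal.sum_mem _ fun g _ => h g g.2)

lemma pull_avg {H : Subgroup G} {g : G} (hg : g ∈ H) (p : MvPolynomial ι ℂ) :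
    pull (ρ g) (avg ρ H p) = avg ρ H p := by
  have := Fintype.ofFinite H
  have h1 : ∑ h : H, pull (ρ g) (pull (ρ h) p) = ∑ h : H, pull (ρ h) p :=
    Fintype.sum_equiv (Equiv.mulRight (⟨g, hg⟩ : H)) _ _ fun m => (pull_rho_mul _ _ _).symm
  have h2 (c : ℂ) : pull (ρ g) (C c) = C c := by simp [pull]
  rw [avg, finsum_eq_sum_of_fintype, map_mul, map_sum, h1, h2]

lemma eval_avg {H : Subgroup G} {v : ι → ℂ} (p : MvPolynomial ι ℂ)
    (h : ∀ g ∈ H, eval (ρ g v) p = eval v p) : eval v (avg ρ H p) = eval v p := by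
  have := Fintype.ofFinite H
  have h0 : (Nat.card H : ℂ) ≠ 0 := by exact_mod_cast Nat.card_pos.ne'
  rw [avg, finsum_eq_sum_of_fintype, map_mul, map_sum, Finset.sum_congr rfl
    (fun g _ => by rw [eval_pull, h g g.2]), Finset.sum_const, Finset.card_univ,
    ← Nat.card_eq_fintype_card, nsmul_eq_mul, eval_C, inv_mul_cancel_left₀ h0]

lemma avg_mul_of_inv {H : Subgroup G} {b : MvPolynomial ι ℂ} (hb : ∀ g ∈ H, pull (ρ g) b = b)
    (p : MvPolynomial ι ℂ) : avg ρ H (p * b) = b * avg ρ H p := by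
  have := Fintype.ofFinite H
  simp only [avg, finsum_eq_sum_of_fintype]
  rw [mul_left_comm, Finset.mul_sum Finset.univ _ b]
  congr 1
  exact Finset.sum_congr rfl fun g _ => by rw [map_mul, hb g g.2, mul_comm]

lemma avg_add {H : Subgroup G} (p q : MvPolynomial ι ℂ) :
    avg ρ H (p + q) = avg ρ H p + avg ρ H q := by
  have := Fintype.ofFinite H
  simp only [avg, finsum_eq_sum_of_fintype, map_add, Finset.sum_add_distrib, mul_add]

lemma avg_of_inv {H : Subgroup G} {b : MvPolynomial ι ℂ} (hb : ∀ g ∈ H, pull (ρ g) b = b) :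
    avg ρ H b = b := by
  have h : b - avg ρ H b ∈ (⊥ : Ideal (MvPolynomial ι ℂ)) :=
    sub_avg_mem fun g hg => by rw [hb g hg]; simp
  exact (sub_eq_zero.1 ((Submodule.mem_bot _).1 h)).symm

lemma iInf_invIdeal_le (hρ : ∀ s ∈ R, ∀ v, ρ s v = v - α s v • a s) (hα : ∀ s ∈ R, α s ≠ 0)
    (hconj : ∀ g, ∀ s ∈ R, g * s * g⁻¹ ∈ R) (hgen : Subgroup.closure R = ⊤) (v : ι → ℂ) (n : ℕ) :
    ∀ h : MvPolynomial ι ℂ, h.totalDegree = n →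
      (∀ g, h ∈ invIdeal ρ (fixedClosure ρ R (ρ g v)) (ρ g v)) → h ∈ invIdeal ρ ⊤ v := by
  induction n using Nat.strong_induction_on with
  | _ n ih =>
  intro h hn hK
  have key : ∀ g : G, h - pull (ρ g) h ∈ invIdeal ρ ⊤ v := by
    have hstab : ∀ g : G, ∀ p ∈ invIdeal ρ (⊤ : Subgroup G) v, pull (ρ g) p ∈ invIdeal ρ ⊤ v := by
      intro g p hp
      induction hp using Submodule.span_induction with
      | mem q hq => rw [hq.1 g (Subgroup.mem_top g)]; exact Ideal.subset_span hq
      | zero => simp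
      | add p q _ _ hp hq => rw [map_add]; exact add_mem hp hq
      | smul c p _ hp => rw [smul_eq_mul, map_mul]; exact Ideal.mul_mem_left _ _ hp
    intro g
    have hg : g ∈ Subgroup.closure R := hgen ▸ Subgroup.mem_top g
    induction hg using Subgroup.closure_induction with
    | mem s hs =>
      obtain ⟨q, hq⟩ := linPoly_dvd_sub_pull (hρ s hs) h
      rw [hq]
      by_cases hq0 : q = 0
      · simp [hq0]
      refine Ideal.mul_mem_left _ _ (ih q.totalDegree ?_ q rfl fun g =>
        quotient_mem_invIdeal hρ hα hconj hs (hK g) ?_ hq)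
      · have h1 := totalDegree_mul_of_isDomain (linPoly_ne_zero (hα s hs)) hq0
        rw [← hq] at h1
        have h2 := one_le_totalDegree_linPoly (hα s hs)
        have h3 : (h - pull (ρ s) h).totalDegree ≤ n :=
          (totalDegree_sub _ _).trans (max_le hn.le ((totalDegree_pull_le _ _).trans hn.le))
        omega
      · rw [← Module.End.mul_apply, ← map_mul]
        exact hK (s * g)
    | one => rw [map_one, pull_one]; simp
    | mul x y _ _ hx hy =>
      have : h - pull (ρ (x * y)) h = (h - pull (ρ y) h) + pull (ρ y) (h - pull (ρ x) h) := by
        rw [pull_rho_mul, map_sub]; ring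
      rw [this]
      exact add_mem hy (hstab y _ hx)
    | inv x _ hx =>
      have : h - pull (ρ x⁻¹) h = - pull (ρ x⁻¹) (h - pull (ρ x) h) := by
        rw [map_sub, ← pull_rho_mul, mul_inv_cancel, map_one, pull_one]; ring
      rw [this]
      exact neg_mem (hstab _ _ hx)
  have h1 := sub_avg_mem (H := ⊤) fun g _ => key g
  have hzero : ∀ g, eval (ρ g v) h = 0 := by
    intro g
    have : invIdeal ρ (fixedClosure ρ R (ρ g v)) (ρ g v) ≤ RingHom.ker (eval (ρ g v)) :=
      Ideal.span_le.2 fun p hp => hp.2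
    exact this (hK g)
  have h2 : avg ρ ⊤ h ∈ invIdeal ρ ⊤ v := by
    have hv : eval v h = 0 := by simpa using hzero 1
    refine mem_invIdeal_of_inv (fun m hm => pull_avg hm h) ?_
    rw [eval_avg, hv]
    intro g _
    rw [hzero, hv]
  simpa using add_mem h1 h2

end Steinberg

section Steinberg

open MvPolynomial

/-- The pointwise stabilizer of a set of vectors. -/
def pointStab {G V : Type*} [Group G] [AddCommGroup V] [Module ℂ V] (ρ : Representation ℂ G V)
    (U : Set V) : Subgroup G where
  carrier := {g | ∀ u ∈ U, ρ g u = u}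
  mul_mem' {g h} hg hh u hu := by rw [map_mul, Module.End.mul_apply, hh u hu, hg u hu]
  one_mem' u _ := by simp
  inv_mem' {g} hg u hu := by
    have : ρ g⁻¹ (ρ g u) = u := by simp [← Module.End.mul_apply, ← map_mul]
    rwa [hg u hu] at this

lemma mem_pointStab {G V : Type*} [Group G] [AddCommGroup V] [Module ℂ V]
    {ρ : Representation ℂ G V} {U : Set V} {g : G} : g ∈ pointStab ρ U ↔ ∀ u ∈ U, ρ g u = u :=
  Iff.rfl

/-- Over `ℂ`, every subspace has a vector whose stabilizer fixes the whole subspace. -/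
lemma exists_generic {G V : Type*} [Group G] [Finite G] [AddCommGroup V] [Module ℂ V]
    (ρ : Representation ℂ G V) (U : Submodule ℂ V) :
    ∃ u ∈ U, ∀ g, ρ g u = u → g ∈ pointStab ρ (U : Set V) := by
  by_contra! h
  have hcov : ⋃ g : {g // g ∉ pointStab ρ (U : Set V)},
      (LinearMap.ker ((1 - ρ g) ∘ₗ U.subtype) : Set U) = Set.univ := by
    refine Set.eq_univ_of_forall fun u => ?_
    obtain ⟨g, hg, hgs⟩ := h u u.2
    refine Set.mem_iUnion.2 ⟨⟨g, hgs⟩, ?_⟩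
    simp [hg]
  obtain ⟨g, hg⟩ := Subspace.exists_eq_top_of_iUnion_eq_univ hcov
  refine g.2 fun u hu => ?_
  have : (⟨u, hu⟩ : U) ∈ LinearMap.ker ((1 - ρ g) ∘ₗ U.subtype) := hg ▸ Submodule.mem_top
  exact (sub_eq_zero.1 (this : u - ρ g u = 0)).symm

variable {ι : Type*} [Fintype ι] {G : Type*} [Group G] {ρ : Representation ℂ G (ι → ℂ)}
variable [Finite G] {R : Set G} {α : G → ((ι → ℂ) →ₗ[ℂ] ℂ)} {a : G → (ι → ℂ)}

lemma invIdeal_fixedClosure_le (hρ : ∀ s ∈ R, ∀ v, ρ s v = v - α s v • a s)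
    (hα : ∀ s ∈ R, α s ≠ 0)
    (hconj : ∀ g, ∀ s ∈ R, g * s * g⁻¹ ∈ R) (hgen : Subgroup.closure R = ⊤) (v : ι → ℂ) :
    invIdeal ρ (fixedClosure ρ R v) v ≤ invIdeal ρ (pointStab ρ {v}) v := by
  classical
  intro f hf
  have hle : invIdeal ρ ⊤ v ≤ invIdeal ρ (pointStab ρ {v}) v :=
    Ideal.span_mono fun p hp => ⟨fun m _ => hp.1 m (Subgroup.mem_top m), hp.2⟩
  have hfin : (Set.range fun g => ρ g v).Finite := Set.finite_range _
  have hsup : invIdeal ρ (pointStab ρ {v}) v ⊔ ⨅ y ∈ hfin.toFinset.erase v,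
      invIdeal ρ (fixedClosure ρ R y) y = ⊤ := by
    refine Ideal.sup_iInf_eq_top fun y hy => ideal_sup_eq_top_of_no_common_zero fun z => ?_
    by_cases hz : z = v
    · subst hz
      exact Or.inr (exists_mem_invIdeal_eval_ne_zero (fun m hm => fixedClosure_apply hm)
        (Finset.ne_of_mem_erase hy).symm)
    · exact Or.inl (exists_mem_invIdeal_eval_ne_zero (fun m hm => hm v rfl) hz)
  have h1 : (1 : MvPolynomial ι ℂ) ∈ _ ⊔ _ := (Ideal.eq_top_iff_one _).1 hsup
  obtain ⟨c, hc, e, he, hce⟩ := Submodule.mem_sup.1 h1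
  have hef : e * f ∈ invIdeal ρ (pointStab ρ {v}) v := by
    refine hle (iInf_invIdeal_le hρ hα hconj hgen v _ _ rfl fun g => ?_)
    by_cases hg : ρ g v = v
    · rw [hg]; exact Ideal.mul_mem_left _ _ hf
    · refine Ideal.mul_mem_right _ _ ?_
      simp only [Submodule.mem_iInf] at he
      exact he _ (by simp [hg])
  have : f = f * c + e * f := by linear_combination (-f) * hce
  rw [this]
  exact add_mem (Ideal.mul_mem_left _ _ hc) hef

lemma pull_eq_of_fixedClosure_inv (hρ : ∀ s ∈ R, ∀ v, ρ s v = v - α s v • a s)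
    (hα : ∀ s ∈ R, α s ≠ 0)
    (hconj : ∀ g, ∀ s ∈ R, g * s * g⁻¹ ∈ R) (hgen : Subgroup.closure R = ⊤) {v : ι → ℂ}
    {t : MvPolynomial ι ℂ} (ht : ∀ g ∈ fixedClosure ρ R v, pull (ρ g) t = t) {g : G}
    (hg : ρ g v = v) : pull (ρ g) t = t := by
  set H := fixedClosure ρ R v
  set m : Ideal (MvPolynomial ι ℂ) := RingHom.ker (eval v)
  have hHL : H ≤ pointStab ρ {v} := fun x hx u hu => by
    rw [Set.mem_singleton_iff.1 hu]; exact fixedClosure_apply hx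
  have key (k : ℕ) : ∀ t : MvPolynomial ι ℂ, (∀ g ∈ H, pull (ρ g) t = t) →
      pull (ρ g) t - t ∈ m ^ k := by
    induction k with
    | zero => intro t _; simp
    | succ k ih =>
      have h1 : ∀ f ∈ invIdeal ρ (pointStab ρ {v}) v, ∀ c,
          pull (ρ g) (avg ρ H (c * f)) - avg ρ H (c * f) ∈ m ^ (k + 1) := by
        intro f hf
        induction hf using Submodule.span_induction with
        | mem b hb =>
          intro c
          rw [avg_mul_of_inv fun x hx => hb.1 x (hHL hx), map_mul,
            hb.1 g (by rw [mem_pointStab]; simpa using hg), ← mul_sub, pow_succ']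
          exact Ideal.mul_mem_mul hb.2 (ih _ fun x hx => pull_avg hx c)
        | zero => intro c; simp [avg]
        | add p q _ _ hp hq =>
          intro c
          rw [mul_add, avg_add, map_add, add_sub_add_comm]
          exact add_mem (hp c) (hq c)
        | smul d p _ hp => intro c; rw [smul_eq_mul, ← mul_assoc]; exact hp _
      intro t ht
      have h2 (x : G) (c : ℂ) : pull (ρ x) (C c) = C c := by simp [pull]
      have ht' : ∀ x ∈ H, pull (ρ x) (t - C (eval v t)) = t - C (eval v t) := fun x hx => by
        rw [map_sub, ht x hx, h2]
      have h3 : t - C (eval v t) ∈ invIdeal ρ H v := mem_invIdeal_of_inv ht' (by simp)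
      have h4 := h1 _ (invIdeal_fixedClosure_le hρ hα hconj hgen v h3) 1
      rw [one_mul, avg_of_inv ht', map_sub, h2] at h4
      simpa using h4
  have hm : m ≠ ⊤ := RingHom.ker_ne_top _
  have h5 : pull (ρ g) t - t ∈ ⨅ i : ℕ, m ^ i := (Submodule.mem_iInf _).2 fun k => key k t ht
  have h6 : (⨅ i : ℕ, m ^ i) ≤ ⊥ := (Ideal.iInf_pow_eq_bot_of_isDomain m hm).le
  exact sub_eq_zero.1 ((Submodule.mem_bot _).1 (h6 h5))

lemma mem_fixedClosure_of_fixes (hinj : Function.Injective ρ)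
    (hρ : ∀ s ∈ R, ∀ v, ρ s v = v - α s v • a s)
    (hα : ∀ s ∈ R, α s ≠ 0)
    (hconj : ∀ g, ∀ s ∈ R, g * s * g⁻¹ ∈ R) (hgen : Subgroup.closure R = ⊤) {v : ι → ℂ} {g : G}
    (hg : ρ g v = v) : g ∈ fixedClosure ρ R v := by
  classical
  set H := fixedClosure ρ R v
  have := Fintype.ofFinite H
  obtain ⟨x, -, hx⟩ := exists_generic ρ ⊤
  have hx1 (g : G) (h : ρ g x = x) : g = 1 := by
    refine hinj (LinearMap.ext fun u => ?_)
    rw [hx g h u trivial]; simp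
  obtain ⟨ℓ, hℓ⟩ := Module.exists_dual_forall_apply_ne_zero (K := ℂ)
    (fun g : {g : G // g ≠ 1} => ρ g x - x) fun g h => g.2 (hx1 g (sub_eq_zero.1 h))
  have hinv : ∀ h' ∈ H, pull (ρ h') (∏ h : H, pull (ρ h) (linPoly ℓ - C (ℓ x))) =
      ∏ h : H, pull (ρ h) (linPoly ℓ - C (ℓ x)) := by
    intro h' hh'
    rw [map_prod]
    simp_rw [← pull_rho_mul]
    exact Fintype.prod_equiv (Equiv.mulRight (⟨h', hh'⟩ : H)) _ _ fun m => rfl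
  have h1 := congrArg (eval x) (pull_eq_of_fixedClosure_inv hρ hα hconj hgen hinv hg)
  rw [eval_pull, map_prod, map_prod, Finset.prod_eq_zero (Finset.mem_univ (1 : H))
    (f := fun h : H => eval x _) (by simp [eval_pull, eval_linPoly]), Finset.prod_eq_zero_iff] at h1
  obtain ⟨h, -, hh⟩ := h1
  rw [eval_pull, map_sub, eval_linPoly, eval_C, ← map_sub, ← Module.End.mul_apply, ← map_mul] at hh
  have hhg : (h : G) * g = 1 := by
    by_contra hne
    exact hℓ ⟨_, hne⟩ hh
  rw [eq_inv_of_mul_eq_one_right hhg]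
  exact inv_mem h.2

end Steinberg

section Reflections

variable {V : Type*} [AddCommGroup V] [Module ℂ V]

/-- The codimension of the fixed space, as the rank of `1 - f`. -/
noncomputable def codimFix (f : Module.End ℂ V) : ℕ := finrank ℂ (LinearMap.range (1 - f))

lemma exists_root_of_codimFix_eq_one {f : Module.End ℂ V} (hf : codimFix f = 1) :
    ∃ (α : V →ₗ[ℂ] ℂ) (a : V), α ≠ 0 ∧ a ≠ 0 ∧ ∀ v, f v = v - α v • a := by
  obtain ⟨a, ha, hspan⟩ := finrank_eq_one_iff'.1 hf
  have hspan' (v : V) : ∃ c : ℂ, c • (a : V) = (1 - f) v := by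
    obtain ⟨c, hc⟩ := hspan ⟨(1 - f) v, v, rfl⟩
    exact ⟨c, congrArg Subtype.val hc⟩
  have ha' : (a : V) ≠ 0 := fun h => ha (Subtype.ext h)
  choose α hα using hspan'
  have hf' (v : V) : f v = v - α v • (a : V) := by rw [hα]; simp
  refine ⟨⟨⟨α, fun x y => ?_⟩, fun c x => ?_⟩, a, fun h0 => ?_, ha', hf'⟩
  · apply smul_left_injective ℂ ha'
    simp only [add_smul, hα, map_add]
  · apply smul_left_injective ℂ ha'
    simp only [mul_smul, hα, map_smul, RingHom.id_apply, smul_eq_mul]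
  · obtain ⟨u, hu⟩ := a.2
    apply ha'
    rw [← hu, ← hα u, show α u = 0 from LinearMap.congr_fun h0 u, zero_smul]

/-- A form of Steinberg's fixed point theorem: if a finite linear group is generated by a
conjugation-invariant set `R` of reflections, then the pointwise stabilizer of a subspace is
generated by the elements of `R` that it contains. -/
theorem pointStab_eq_closure [FiniteDimensional ℂ V] {G : Type*} [Group G] [Finite G]
    {ρ : Representation ℂ G V} (hinj : Function.Injective ρ) {R : Set G}
    (hR : ∀ s ∈ R, codimFix (ρ s) = 1) (hconj : ∀ g, ∀ s ∈ R, g * s * g⁻¹ ∈ R)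
    (hgen : Subgroup.closure R = ⊤) (U : Submodule ℂ V) :
    Subgroup.closure (R ∩ pointStab ρ (U : Set V)) = pointStab ρ (U : Set V) := by
  refine le_antisymm ((Subgroup.closure_le _).2 Set.inter_subset_right) fun g hg => ?_
  obtain ⟨u, hu, hgen_u⟩ := exists_generic ρ U
  let φ := (Module.finBasis ℂ V).equivFun
  let ρ' : Representation ℂ G (Fin (finrank ℂ V) → ℂ) := (φ.conjAlgEquiv ℂ).toMonoidHom.comp ρ
  have hρ' (g : G) (v) : ρ' g v = φ (ρ g (φ.symm v)) := rfl
  have hinj' : Function.Injective ρ' := (φ.conjAlgEquiv ℂ).injective.comp hinj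
  have hroot : ∀ s : G, ∃ (α : (Fin (finrank ℂ V) → ℂ) →ₗ[ℂ] ℂ) (a : Fin (finrank ℂ V) → ℂ),
      s ∈ R → α ≠ 0 ∧ ∀ v, ρ' s v = v - α v • a := by
    intro s
    by_cases hs : s ∈ R
    · obtain ⟨α, a, hα, -, h⟩ := exists_root_of_codimFix_eq_one (hR s hs)
      refine ⟨α ∘ₗ φ.symm.toLinearMap, φ a, fun _ => ⟨fun h0 => hα (LinearMap.ext fun v => ?_),
        fun v => ?_⟩⟩
      · simpa using LinearMap.congr_fun h0 (φ v)
      · simp [hρ', h]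
    · exact ⟨0, 0, fun h => absurd h hs⟩
  choose α a hαa using hroot
  have h1 := mem_fixedClosure_of_fixes (v := φ u) hinj' (fun s hs => (hαa s hs).2)
    (fun s hs => (hαa s hs).1) hconj hgen (g := g) (by rw [hρ']; simp [hg u hu])
  have hsub : {s | s ∈ R ∧ ρ' s (φ u) = φ u} ⊆ R ∩ pointStab ρ (U : Set V) := fun s hs =>
    ⟨hs.1, hgen_u s (by simpa [hρ'] using hs.2)⟩
  exact Subgroup.closure_mono hsub h1

end Reflections

section GaloisExtension

/-- An automorphism of a subfield of an algebraically closed field extends to the whole field. -/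
lemma exists_ringEquiv_extending {K L : Type*} [Field K] [Field L] [IsAlgClosed L] [Algebra K L]
    (γ : K ≃+* K) : ∃ σ : L ≃+* L, ∀ x : K, σ (algebraMap K L x) = algebraMap K L (γ x) := by
  obtain ⟨s, hs⟩ := exists_isTranscendenceBasis K L
  have := IsAlgClosed.isAlgClosure_of_transcendence_basis _ hs
  let e : Algebra.adjoin K (Set.range ((↑) : s → L)) ≃+* Algebra.adjoin K (Set.range ((↑) : s → L)) :=
    (hs.1.aevalEquiv.symm.toRingEquiv.trans (MvPolynomial.mapEquiv s γ)).trans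
      hs.1.aevalEquiv.toRingEquiv
  have he (x : K) : e (algebraMap K _ x) = algebraMap K _ (γ x) := by
    simp only [e, RingEquiv.trans_apply, AlgEquiv.coe_ringEquiv,
      AlgEquiv.commutes, MvPolynomial.algebraMap_eq, MvPolynomial.mapEquiv_apply,
      MvPolynomial.map_C, RingHom.coe_coe]
    rw [← MvPolynomial.algebraMap_eq, AlgEquiv.commutes]
  refine ⟨IsAlgClosure.equivOfEquiv L L e, fun x => ?_⟩
  rw [IsScalarTower.algebraMap_apply K (Algebra.adjoin K (Set.range ((↑) : s → L))) L,
    IsAlgClosure.equivOfEquiv_algebraMap, he, ← IsScalarTower.algebraMap_apply]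

lemma exists_ringEquiv_pow {m k : ℕ} (hm : m ≠ 0) (hk : k.Coprime m) :
    ∃ σ : ℂ ≃+* ℂ, ∀ ω : ℂ, ω ^ m = 1 → σ ω = ω ^ k := by
  have : NeZero m := ⟨hm⟩
  let L := CyclotomicField m ℚ
  have : IsCyclotomicExtension {m} ℚ L := CyclotomicField.isCyclotomicExtension m ℚ
  let f : L →+* ℂ := (IsAlgClosed.lift : L →ₐ[ℚ] ℂ)
  let : Algebra L ℂ := f.toAlgebra
  have hζ := IsCyclotomicExtension.zeta_spec m ℚ L
  have hμ := hζ.pow_of_coprime k hk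
  obtain ⟨σ, hσ⟩ := exists_ringEquiv_extending (L := ℂ) (IsCyclotomicExtension.fromZetaAut hμ
    (Polynomial.cyclotomic.irreducible_rat (Nat.pos_of_ne_zero hm)) : L ≃ₐ[ℚ] L).toRingEquiv
  refine ⟨σ, fun ω hω => ?_⟩
  obtain ⟨i, -, rfl⟩ := (hζ.map_of_injective (algebraMap L ℂ).injective).eq_pow_of_pow_eq_one hω
  have h := hσ (IsCyclotomicExtension.zeta m ℚ L)
  rw [AlgEquiv.coe_ringEquiv,
    IsCyclotomicExtension.fromZetaAut_spec, map_pow] at h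
  rw [map_pow, h, ← pow_mul, ← pow_mul, mul_comm]

end GaloisExtension

section Trace

variable {V : Type*} [AddCommGroup V] [Module ℂ V] [FiniteDimensional ℂ V]

/-- The projection onto the `ω`-eigenspace of an endomorphism `f` with `f ^ m = 1`. -/
noncomputable def eigenProj (m : ℕ) (ω : ℂ) (f : Module.End ℂ V) : Module.End ℂ V :=
  (m : ℂ)⁻¹ • ∑ i ∈ Finset.range m, ω⁻¹ ^ i • f ^ i

omit [FiniteDimensional ℂ V] in
lemma mul_eigenProj {m : ℕ} {ω : ℂ} (hω : ω ^ m = 1) {f : Module.End ℂ V} (hm : m ≠ 0)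
    (hf : f ^ m = 1) : f * eigenProj m ω f = ω • eigenProj m ω f := by
  have h0 : ω ≠ 0 := fun h => by rw [h, zero_pow hm] at hω; exact zero_ne_one hω
  have h1 : ∑ i ∈ Finset.range m, ω⁻¹ ^ (i + 1) • f ^ (i + 1) =
      ∑ i ∈ Finset.range m, ω⁻¹ ^ i • f ^ i := by
    have h2 := Finset.sum_range_succ (fun i => ω⁻¹ ^ i • f ^ i : ℕ → Module.End ℂ V) m
    rw [Finset.sum_range_succ'] at h2
    have h3 : ω⁻¹ ^ m • f ^ m = ω⁻¹ ^ 0 • f ^ 0 := by rw [hf, inv_pow, hω]; simp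
    rw [h3] at h2
    exact add_right_cancel h2
  rw [eigenProj, mul_smul_comm, smul_comm ω]
  congr 1
  conv_rhs => rw [← h1]
  rw [Finset.mul_sum, Finset.smul_sum]
  refine Finset.sum_congr rfl fun i _ => ?_
  rw [mul_smul_comm, smul_smul, pow_succ' f, pow_succ' ω⁻¹, mul_inv_cancel_left₀ h0]

omit [FiniteDimensional ℂ V] in
lemma eigenProj_idem {m : ℕ} {ω : ℂ} (hω : ω ^ m = 1) {f : Module.End ℂ V} (hm : m ≠ 0)
    (hf : f ^ m = 1) : IsIdempotentElem (eigenProj m ω f) := by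
  have h0 : ω ≠ 0 := fun h => by rw [h, zero_pow hm] at hω; exact zero_ne_one hω
  have h1 (i : ℕ) : f ^ i * eigenProj m ω f = ω ^ i • eigenProj m ω f := by
    induction i with
    | zero => simp
    | succ i ih => rw [pow_succ, mul_assoc, mul_eigenProj hω hm hf, mul_smul_comm, ih, smul_smul,
        ← pow_succ']
  have h2 : eigenProj m ω f * eigenProj m ω f =
      (m : ℂ)⁻¹ • ∑ i ∈ Finset.range m, ω⁻¹ ^ i • (f ^ i * eigenProj m ω f) := by
    conv_lhs => enter [1]; rw [eigenProj]
    rw [smul_mul_assoc, Finset.sum_mul]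
    simp_rw [smul_mul_assoc]
  have hm' : (m : ℂ) ≠ 0 := by exact_mod_cast hm
  rw [IsIdempotentElem, h2]
  simp_rw [h1, smul_smul, ← mul_pow, inv_mul_cancel₀ h0, one_pow, one_smul]
  rw [Finset.sum_const, Finset.card_range, ← Nat.cast_smul_eq_nsmul ℂ, smul_smul,
    inv_mul_cancel₀ hm', one_smul]

lemma trace_eigenProj {m : ℕ} {ω : ℂ} (hω : ω ^ m = 1) {f : Module.End ℂ V} (hm : m ≠ 0)
    (hf : f ^ m = 1) : LinearMap.trace ℂ V (eigenProj m ω f) =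
      finrank ℂ (LinearMap.range (eigenProj m ω f)) :=
  (eigenProj_idem hω hm hf).isProj_range.trace

lemma trace_pow_eq_sum {m : ℕ} (hm : m ≠ 0) {ζ : ℂ} (hζ : IsPrimitiveRoot ζ m)
    {f : Module.End ℂ V} (hf : f ^ m = 1) :
    ∃ n : ℕ → ℕ, ∀ k, LinearMap.trace ℂ V (f ^ k) =
      ∑ j ∈ Finset.range m, (n j : ℂ) * (ζ ^ j) ^ k := by
  refine ⟨fun j => finrank ℂ (LinearMap.range (eigenProj m (ζ ^ j) f)), fun k => ?_⟩
  have hm' : (m : ℂ) ≠ 0 := by exact_mod_cast hm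
  have hω (j : ℕ) : (ζ ^ j) ^ m = 1 := by rw [← pow_mul, mul_comm, pow_mul, hζ.pow_eq_one, one_pow]
  simp_rw [← trace_eigenProj (hω _) hm hf]
  have hone : ∑ j ∈ Finset.range m, eigenProj m (ζ ^ j) f = 1 := by
    simp_rw [eigenProj]
    rw [← Finset.smul_sum, Finset.sum_comm]
    simp_rw [← Finset.sum_smul]
    have h1 (i : ℕ) (hi : i ∈ Finset.range m) :
        (∑ j ∈ Finset.range m, (ζ ^ j)⁻¹ ^ i) • f ^ i = if i = 0 then (m : ℂ) • (1 : Module.End ℂ V)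
          else 0 := by
      split_ifs with h0
      · simp [h0]
      · have hne : (ζ⁻¹) ^ i ≠ 1 := by
          rw [inv_pow, inv_ne_one]
          exact hζ.pow_ne_one_of_pos_of_lt h0 (Finset.mem_range.1 hi)
        have h2 (j : ℕ) : (ζ ^ j)⁻¹ ^ i = (ζ⁻¹ ^ i) ^ j := by
          rw [← inv_pow, ← pow_mul, ← pow_mul, mul_comm]
        simp_rw [h2]
        rw [geom_sum_eq hne, ← pow_mul, mul_comm, pow_mul, inv_pow, hζ.pow_eq_one]
        simp
    rw [Finset.sum_congr rfl h1, Finset.sum_ite_eq' (Finset.range m) 0,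
      if_pos (Finset.mem_range.2 (Nat.pos_of_ne_zero hm)), smul_smul, inv_mul_cancel₀ hm', one_smul]
  have hk (k j : ℕ) : f ^ k * eigenProj m (ζ ^ j) f = (ζ ^ j) ^ k • eigenProj m (ζ ^ j) f := by
    induction k with
    | zero => simp
    | succ i ih => rw [pow_succ, mul_assoc, mul_eigenProj (hω j) hm hf, mul_smul_comm, ih, smul_smul,
        ← pow_succ']
  calc LinearMap.trace ℂ V (f ^ k)
      = LinearMap.trace ℂ V (f ^ k * ∑ j ∈ Finset.range m, eigenProj m (ζ ^ j) f) := by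
        rw [hone, mul_one]
    _ = _ := by
        rw [Finset.mul_sum, map_sum]
        simp_rw [hk, map_smul, smul_eq_mul, mul_comm]

lemma ringHom_trace {m k : ℕ} (hm : m ≠ 0) {σ : ℂ →+* ℂ} (hσ : ∀ ω : ℂ, ω ^ m = 1 → σ ω = ω ^ k)
    {f : Module.End ℂ V} (hf : f ^ m = 1) :
    σ (LinearMap.trace ℂ V f) = LinearMap.trace ℂ V (f ^ k) := by
  obtain ⟨ζ, hζ⟩ : ∃ ζ : ℂ, IsPrimitiveRoot ζ m := ⟨_, Complex.isPrimitiveRoot_exp m hm⟩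
  obtain ⟨n, hn⟩ := trace_pow_eq_sum hm hζ hf
  have h1 := hn 1
  rw [pow_one] at h1
  rw [hn k, h1, map_sum]
  refine Finset.sum_congr rfl fun j _ => ?_
  rw [map_mul, map_natCast, pow_one, hσ]
  rw [← pow_mul, mul_comm, pow_mul, hζ.pow_eq_one, one_pow]

lemma card_mul_codimFix {m : ℕ} (hm : m ≠ 0) {f : Module.End ℂ V} (hf : f ^ m = 1) :
    (m : ℂ) * codimFix f =
      ∑ i ∈ Finset.range m, (LinearMap.trace ℂ V 1 - LinearMap.trace ℂ V (f ^ i)) := by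
  have hm' : (m : ℂ) ≠ 0 := by exact_mod_cast hm
  have hidem := eigenProj_idem (one_pow m) hm hf
  have h1 : f * eigenProj m 1 f = eigenProj m 1 f := by
    simpa using mul_eigenProj (one_pow m) hm hf
  have h2 : LinearMap.range (eigenProj m 1 f) = LinearMap.ker (1 - f) := by
    refine le_antisymm ?_ fun x hx => ?_
    · rintro _ ⟨x, rfl⟩
      have := LinearMap.congr_fun h1 x
      simp only [Module.End.mul_apply] at this
      simp [this]
    · have hx' : f x = x := by
        have : x - f x = 0 := hx
        exact (sub_eq_zero.1 this).symm
      have hp (i : ℕ) : (f ^ i) x = x := by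
        induction i with
        | zero => simp
        | succ i ih => rw [pow_succ, Module.End.mul_apply, hx', ih]
      refine ⟨x, ?_⟩
      simp [eigenProj, hp, ← Nat.cast_smul_eq_nsmul ℂ, smul_smul, inv_mul_cancel₀ hm']
  have h3 := trace_eigenProj (one_pow m) hm hf
  have h4 := LinearMap.finrank_range_add_finrank_ker (1 - f)
  rw [h2] at h3
  have h5 : (codimFix f : ℂ) = finrank ℂ V - finrank ℂ (LinearMap.ker (1 - f)) := by
    rw [← h4, codimFix]; push_cast; ring
  rw [h5, ← h3, Finset.sum_sub_distrib, eigenProj, map_smul, map_sum, Finset.sum_const,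
    Finset.card_range, LinearMap.trace_one, nsmul_eq_mul, mul_sub, smul_eq_mul, mul_inv_cancel_left₀ hm']
  simp

lemma sum_coprime_eq_zero {m : ℕ} (hm : m ≠ 0) (D : ℕ → ℂ)
    (hD : ∀ d e, d * e = m → ∑ i ∈ Finset.range e, D (d * i) = 0) :
    ∑ k ∈ Finset.range m with k.Coprime m, D k = 0 := by
  induction m using Nat.strong_induction_on generalizing D with
  | _ m ih =>
  have h1 : ∑ i ∈ Finset.range m, D i =
      ∑ d ∈ m.divisors, ∑ i ∈ Finset.range m with i.gcd m = d, D i :=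
    (Finset.sum_fiberwise_of_maps_to (fun i _ =>
      Nat.mem_divisors.2 ⟨Nat.gcd_dvd_right _ _, hm⟩) _).symm
  have h2 : ∀ d ∈ m.divisors, d ≠ 1 → ∑ i ∈ Finset.range m with i.gcd m = d, D i = 0 := by
    intro d hd hd1
    obtain ⟨e, rfl⟩ := (Nat.mem_divisors.1 hd).1
    have hd0 : 0 < d := Nat.pos_of_ne_zero (left_ne_zero_of_mul hm)
    have he0 : 0 < e := Nat.pos_of_ne_zero (right_ne_zero_of_mul hm)
    rw [← ih e (by nlinarith [show 2 ≤ d by omega]) he0.ne' (fun i => D (d * i)) fun d' e' h => ?_]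
    · refine Finset.sum_nbij' (fun i => i / d) (fun i => d * i) ?_ ?_ ?_ ?_ ?_
      · intro i hi
        simp only [Finset.mem_filter, Finset.mem_range] at hi ⊢
        obtain ⟨c, rfl⟩ : d ∣ i := hi.2 ▸ Nat.gcd_dvd_left i (d * e)
        rw [Nat.mul_div_cancel_left _ hd0]
        rw [Nat.gcd_mul_left] at hi
        exact ⟨Nat.lt_of_mul_lt_mul_left hi.1, Nat.eq_of_mul_eq_mul_left hd0 (by rw [hi.2, mul_one])⟩
      · intro i hi
        simp only [Finset.mem_filter, Finset.mem_range] at hi ⊢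
        exact ⟨Nat.mul_lt_mul_of_pos_left hi.1 hd0, by
          rw [Nat.gcd_mul_left, Nat.Coprime.gcd_eq_one hi.2, mul_one]⟩
      · intro i hi
        simp only [Finset.mem_filter, Finset.mem_range] at hi
        exact Nat.mul_div_cancel' (hi.2 ▸ Nat.gcd_dvd_left i (d * e))
      · intro i _
        exact Nat.mul_div_cancel_left _ hd0
      · intro i hi
        simp only [Finset.mem_filter, Finset.mem_range] at hi
        rw [Nat.mul_div_cancel' (hi.2 ▸ Nat.gcd_dvd_left i (d * e))]
    · rw [← hD (d * d') e' (by rw [mul_assoc, h])]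
      simp_rw [mul_assoc]
  have h3 := hD 1 m (one_mul m)
  simp_rw [one_mul] at h3
  rw [h1, Finset.sum_eq_single_of_mem 1 (Nat.one_mem_divisors.2 hm) fun d hd h => h2 d hd h] at h3
  exact h3

lemma sum_coprime_trace_eq {W : Type*} [AddCommGroup W] [Module ℂ W] [FiniteDimensional ℂ W]
    {m : ℕ} (hm : m ≠ 0) {f : Module.End ℂ V} {f' : Module.End ℂ W}
    (hf : f ^ m = 1) (hf' : f' ^ m = 1) (hc : ∀ d, codimFix (f ^ d) = codimFix (f' ^ d)) :
    ∑ k ∈ Finset.range m with k.Coprime m, (LinearMap.trace ℂ V 1 - LinearMap.trace ℂ V (f ^ k)) =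
      ∑ k ∈ Finset.range m with k.Coprime m,
        (LinearMap.trace ℂ W 1 - LinearMap.trace ℂ W (f' ^ k)) := by
  rw [← sub_eq_zero, ← Finset.sum_sub_distrib]
  refine sum_coprime_eq_zero hm _ fun d e h => ?_
  have he : e ≠ 0 := right_ne_zero_of_mul (h.symm ▸ hm)
  rw [Finset.sum_sub_distrib, sub_eq_zero]
  simp_rw [pow_mul]
  rw [← card_mul_codimFix he (by rw [← pow_mul, h, hf]),
    ← card_mul_codimFix he (by rw [← pow_mul, h, hf']), hc]

end Trace

section CodimFix

variable {V : Type*} [AddCommGroup V] [Module ℂ V] [FiniteDimensional ℂ V]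

lemma codimFix_eq_zero {f : Module.End ℂ V} : codimFix f = 0 ↔ f = 1 := by
  rw [codimFix, Submodule.finrank_eq_zero, LinearMap.range_eq_bot, sub_eq_zero, eq_comm]

lemma codimFix_mul_le (f g : Module.End ℂ V) : codimFix (f * g) ≤ codimFix f + codimFix g := by
  have h : LinearMap.range (1 - f * g) ≤ LinearMap.range (1 - f) ⊔ LinearMap.range (1 - g) := by
    rw [show 1 - f * g = (1 - f) * g + (1 - g) by noncomm_ring]
    refine (LinearMap.range_add_le _ _).trans (sup_le_sup_right ?_ _)
    exact LinearMap.range_comp_le_range _ _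
  exact (Submodule.finrank_mono h).trans (Submodule.finrank_add_le_finrank_add_finrank _ _)

lemma codimFix_pow_le (f : Module.End ℂ V) (d : ℕ) : codimFix (f ^ d) ≤ codimFix f := by
  refine Submodule.finrank_mono ?_
  rw [← mul_neg_geom_sum f d]
  exact LinearMap.range_comp_le_range _ _

lemma codimFix_conj_le {f g h : Module.End ℂ V} (h1 : g * h = 1) :
    codimFix (g * f * h) ≤ codimFix f := by
  have : 1 - g * f * h = g * ((1 - f) * h) := by
    rw [sub_mul, mul_sub, one_mul, h1, mul_assoc]
  rw [codimFix, this, Module.End.mul_eq_comp, LinearMap.range_comp]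
  exact (Submodule.finrank_map_le _ _).trans
    (Submodule.finrank_mono (LinearMap.range_comp_le_range _ _))

lemma codimFix_conj {G : Type*} [Group G] (ρ : Representation ℂ G V) (g s : G) :
    codimFix (ρ (g * s * g⁻¹)) = codimFix (ρ s) := by
  have key (g s : G) : codimFix (ρ (g * s * g⁻¹)) ≤ codimFix (ρ s) := by
    rw [map_mul, map_mul]
    exact codimFix_conj_le (by rw [← map_mul, mul_inv_cancel, map_one])
  refine le_antisymm (key g s) ?_
  simpa [mul_assoc] using key g⁻¹ (g * s * g⁻¹)

/-- For a reflection `f`, the complement of the projection onto the fixed hyperplane has rank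
one. -/
lemma exists_root_of_eigenProj {m : ℕ} (hm : m ≠ 0) {f : Module.End ℂ V} (hf : f ^ m = 1)
    (hc : codimFix f = 1) : ∃ (β : V →ₗ[ℂ] ℂ) (a : V), β a = 1 ∧
      ∀ v, (1 - eigenProj m 1 f) v = β v • a := by
  have hm' : (m : ℂ) ≠ 0 := by exact_mod_cast hm
  have hE := eigenProj_idem (one_pow m) hm hf
  have htr : LinearMap.trace ℂ V (1 - eigenProj m 1 f) = codimFix f := by
    rw [← mul_right_inj' hm', card_mul_codimFix hm hf, eigenProj, map_sub, map_smul, map_sum,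
      mul_sub, smul_eq_mul, mul_inv_cancel_left₀ hm']
    simp
  rw [hE.one_sub.isProj_range.trace, Nat.cast_inj, hc] at htr
  obtain ⟨β, a, -, ha, h⟩ := exists_root_of_codimFix_eq_one (f := eigenProj m 1 f) htr
  have h' (v : V) : (1 - eigenProj m 1 f) v = β v • a := by simp [h]
  refine ⟨β, a, ?_, h'⟩
  have h1 : ∃ v, β v ≠ 0 := by
    by_contra! h0
    have : 1 - eigenProj m 1 f = 0 := LinearMap.ext fun v => by rw [h', h0]; simp
    rw [this, LinearMap.range_zero, finrank_bot] at htr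
    exact zero_ne_one htr
  obtain ⟨v, hv⟩ := h1
  have h2 := LinearMap.congr_fun hE.one_sub v
  rw [Module.End.mul_apply, h' v, map_smul, h' a] at h2
  exact smul_left_injective ℂ ha (by simpa using smul_right_injective V hv h2)

end CodimFix

section RankEquation

variable {P : Type*} [Group P] [Finite P] {V : Type*} [AddCommGroup V] [Module ℂ V]
  [FiniteDimensional ℂ V]

omit [Finite P] [FiniteDimensional ℂ V] in
lemma rho_pow_card (ρ : Representation ℂ P V) (g : P) : ρ g ^ Nat.card P = 1 := by
  rw [← map_pow, pow_card_eq_one', map_one]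

/-- The projection onto the root line of a reflection `s` along its hyperplane. -/
noncomputable def rootProj (ρ : Representation ℂ P V) (s : P) : Module.End ℂ V :=
  1 - eigenProj (Nat.card P) 1 (ρ s)

omit [FiniteDimensional ℂ V] in
lemma rootProj_mul_one_sub (ρ : Representation ℂ P V) (s : P) :
    rootProj ρ s * (1 - ρ s) = 1 - ρ s := by
  have h := mul_eigenProj (one_pow _) Nat.card_pos.ne' (rho_pow_card ρ s)
  have hcomm : Commute (eigenProj (Nat.card P) 1 (ρ s)) (ρ s) := by
    rw [eigenProj]
    refine Commute.smul_left (Commute.sum_left _ _ _ fun i _ => Commute.smul_left ?_ _) _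
    exact (Commute.refl _).pow_left i
  rw [rootProj, sub_mul, one_mul, mul_sub, mul_one, hcomm.eq, h, one_smul, sub_self, sub_zero]

omit [Finite P] [FiniteDimensional ℂ V] in
lemma rho_mul_rootProj (ρ : Representation ℂ P V) (g s : P) :
    ρ g * rootProj ρ s = rootProj ρ (g * s * g⁻¹) * ρ g := by
  have h (i : ℕ) : ρ (g * s * g⁻¹) ^ i * ρ g = ρ g * ρ s ^ i := by
    rw [← map_pow, ← map_pow, ← map_mul, ← map_mul, conj_pow]
    simp
  simp_rw [rootProj, eigenProj, sub_mul, mul_sub, one_mul, mul_one, smul_mul_assoc, mul_smul_comm,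
    Finset.sum_mul, Finset.mul_sum, smul_mul_assoc, mul_smul_comm, h]

omit [FiniteDimensional ℂ V] in
lemma rootProj_apply_of_fixed {ρ : Representation ℂ P V} {s : P} {v : V} (hv : ρ s v = v) :
    rootProj ρ s v = 0 := by
  have h := mul_eigenProj (one_pow (Nat.card P)) Nat.card_pos.ne' (rho_pow_card ρ s)
  have hp (i : ℕ) : (ρ s ^ i) v = v := by
    induction i with
    | zero => simp
    | succ i ih => rw [pow_succ, Module.End.mul_apply, hv, ih]
  have hm : (Nat.card P : ℂ) ≠ 0 := by exact_mod_cast Nat.card_pos.ne'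
  simp [rootProj, eigenProj, hp, ← Nat.cast_smul_eq_nsmul ℂ, smul_smul, inv_mul_cancel₀ hm]

/-- A group generated by reflections has rational weights on its reflections for which the
weighted sum of the root projections is the projection onto the span of the roots. -/
lemma exists_rank_weights {ρ : Representation ℂ P V} {R : Set P} [Fintype R]
    (hR : ∀ s, codimFix (ρ s) = 1 ↔ s ∈ R) (hgen : Subgroup.closure R = ⊤) :
    ∃ x : R → ℚ, (∀ t : R, ∑ s : R, (x s : ℂ) * LinearMap.trace ℂ V (rootProj ρ s * rootProj ρ t)
        = 1) ∧
      ∑ s : R, (x s : ℂ) + finrank ℂ ρ.invariants = finrank ℂ V := by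
  classical
  have hm : Nat.card P ≠ 0 := Nat.card_pos.ne'
  have hconj (g s : P) (hs : s ∈ R) : g * s * g⁻¹ ∈ R := by
    rw [← hR, codimFix_conj, hR]; exact hs
  choose β a hβ hq using fun s : R =>
    exists_root_of_eigenProj hm (rho_pow_card ρ s) ((hR s).2 s.2)
  replace hq (s : R) (v : V) : rootProj ρ s v = β s v • a s := hq s v
  have htrq (s : R) : LinearMap.trace ℂ V (rootProj ρ s) = 1 := by
    have : rootProj ρ s = (β s).smulRight (a s) := LinearMap.ext fun v => by simp [hq]
    rw [this, LinearMap.trace_smulRight, hβ]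
  set Z : Module.End ℂ V := ∑ s : R, rootProj ρ s with hZ
  have hZρ (g : P) : ρ g * Z = Z * ρ g := by
    rw [hZ, Finset.mul_sum, Finset.sum_mul]
    refine Fintype.sum_bijective (fun s : R => (⟨g * s * g⁻¹, hconj g s s.2⟩ : R)) ?_ _ _ fun s =>
      rho_mul_rootProj ρ g s
    refine (Fintype.bijective_iff_injective_and_card _).2 ⟨fun s t h => ?_, rfl⟩
    simpa [Subtype.ext_iff] using h
  have hZq (s : R) : rootProj ρ s * Z = Z * rootProj ρ s := by
    have h (i : ℕ) : ρ s ^ i * Z = Z * ρ s ^ i := by rw [← map_pow, hZρ]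
    simp_rw [rootProj, eigenProj, sub_mul, mul_sub, one_mul, mul_one, smul_mul_assoc,
      mul_smul_comm, Finset.sum_mul, Finset.mul_sum, smul_mul_assoc, mul_smul_comm, h]
  set μ : R → ℂ := fun s => β s (Z (a s))
  have hZa (s : R) : Z (a s) = μ s • a s := by
    have h := LinearMap.congr_fun (hZq s) (a s)
    simp only [Module.End.mul_apply, hq, hβ, one_smul] at h
    exact h.symm
  have hμ (s t : R) (h0 : β s (a t) ≠ 0) : μ s = μ t := by
    have has : a s ≠ 0 := fun h => by simpa [h] using hβ s
    have h := LinearMap.congr_fun (hZq s) (a t)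
    simp only [Module.End.mul_apply, hq, hZa, map_smul, smul_smul, smul_eq_mul] at h
    have h2 := smul_left_injective ℂ has h
    exact mul_right_cancel₀ h0 (by rw [h2, mul_comm])
  have hrat (t : R) : ∃ r : ℚ, (r : ℂ) * μ t = 1 := by
    set U : Submodule ℂ V := Submodule.span ℂ (a '' {s | μ s = μ t})
    set Y : Module.End ℂ V := ∑ s : R with μ s = μ t, rootProj ρ s
    have hYU (v : V) : Y v ∈ U := by
      simp only [Y, LinearMap.sum_apply, hq]
      exact Submodule.sum_mem _ fun s hs => Submodule.smul_mem _ _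
        (Submodule.subset_span ⟨s, (Finset.mem_filter.1 hs).2, rfl⟩)
    have hYa : ∀ u ∈ U, Y u = μ t • u := by
      intro u hu
      induction hu using Submodule.span_induction with
      | mem u hu =>
        obtain ⟨s, hs, rfl⟩ := hu
        have hs : μ s = μ t := hs
        rw [← hs, ← hZa, hZ, LinearMap.sum_apply, LinearMap.sum_apply]
        refine Finset.sum_subset (Finset.filter_subset _ _) fun r _ hr => ?_
        rw [hq]
        by_contra h0
        exact hr (Finset.mem_filter.2 ⟨Finset.mem_univ _, (hμ r s fun h => h0 (by simp [h])).trans hs⟩)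
      | zero => simp
      | add u v _ _ hu hv => rw [map_add, hu, hv, smul_add]
      | smul c u _ hu => rw [map_smul, hu, smul_comm]
    have h1 : LinearMap.trace ℂ V Y = μ t * finrank ℂ U := by
      rw [← LinearMap.trace_restrict_eq_of_forall_mem U Y hYU]
      have : Y.restrict (fun u _ => hYU u) = μ t • (1 : Module.End ℂ U) :=
        LinearMap.ext fun u => Subtype.ext (by simpa using hYa u u.2)
      rw [this, map_smul, LinearMap.trace_one, smul_eq_mul]
    have h2 : LinearMap.trace ℂ V Y = (Finset.univ.filter fun s : R => μ s = μ t).card := by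
      simp [Y, htrq]
    have h3 : ((Finset.univ.filter fun s : R => μ s = μ t).card : ℂ) ≠ 0 := by
      rw [Nat.cast_ne_zero]
      exact Finset.card_ne_zero_of_mem (Finset.mem_filter.2 ⟨Finset.mem_univ t, rfl⟩)
    refine ⟨finrank ℂ U / (Finset.univ.filter fun s : R => μ s = μ t).card, ?_⟩
    push_cast
    rw [div_mul_eq_mul_div, mul_comm, ← h1, h2, div_self h3]
  choose x hx using hrat
  set Y : Module.End ℂ V := ∑ s : R, (x s : ℂ) • rootProj ρ s
  have hYa (t : R) : Y (a t) = a t := by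
    have h1 (s : R) : (x s : ℂ) • rootProj ρ s (a t) = (x t : ℂ) • rootProj ρ s (a t) := by
      rw [hq]
      by_cases h0 : β s (a t) = 0
      · simp [h0]
      · have : (x s : ℂ) = x t := by
          rw [eq_inv_of_mul_eq_one_left (hx s), eq_inv_of_mul_eq_one_left (hx t), hμ s t h0]
        rw [this]
    simp only [Y, LinearMap.sum_apply, LinearMap.smul_apply, h1]
    rw [← Finset.smul_sum, ← LinearMap.sum_apply, ← hZ, hZa, smul_smul, hx, one_smul]
  have hYq (t : R) : Y * rootProj ρ t = rootProj ρ t := LinearMap.ext fun v => by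
    rw [Module.End.mul_apply, hq, map_smul, hYa]
  refine ⟨x, fun t => ?_, ?_⟩
  · rw [← htrq t]
    conv_rhs => rw [← hYq t, Finset.sum_mul, map_sum]
    simp_rw [smul_mul_assoc, map_smul, smul_eq_mul]
  · have hY1 (g : P) : ∀ v, Y (v - ρ g v) = v - ρ g v := by
      have hg : g ∈ Subgroup.closure R := hgen ▸ Subgroup.mem_top g
      induction hg using Subgroup.closure_induction with
      | mem s hs =>
        intro v
        have h := rootProj_mul_one_sub ρ s
        have h2 := LinearMap.congr_fun (hYq ⟨s, hs⟩) ((1 - ρ s) v)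
        rw [← Module.End.mul_apply, mul_assoc] at h2
        simp only [← Module.End.mul_apply, h] at h2
        exact h2
      | one => simp
      | mul g h _ _ hg hh =>
        intro v
        have : v - ρ (g * h) v = (v - ρ h v) + (ρ h v - ρ g (ρ h v)) := by simp
        rw [this, map_add, hg, hh]
      | inv g _ hg =>
        intro v
        have : v - ρ g⁻¹ v = -(ρ g⁻¹ v - ρ g (ρ g⁻¹ v)) := by simp
        rw [this, map_neg, hg]
    have := Fintype.ofFinite P
    have : Invertible (Fintype.card P : ℂ) := invertibleOfNonzero (by simp)
    have hA := (Representation.isProj_averageMap ρ)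
    have hYA : Y = 1 - Representation.averageMap ρ := by
      refine LinearMap.ext fun v => ?_
      have hfix : Y (Representation.averageMap ρ v) = 0 := by
        simp only [Y, LinearMap.sum_apply, LinearMap.smul_apply]
        exact Finset.sum_eq_zero fun s _ => by
          rw [rootProj_apply_of_fixed (hA.map_mem v s), smul_zero]
      have hcard : (Fintype.card P : ℂ) ≠ 0 := by simp
      have hav : v - Representation.averageMap ρ v =
          (Fintype.card P : ℂ)⁻¹ • ∑ g, (v - ρ g v) := by
        simp [GroupAlgebra.average, smul_sub, ← Nat.cast_smul_eq_nsmul ℂ, smul_smul]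
      have h1 : Y (v - Representation.averageMap ρ v) = v - Representation.averageMap ρ v := by
        rw [hav, map_smul, map_sum]
        simp_rw [hY1]
      rwa [map_sub, hfix, sub_zero] at h1
    have htr := congrArg (LinearMap.trace ℂ V) hYA
    rw [map_sub, LinearMap.trace_one, hA.trace, map_sum] at htr
    simp only [map_smul, htrq, smul_eq_mul, mul_one] at htr
    rw [htr]; ring

omit [FiniteDimensional ℂ V] in
lemma card_sq_mul_trace_rootProj (ρ : Representation ℂ P V) (s t : P) :
    (Nat.card P : ℂ) ^ 2 * LinearMap.trace ℂ V (rootProj ρ s * rootProj ρ t) =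
      ∑ i ∈ Finset.range (Nat.card P), ∑ j ∈ Finset.range (Nat.card P),
        ((LinearMap.trace ℂ V 1 - LinearMap.trace ℂ V (ρ (s ^ i))) +
          (LinearMap.trace ℂ V 1 - LinearMap.trace ℂ V (ρ (t ^ j))) -
          (LinearMap.trace ℂ V 1 - LinearMap.trace ℂ V (ρ (s ^ i * t ^ j)))) := by
  have hm : (Nat.card P : ℂ) ≠ 0 := by exact_mod_cast Nat.card_pos.ne'
  have h (s : P) : (Nat.card P : ℂ) • rootProj ρ s =
      ∑ i ∈ Finset.range (Nat.card P), (1 - ρ (s ^ i)) := by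
    rw [rootProj, eigenProj, smul_sub, smul_smul, mul_inv_cancel₀ hm, Finset.sum_sub_distrib]
    simp [Nat.cast_smul_eq_nsmul]
  have h2 : (Nat.card P : ℂ) ^ 2 * LinearMap.trace ℂ V (rootProj ρ s * rootProj ρ t) =
      LinearMap.trace ℂ V (((Nat.card P : ℂ) • rootProj ρ s) * ((Nat.card P : ℂ) • rootProj ρ t)) := by
    rw [smul_mul_smul_comm, map_smul, smul_eq_mul, sq]
  rw [h2, h, h, Finset.sum_mul_sum, map_sum]
  refine Finset.sum_congr rfl fun i _ => ?_
  rw [map_sum]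
  refine Finset.sum_congr rfl fun j _ => ?_
  have : (1 - ρ (s ^ i)) * (1 - ρ (t ^ j)) = 1 - ρ (s ^ i) - ρ (t ^ j) + ρ (s ^ i * t ^ j) := by
    rw [map_mul]; noncomm_ring
  rw [this, map_add, map_sub, map_sub]
  ring

/-- The Galois-averaged Gram matrix of the reflections, in terms of traces. -/
noncomputable def gramSum (ρ : Representation ℂ P V) (s t : P) : ℂ :=
  ∑ k ∈ Finset.range (Nat.card P) with k.Coprime (Nat.card P),
    ∑ i ∈ Finset.range (Nat.card P), ∑ j ∈ Finset.range (Nat.card P),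
        ((LinearMap.trace ℂ V 1 - LinearMap.trace ℂ V (ρ (s ^ i) ^ k)) +
          (LinearMap.trace ℂ V 1 - LinearMap.trace ℂ V (ρ (t ^ j) ^ k)) -
          (LinearMap.trace ℂ V 1 - LinearMap.trace ℂ V (ρ (s ^ i * t ^ j) ^ k)))

lemma sum_weights_gramSum {ρ : Representation ℂ P V} {R : Set P} [Fintype R] {x : R → ℚ} {t : R}
    (hx : ∑ s : R, (x s : ℂ) * LinearMap.trace ℂ V (rootProj ρ s * rootProj ρ t) = 1) :
    ∑ s : R, (x s : ℂ) * gramSum ρ s t =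
      (Nat.card P).totient * (Nat.card P : ℂ) ^ 2 := by
  have hm : Nat.card P ≠ 0 := Nat.card_pos.ne'
  have hk (k : ℕ) (hk : k.Coprime (Nat.card P)) : ∑ s : R, (x s : ℂ) *
      ∑ i ∈ Finset.range (Nat.card P), ∑ j ∈ Finset.range (Nat.card P),
        ((LinearMap.trace ℂ V 1 - LinearMap.trace ℂ V (ρ ((s : P) ^ i) ^ k)) +
          (LinearMap.trace ℂ V 1 - LinearMap.trace ℂ V (ρ ((t : P) ^ j) ^ k)) -
          (LinearMap.trace ℂ V 1 - LinearMap.trace ℂ V (ρ ((s : P) ^ i * (t : P) ^ j) ^ k))) =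
      (Nat.card P : ℂ) ^ 2 := by
    obtain ⟨σ, hσ⟩ := exists_ringEquiv_pow hm hk
    have htr (g : P) : LinearMap.trace ℂ V (ρ g ^ k) = σ (LinearMap.trace ℂ V (ρ g)) :=
      (ringHom_trace (σ := (σ : ℂ →+* ℂ)) hm hσ (rho_pow_card ρ g)).symm
    have h1 : σ (LinearMap.trace ℂ V 1) = LinearMap.trace ℂ V 1 := by simp
    have h2 (s : R) := congrArg σ (card_sq_mul_trace_rootProj ρ s t)
    simp_rw [map_sum σ, map_sub σ, map_add σ, map_sub σ, ← htr, h1] at h2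
    simp_rw [← h2]
    have hs (s : R) : (x s : ℂ) * σ ((Nat.card P : ℂ) ^ 2 * LinearMap.trace ℂ V
        (rootProj ρ s * rootProj ρ t)) = (Nat.card P : ℂ) ^ 2 *
          σ ((x s : ℂ) * LinearMap.trace ℂ V (rootProj ρ s * rootProj ρ t)) := by
      rw [map_mul σ, map_mul σ, map_pow, map_natCast, map_ratCast]
      ring
    simp_rw [hs]
    rw [← Finset.mul_sum, ← map_sum, hx, map_one, mul_one]
  simp_rw [gramSum]
  simp_rw [Finset.mul_sum (Finset.filter _ _)]
  rw [Finset.sum_comm, Finset.sum_congr rfl fun k hk' => hk k (Finset.mem_filter.1 hk').2,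
    Finset.sum_const, nsmul_eq_mul, Nat.totient_eq_card_coprime]
  simp_rw [Nat.coprime_comm]

omit [Finite P] [FiniteDimensional ℂ V] in
lemma gramSum_comm (ρ : Representation ℂ P V) (s t : P) : gramSum ρ s t = gramSum ρ t s := by
  refine Finset.sum_congr rfl fun k _ => ?_
  rw [Finset.sum_comm]
  refine Finset.sum_congr rfl fun i _ => Finset.sum_congr rfl fun j _ => ?_
  have h : (t ^ i * s ^ j) ^ k = (s ^ j)⁻¹ * (s ^ j * t ^ i) ^ k * (s ^ j)⁻¹⁻¹ := by
    rw [← conj_pow]; congr 1; group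
  have h2 := ρ.char_conj ((s ^ j * t ^ i) ^ k) (s ^ j)⁻¹
  rw [← h, Representation.character, Representation.character] at h2
  have h3 : LinearMap.trace ℂ V (ρ (t ^ i * s ^ j) ^ k) =
      LinearMap.trace ℂ V (ρ (s ^ j * t ^ i) ^ k) := by
    rw [← map_pow, ← map_pow, h2]
  linear_combination -h3

omit [Finite P] in
lemma codimFix_pow_mul_pow_le {ρ : Representation ℂ P V} {s t : P} (hs : codimFix (ρ s) = 1)
    (ht : codimFix (ρ t) = 1) (i j d : ℕ) : codimFix (ρ ((s ^ i * t ^ j) ^ d)) ≤ 2 := by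
  rw [map_pow, map_mul, map_pow, map_pow]
  refine (codimFix_pow_le _ _).trans ((codimFix_mul_le _ _).trans ?_)
  have h1 := codimFix_pow_le (ρ s) i
  have h2 := codimFix_pow_le (ρ t) j
  omega

/-- If two faithful representations of a finite group have the same reflections and these
generate the group, then their invariants have the same codimension. -/
theorem finrank_add_finrank_invariants {W : Type*} [AddCommGroup W] [Module ℂ W]
    [FiniteDimensional ℂ W] {ρ : Representation ℂ P V} {ρ' : Representation ℂ P W}
    (hinj : Function.Injective ρ) (hinj' : Function.Injective ρ') {R : Set P}
    (hR : ∀ s, codimFix (ρ s) = 1 ↔ s ∈ R) (hR' : ∀ s, codimFix (ρ' s) = 1 ↔ s ∈ R)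
    (hgen : Subgroup.closure R = ⊤) :
    finrank ℂ V + finrank ℂ ρ'.invariants = finrank ℂ W + finrank ℂ ρ.invariants := by
  classical
  have := Fintype.ofFinite R
  obtain ⟨x, hx, hxV⟩ := exists_rank_weights hR hgen
  obtain ⟨y, hy, hyW⟩ := exists_rank_weights hR' hgen
  have hm : Nat.card P ≠ 0 := Nat.card_pos.ne'
  have hcodim (g : P) (h : codimFix (ρ g) ≤ 2) (h' : codimFix (ρ' g) ≤ 2) :
      codimFix (ρ g) = codimFix (ρ' g) := by
    have h0 : codimFix (ρ g) = 0 ↔ codimFix (ρ' g) = 0 := by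
      rw [codimFix_eq_zero, codimFix_eq_zero, map_eq_one_iff ρ hinj, map_eq_one_iff ρ' hinj']
    have h1 := (hR g).trans (hR' g).symm
    omega
  have hsum (s t : R) (i j : ℕ) := sum_coprime_trace_eq (f := ρ ((s : P) ^ i * (t : P) ^ j))
    (f' := ρ' ((s : P) ^ i * (t : P) ^ j)) hm (rho_pow_card ρ _) (rho_pow_card ρ' _) fun d => by
      rw [← map_pow, ← map_pow]; exact hcodim _
        (codimFix_pow_mul_pow_le ((hR s).2 s.2) ((hR t).2 t.2) i j d)
        (codimFix_pow_mul_pow_le ((hR' s).2 s.2) ((hR' t).2 t.2) i j d)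
  have hgram (s t : R) : gramSum ρ s t = gramSum ρ' s t := by
    rw [gramSum, gramSum, Finset.sum_comm, Finset.sum_comm (s := Finset.filter _ _)]
    refine Finset.sum_congr rfl fun i _ => ?_
    rw [Finset.sum_comm, Finset.sum_comm (s := Finset.filter _ _)]
    refine Finset.sum_congr rfl fun j _ => ?_
    have h1 := hsum s t i 0
    have h2 := hsum s t 0 j
    simp only [pow_zero, mul_one, one_mul] at h1 h2
    simp only [Finset.sum_sub_distrib (s := Finset.filter _ _), Finset.sum_add_distrib] at h1 h2 ⊢
    have h3 := hsum s t i j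
    simp only [Finset.sum_sub_distrib (s := Finset.filter _ _)] at h3
    rw [h1, h2, h3]
  have h1 : (Nat.card P).totient * (Nat.card P : ℂ) ^ 2 * ∑ s : R, (y s : ℂ) =
      (Nat.card P).totient * (Nat.card P : ℂ) ^ 2 * ∑ t : R, (x t : ℂ) := by
    rw [Finset.mul_sum, Finset.mul_sum]
    have hx' (s : R) : (y s : ℂ) * ∑ t : R, (x t : ℂ) * gramSum ρ t s =
        (Nat.card P).totient * (Nat.card P : ℂ) ^ 2 * y s := by
      rw [sum_weights_gramSum (hx s), mul_comm]
    have hy' (t : R) : (x t : ℂ) * ∑ s : R, (y s : ℂ) * gramSum ρ' s t =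
        (Nat.card P).totient * (Nat.card P : ℂ) ^ 2 * x t := by
      rw [sum_weights_gramSum (hy t), mul_comm]
    simp_rw [← hx', ← hy', Finset.mul_sum]
    rw [Finset.sum_comm]
    refine Finset.sum_congr rfl fun t _ => Finset.sum_congr rfl fun s _ => ?_
    rw [gramSum_comm ρ, hgram]
    ring
  have h0 : ((Nat.card P).totient * (Nat.card P : ℂ) ^ 2) ≠ 0 :=
    mul_ne_zero (by exact_mod_cast (Nat.totient_pos.2 Nat.card_pos).ne')
      (pow_ne_zero _ (by exact_mod_cast hm))
  have h2 := mul_left_cancel₀ h0 h1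
  have h3 : ((finrank ℂ V + finrank ℂ ρ'.invariants : ℕ) : ℂ) =
      (finrank ℂ W + finrank ℂ ρ.invariants : ℕ) := by
    push_cast
    rw [← hxV, ← hyW, h2]
    ring
  exact_mod_cast h3

end RankEquation

section ElementCodim

variable {G : Type*} [Group G] {V W : Type*} [AddCommGroup V] [Module ℂ V] [AddCommGroup W]
  [Module ℂ W]

/-- Irreducibility of a representation, in terms of invariant subspaces. -/
def IsIrred (ρ : Representation ℂ G V) : Prop :=
  Nontrivial V ∧ ∀ U : Submodule ℂ V, (∀ g, ∀ u ∈ U, ρ g u ∈ U) → U = ⊥ ∨ U = ⊤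

lemma IsIrred.isIrreducible {ρ : Representation ℂ G V} (h : IsIrred ρ) : ρ.IsIrreducible := by
  have := h.1
  refine { exists_pair_ne := ⟨⊥, ⊤, fun h0 => ?_⟩, eq_bot_or_eq_top := fun U => ?_ }
  · exact bot_ne_top (congrArg Subrepresentation.toSubmodule h0 : (⊥ : Submodule ℂ V) = ⊤)
  · refine (h.2 U.toSubmodule U.apply_mem_toSubmodule).imp (fun hU => ?_) fun hU => ?_
    · exact Subrepresentation.toSubmodule_injective hU
    · exact Subrepresentation.toSubmodule_injective hU

variable [Finite G] [FiniteDimensional ℂ V] [FiniteDimensional ℂ W]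

lemma codimFix_add_finrank_ker (f : Module.End ℂ V) :
    codimFix f + finrank ℂ (LinearMap.ker (1 - f)) = finrank ℂ V :=
  LinearMap.finrank_range_add_finrank_ker _

lemma codimFix_le_of_reflections_eq {ρ : Representation ℂ G V} {ρ' : Representation ℂ G W}
    (hinj : Function.Injective ρ) (hinj' : Function.Injective ρ') {R : Set G}
    (hR : ∀ s, codimFix (ρ s) = 1 ↔ s ∈ R) (hR' : ∀ s, codimFix (ρ' s) = 1 ↔ s ∈ R)
    (hgen : Subgroup.closure R = ⊤) (g : G) : codimFix (ρ' g) ≤ codimFix (ρ g) := by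
  have hconj (g s : G) (hs : s ∈ R) : g * s * g⁻¹ ∈ R := by
    rw [← hR, codimFix_conj, hR]; exact hs
  set U := LinearMap.ker (1 - ρ g)
  have hmem {f : Module.End ℂ V} {v : V} : v ∈ LinearMap.ker (1 - f) ↔ f v = v := by
    rw [LinearMap.mem_ker, LinearMap.sub_apply, sub_eq_zero, Module.End.one_apply, eq_comm]
  set P := pointStab ρ (U : Set V)
  have hgP : g ∈ P := fun u hu => hmem.1 hu
  have hcl := pointStab_eq_closure hinj (fun s hs => (hR s).2 hs) hconj hgen U
  have hgenP : Subgroup.closure (((↑) : P → G) ⁻¹' R) = ⊤ := by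
    apply Subgroup.map_injective P.subtype_injective
    rw [MonoidHom.map_closure, ← MonoidHom.range_eq_map, Subgroup.range_subtype]
    refine Eq.trans (congrArg Subgroup.closure ?_) hcl
    ext s
    simp [P]
  have hB := finrank_add_finrank_invariants (ρ := ρ.comp P.subtype) (ρ' := ρ'.comp P.subtype)
    (hinj.comp P.subtype_injective) (hinj'.comp P.subtype_injective)
    (fun s => hR s) (fun s => hR' s) hgenP
  have h1 : Representation.invariants (ρ.comp P.subtype) ≤ U := fun v hv =>
    hmem.2 (hv ⟨g, hgP⟩)
  have h2 : U ≤ Representation.invariants (ρ.comp P.subtype) := fun v hv p => p.2 v hv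
  have h3 : Representation.invariants (ρ'.comp P.subtype) ≤ LinearMap.ker (1 - ρ' g) := fun v hv =>
    LinearMap.mem_ker.2 (sub_eq_zero.2 (hv ⟨g, hgP⟩).symm)
  have h4 := Submodule.finrank_mono h3
  have h5 : _ + finrank ℂ U = _ := codimFix_add_finrank_ker (ρ g)
  have h6 := codimFix_add_finrank_ker (ρ' g)
  rw [le_antisymm h1 h2] at hB
  omega

/-- If two faithful representations of a finite group have the same reflections and these
generate the group, then every element has fixed spaces of the same codimension. -/
theorem codimFix_eq_of_reflections_eq {ρ : Representation ℂ G V} {ρ' : Representation ℂ G W}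
    (hinj : Function.Injective ρ) (hinj' : Function.Injective ρ') {R : Set G}
    (hR : ∀ s, codimFix (ρ s) = 1 ↔ s ∈ R) (hR' : ∀ s, codimFix (ρ' s) = 1 ↔ s ∈ R)
    (hgen : Subgroup.closure R = ⊤) (g : G) : codimFix (ρ g) = codimFix (ρ' g) :=
  le_antisymm (codimFix_le_of_reflections_eq hinj' hinj hR' hR hgen g)
    (codimFix_le_of_reflections_eq hinj hinj' hR hR' hgen g)

omit [Finite G] [FiniteDimensional ℂ V] in
lemma IsIrred.finrank_eq_one_of_subsingleton [Subsingleton G] {ρ : Representation ℂ G V}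
    (h : IsIrred ρ) : finrank ℂ V = 1 := by
  have := h.1
  obtain ⟨v, hv⟩ := exists_ne (0 : V)
  have h1 := (h.2 (ℂ ∙ v) fun g u hu => by
    rw [Subsingleton.elim g 1, map_one]; exact hu).resolve_left (by simpa using hv)
  rw [← finrank_top, ← h1, finrank_span_singleton hv]

omit [Finite G] [FiniteDimensional ℂ V] in
lemma IsIrred.invariants_eq_bot [Nontrivial G] {ρ : Representation ℂ G V}
    (hinj : Function.Injective ρ) (h : IsIrred ρ) : ρ.invariants = ⊥ := by
  refine (h.2 ρ.invariants fun g u hu => ?_).resolve_right fun htop => ?_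
  · rw [hu g]; exact hu
  · obtain ⟨g, hg⟩ := exists_ne (1 : G)
    refine hg (hinj (LinearMap.ext fun v => ?_))
    have : v ∈ ρ.invariants := htop ▸ Submodule.mem_top
    rw [this g]; simp

theorem finrank_eq_of_reflections_eq {ρ : Representation ℂ G V} {ρ' : Representation ℂ G W}
    (hinj : Function.Injective ρ) (hinj' : Function.Injective ρ') (hi : IsIrred ρ)
    (hi' : IsIrred ρ') {R : Set G}
    (hR : ∀ s, codimFix (ρ s) = 1 ↔ s ∈ R) (hR' : ∀ s, codimFix (ρ' s) = 1 ↔ s ∈ R)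
    (hgen : Subgroup.closure R = ⊤) : finrank ℂ V = finrank ℂ W := by
  rcases subsingleton_or_nontrivial G with h | h
  · rw [hi.finrank_eq_one_of_subsingleton, hi'.finrank_eq_one_of_subsingleton]
  · have hB := finrank_add_finrank_invariants hinj hinj' hR hR' hgen
    rw [hi.invariants_eq_bot hinj, hi'.invariants_eq_bot hinj', finrank_bot, finrank_bot] at hB
    exact hB

end ElementCodim

section CommutingReflections

variable {V : Type*} [AddCommGroup V] [Module ℂ V]

lemma exists_root_of_pow_eq_one {m : ℕ} (hm : m ≠ 0) {f : Module.End ℂ V} (hf : f ^ m = 1)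
    (hc : codimFix f = 1) :
    ∃ (α : V →ₗ[ℂ] ℂ) (a : V), α a ≠ 0 ∧ ∀ v, f v = v - α v • a := by
  obtain ⟨α, a, hα, ha, h⟩ := exists_root_of_codimFix_eq_one hc
  refine ⟨α, a, fun h0 => hα (LinearMap.ext fun v => ?_), h⟩
  have hp (i : ℕ) : (f ^ i) v = v - (i * α v) • a := by
    induction i with
    | zero => simp
    | succ i ih =>
      rw [pow_succ', Module.End.mul_apply, ih, h, map_sub, map_smul, h0, smul_zero, sub_zero]
      push_cast
      module
  have h1 := hp m
  rw [hf, Module.End.one_apply, eq_comm, sub_eq_self, smul_eq_zero, or_iff_left ha] at h1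
  simpa [hm] using h1

lemma det_of_root [FiniteDimensional ℂ V] {f : Module.End ℂ V} {α : V →ₗ[ℂ] ℂ} {a : V}
    (h : ∀ v, f v = v - α v • a) : LinearMap.det f = 1 - α a := by
  have : f = LinearMap.transvection (-α) a := LinearMap.ext fun v => by
    simp [h, LinearMap.transvection.apply, sub_eq_add_neg]
  rw [this, LinearMap.transvection.det, LinearMap.neg_apply, sub_eq_add_neg]

lemma mem_ker_one_sub {f : Module.End ℂ V} {v : V} : v ∈ LinearMap.ker (1 - f) ↔ f v = v := by
  rw [LinearMap.mem_ker, LinearMap.sub_apply, sub_eq_zero, Module.End.one_apply, eq_comm]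

lemma mem_ker_of_root {f : Module.End ℂ V} {α : V →ₗ[ℂ] ℂ} {a : V} (ha : α a ≠ 0)
    (h : ∀ v, f v = v - α v • a) {v : V} : v ∈ LinearMap.ker (1 - f) ↔ α v = 0 := by
  have : a ≠ 0 := fun h0 => ha (by simp [h0])
  rw [mem_ker_one_sub, h, sub_eq_self, smul_eq_zero, or_iff_left this]

/-- Two commuting reflections with non-orthogonal roots have the same root line and the same
hyperplane. -/
lemma parallel_of_commute {f h : Module.End ℂ V} {α β : V →ₗ[ℂ] ℂ} {a b : V}
    (hf : ∀ v, f v = v - α v • a) (hh : ∀ v, h v = v - β v • b) (ha : α a ≠ 0) (hb : β b ≠ 0)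
    (hfh : f * h = h * f) (hab : α b ≠ 0) :
    ∃ r c : ℂ, r ≠ 0 ∧ c ≠ 0 ∧ b = r • a ∧ ∀ v, β v = c * α v := by
  have key (v : V) : (α b * β v) • a = (β a * α v) • b := by
    have := LinearMap.congr_fun hfh v
    simp only [Module.End.mul_apply, hf, hh, map_sub, map_smul, smul_eq_mul] at this
    rw [← sub_eq_zero] at this ⊢
    rw [← this]
    module
  have ha0 : a ≠ 0 := fun h0 => ha (by simp [h0])
  have h1 := key b
  have hβa : β a ≠ 0 := by
    intro h0
    rw [h0, zero_mul, zero_smul, smul_eq_zero, or_iff_left ha0] at h1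
    exact mul_ne_zero hab hb h1
  have hba : b = (β b / β a) • a := by
    have h2 := congrArg (fun v => (β a * α b)⁻¹ • v) h1
    simp only [smul_smul, inv_mul_cancel₀ (mul_ne_zero hβa hab), one_smul] at h2
    refine h2.symm.trans ?_
    congr 1
    field_simp
  refine ⟨β b / β a, β b / α b, div_ne_zero hb hβa, div_ne_zero hb hab, hba, fun v => ?_⟩
  have h3 := key v
  rw [hba, smul_smul, ← hba] at h3
  have h4 : α b * β v = β a * α v * (β b / β a) := smul_left_injective ℂ ha0 h3
  field_simp at h4 ⊢
  linear_combination h4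

/-- Two commuting reflections whose product is a reflection have the same root line and the same
hyperplane. -/
lemma apply_root_ne_zero_of_mul [FiniteDimensional ℂ V] {f h : Module.End ℂ V} {α β : V →ₗ[ℂ] ℂ}
    {a b : V} (hf : ∀ v, f v = v - α v • a) (hh : ∀ v, h v = v - β v • b) (ha : α a ≠ 0)
    (hb : β b ≠ 0) (hfh : f * h = h * f) (hc : codimFix (f * h) = 1) : α b ≠ 0 := by
  intro hab
  have hba : β a = 0 := by
    by_contra h0
    obtain ⟨r, c, -, hc, -, h⟩ := parallel_of_commute hh hf hb ha hfh.symm h0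
    rw [h b] at hab
    exact mul_ne_zero hc hb hab
  have h1 (v : V) : (1 - f * h) v = β v • b + α v • a := by
    simp only [LinearMap.sub_apply, Module.End.one_apply, Module.End.mul_apply, hf, hh, map_sub,
      map_smul, hab, smul_zero, sub_zero]
    abel
  obtain ⟨u, -, hu⟩ := finrank_eq_one_iff'.1 hc
  have ha' : (1 - f * h) ((α a)⁻¹ • a) = a := by simp [h1, hba, ha]
  have hb' : (1 - f * h) ((β b)⁻¹ • b) = b := by simp [h1, hab, hb]
  obtain ⟨x, hx⟩ := hu ⟨a, _, ha'⟩
  obtain ⟨y, hy⟩ := hu ⟨b, _, hb'⟩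
  replace hx : x • (u : V) = a := congrArg Subtype.val hx
  replace hy : y • (u : V) = b := congrArg Subtype.val hy
  rw [← hx, map_smul, smul_eq_mul] at ha
  rw [← hy, map_smul, smul_eq_mul] at hb hab
  have := hx ▸ hba
  simp_all

end CommutingReflections

section SmallAngle

variable {G : Type*} [Group G] [Finite G] {W : Type*} [AddCommGroup W] [Module ℂ W]
  [FiniteDimensional ℂ W]

open scoped InnerProductSpace ComplexConjugate

/-- A complex representation of a finite group carries an invariant inner product, here obtained
by pulling back the standard inner product of a Hermitian space. -/
lemma exists_invariant_embedding (ρ : Representation ℂ G W) :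
    ∃ (ι : Type) (_ : Fintype ι) (Φ : W →ₗ[ℂ] EuclideanSpace ℂ ι), Function.Injective Φ ∧
      ∀ g x y, ⟪Φ (ρ g x), Φ (ρ g y)⟫_ℂ = ⟪Φ x, Φ y⟫_ℂ := by
  have b := Module.finBasis ℂ W
  have e : G ≃ Fin (Nat.card G) := Finite.equivFin G
  refine ⟨Fin (Nat.card G) × Fin (finrank ℂ W), inferInstance,
    (WithLp.linearEquiv 2 ℂ _).symm.toLinearMap ∘ₗ
      LinearMap.pi fun p => b.coord p.2 ∘ₗ ρ (e.symm p.1), fun x y hxy => ?_, fun g x y => ?_⟩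
  · refine b.ext_elem fun i => ?_
    simpa using congrArg (fun z : EuclideanSpace ℂ _ => z (e 1, i)) hxy
  · simp only [PiLp.inner_apply, Fintype.sum_prod_type]
    refine Fintype.sum_equiv (e.symm.trans ((Equiv.mulRight g).trans e)) _ _ fun k => ?_
    refine Finset.sum_congr rfl fun i _ => ?_
    simp

variable {ρ : Representation ℂ G W}

omit [FiniteDimensional ℂ W] in
/-- A complex reflection is orthogonal with respect to any invariant inner product. -/
lemma root_form_eq_inner {E : Type*} [NormedAddCommGroup E] [InnerProductSpace ℂ E]
    {Φ : W →ₗ[ℂ] E} {f : Module.End ℂ W}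
    (hΦ : Function.Injective Φ) (hinv : ∀ x y, ⟪Φ (f x), Φ (f y)⟫_ℂ = ⟪Φ x, Φ y⟫_ℂ)
    {α : W →ₗ[ℂ] ℂ} {a : W} (hf : ∀ v, f v = v - α v • a) (ha : α a ≠ 0) :
    (1 - conj (α a)) * (1 - α a) = 1 ∧ ∀ v, α v * ⟪Φ a, Φ a⟫_ℂ = α a * ⟪Φ a, Φ v⟫_ℂ := by
  have ha0 : Φ a ≠ 0 := fun h => ha (by rw [hΦ (h.trans (map_zero Φ).symm), map_zero])
  have haa : ⟪Φ a, Φ a⟫_ℂ ≠ 0 := inner_self_ne_zero.2 ha0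
  have key (v : W) :
      (1 - conj (α a)) * (⟪Φ a, Φ v⟫_ℂ - α v * ⟪Φ a, Φ a⟫_ℂ) = ⟪Φ a, Φ v⟫_ℂ := by
    refine Eq.trans ?_ (hinv a v)
    rw [hf a, hf v]
    simp only [map_sub, map_smul, inner_sub_left, inner_sub_right, inner_smul_left,
      inner_smul_right]
    ring
  have h1 : (1 - conj (α a)) * (1 - α a) = 1 := by
    refine mul_right_cancel₀ haa ?_
    linear_combination key a
  refine ⟨h1, fun v => ?_⟩
  linear_combination (⟪Φ a, Φ v⟫_ℂ - α v * ⟪Φ a, Φ a⟫_ℂ) * h1 - (1 - α a) * key v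

/-- A complex reflection rotating by an angle at most `π / 3` commutes with all its conjugates in
a finite group. -/
lemma commute_conj_of_small_angle {t : G} {α : W →ₗ[ℂ] ℂ} {a : W}
    (ht : ∀ v, ρ t v = v - α v • a) (ha : α a ≠ 0) (hsmall : Complex.normSq (α a) ≤ 1) (g : G) :
    ρ t * ρ (g * t * g⁻¹) = ρ (g * t * g⁻¹) * ρ t := by
  obtain ⟨ι, _, Φ, hΦ, hinv⟩ := exists_invariant_embedding ρ
  obtain ⟨hz, hα⟩ := root_form_eq_inner hΦ (hinv t) ht ha
  have ha0 : Φ a ≠ 0 := fun h => ha (by rw [hΦ (h.trans (map_zero Φ).symm), map_zero])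
  have haa : ⟪Φ a, Φ a⟫_ℂ ≠ 0 := inner_self_ne_zero.2 ha0
  have hN : ⟪Φ a, Φ a⟫_ℂ = ((‖Φ a‖ ^ 2 : ℝ) : ℂ) := by
    rw [inner_self_eq_norm_sq_to_K]; norm_cast
  have hNpos : 0 < ‖Φ a‖ ^ 2 := by positivity
  have hinv' (g : G) (v : W) : ⟪Φ a, Φ (ρ g⁻¹ v)⟫_ℂ = ⟪Φ (ρ g a), Φ v⟫_ℂ := by
    rw [← hinv g]; simp
  have hconj (g : G) (v : W) : ρ (g * t * g⁻¹) v = v - α (ρ g⁻¹ v) • ρ g a := by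
    rw [map_mul, map_mul, Module.End.mul_apply, Module.End.mul_apply, ht, map_sub, map_smul]
    simp
  have horth (g : G) (h : ⟪Φ a, Φ (ρ g a)⟫_ℂ = 0) :
      ρ t * ρ (g * t * g⁻¹) = ρ (g * t * g⁻¹) * ρ t := by
    have h1 : α (ρ g a) = 0 := by simpa [h, ha0] using hα (ρ g a)
    have h2 : α (ρ g⁻¹ a) = 0 := by
      have := hα (ρ g⁻¹ a)
      rw [hinv', ← inner_conj_symm (Φ (ρ g a)), h, map_zero, mul_zero] at this
      simpa [ha0] using this
    ext v
    simp only [Module.End.mul_apply, ht, hconj, map_sub, map_smul, h1, h2, smul_zero, sub_zero]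
    abel
  have hpar (g : G) {r : ℂ} (h : ρ g a = r • a) :
      ρ t * ρ (g * t * g⁻¹) = ρ (g * t * g⁻¹) * ρ t := by
    have h1 (v : W) : α (ρ g⁻¹ v) = conj r * α v := by
      refine mul_right_cancel₀ haa ?_
      rw [hα, hinv', h, map_smul, inner_smul_left]
      linear_combination -conj r * hα v
    ext v
    simp only [Module.End.mul_apply, ht, hconj, map_sub, map_smul, h, h1, smul_eq_mul]
    module
  set c : G → ℝ := fun g => ‖⟪Φ a, Φ (ρ g a)⟫_ℂ‖ ^ 2 / (‖Φ a‖ ^ 2) ^ 2 with hc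
  have hnorm (g : G) : ‖Φ (ρ g a)‖ = ‖Φ a‖ := by
    rw [@norm_eq_sqrt_re_inner ℂ, @norm_eq_sqrt_re_inner ℂ _ _ _ _ (Φ a), hinv]
  have hc1 (g : G) (h : 1 ≤ c g) : ρ t * ρ (g * t * g⁻¹) = ρ (g * t * g⁻¹) * ρ t := by
    have h1 : ‖⟪Φ a, Φ (ρ g a)⟫_ℂ‖ = ‖Φ a‖ * ‖Φ (ρ g a)‖ := by
      refine le_antisymm (norm_inner_le_norm _ _) ?_
      rw [hc, one_le_div (by positivity)] at h
      rw [hnorm, ← sq]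
      exact le_of_sq_le_sq h (norm_nonneg _)
    obtain ⟨r, -, hr⟩ := (norm_inner_eq_norm_iff ha0 (by
      rw [← norm_ne_zero_iff, hnorm]; exact norm_ne_zero_iff.2 ha0)).1 h1
    exact hpar g (hΦ (by rw [hr, map_smul]))
  have hstep (g : G) : c (g * t * g⁻¹) = 1 - Complex.normSq (α a) * c g * (1 - c g) := by
    set z := ⟪Φ a, Φ (ρ g a)⟫_ℂ with hzdef
    set X := ⟪Φ a, Φ (ρ (g * t * g⁻¹) a)⟫_ℂ with hX
    set N := ‖Φ a‖ ^ 2 with hNdef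
    have h1 : (N : ℂ) * X = N ^ 2 - α a * Complex.normSq z := by
      have h2 := hα (ρ g⁻¹ a)
      rw [hinv', ← inner_conj_symm (Φ (ρ g a)), ← hzdef, hN] at h2
      rw [hX, hconj, map_sub, map_smul, inner_sub_right, inner_smul_right, ← hzdef, hN,
        Complex.normSq_eq_conj_mul_self]
      linear_combination -z * h2
    have h3 := congrArg Complex.normSq h1
    have h4 : 2 * (α a).re = Complex.normSq (α a) := by
      have := congrArg Complex.re hz
      simp [Complex.normSq_apply] at this ⊢
      linarith
    have h5 : N ^ 2 * Complex.normSq X = N ^ 4 - 2 * (α a).re * Complex.normSq z * N ^ 2 +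
        Complex.normSq (α a) * Complex.normSq z ^ 2 := by
      rw [Complex.normSq_mul, Complex.normSq_ofReal] at h3
      rw [sq N, h3]
      simp [Complex.normSq_apply, ← Complex.ofReal_pow]
      ring
    rw [h4] at h5
    simp only [hc, ← Complex.normSq_eq_norm_sq]
    rw [← hzdef, ← hX]
    field_simp
    linear_combination h5
  by_contra hcon
  have hc0 (g : G) : 0 ≤ c g := by positivity
  obtain ⟨g₀, ⟨h1, h0⟩, hmax⟩ := Set.exists_max_image {g | c g < 1 ∧ c g ≠ 0} c (Set.toFinite _)
    ⟨g, by
      refine ⟨not_le.1 fun h => hcon (hc1 g h), fun h => hcon (horth g ?_)⟩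
      simpa [hc, ha0] using h⟩
  have hpos : 0 < Complex.normSq (α a) := Complex.normSq_pos.2 ha
  have hp : 0 < c g₀ := lt_of_le_of_ne (hc0 _) (Ne.symm h0)
  have hlt : c g₀ < c (g₀ * t * g₀⁻¹) := by
    rw [hstep]
    nlinarith [mul_nonneg (sub_nonneg.2 hsmall) (mul_nonneg hp.le (sub_nonneg.2 h1.le)), hstep g₀]
  refine not_le.2 hlt (hmax _ ⟨?_, (hp.trans hlt).ne'⟩)
  rw [hstep]
  have := mul_pos (mul_pos hpos hp) (sub_pos.2 h1)
  linarith

end SmallAngle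

section ReflectionsAgree

variable {G : Type*} [Group G] [Finite G] {V W : Type*} [AddCommGroup V] [Module ℂ V]
  [FiniteDimensional ℂ V] [AddCommGroup W] [Module ℂ W] [FiniteDimensional ℂ W]

omit [Finite G] in
lemma ker_eq_of_le_of_ne_one {f f' : Module.End ℂ V} (hf : codimFix f = 1) (hf' : f' ≠ 1)
    (hle : LinearMap.ker (1 - f) ≤ LinearMap.ker (1 - f')) :
    LinearMap.ker (1 - f) = LinearMap.ker (1 - f') ∧ codimFix f' = 1 := by
  have h1 := codimFix_add_finrank_ker f
  have h2 := codimFix_add_finrank_ker f'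
  have h3 := Submodule.finrank_mono hle
  have h4 : codimFix f' ≠ 0 := mt codimFix_eq_zero.1 hf'
  exact ⟨Submodule.eq_of_le_of_finrank_le hle (by omega), by omega⟩

lemma normSq_one_sub_exp_le {m : ℕ} (hm : 6 ≤ m) :
    Complex.normSq (1 - Complex.exp (2 * Real.pi * Complex.I / m)) ≤ 1 := by
  have hm' : (6 : ℝ) ≤ m := by exact_mod_cast hm
  have he : (2 * Real.pi * Complex.I / m : ℂ) = ((2 * Real.pi / m : ℝ) : ℂ) * Complex.I := by
    push_cast; ring
  have hcos : 1 / 2 ≤ Real.cos (2 * Real.pi / m) := by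
    rw [← Real.cos_pi_div_three]
    refine Real.cos_le_cos_of_nonneg_of_le_pi (by positivity) (by linarith [Real.pi_pos]) ?_
    rw [div_le_div_iff₀ (by positivity) (by norm_num)]
    nlinarith [Real.pi_pos]
  rw [he, Complex.normSq_apply]
  simp only [Complex.sub_re, Complex.sub_im, Complex.one_re, Complex.one_im,
    Complex.exp_ofReal_mul_I_re, Complex.exp_ofReal_mul_I_im]
  nlinarith [Real.sin_sq_add_cos_sq (2 * Real.pi / m)]

omit [FiniteDimensional ℂ V] [Finite G] in
/-- In an irreducible representation, no nonzero linear form vanishes on the orbit of a nonzero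
vector. -/
lemma IsIrred.exists_apply_ne_zero {ρ : Representation ℂ G V} (hi : IsIrred ρ) {α : V →ₗ[ℂ] ℂ}
    {a : V} (hα : α ≠ 0) (ha : a ≠ 0) : ∃ g, α (ρ g a) ≠ 0 := by
  by_contra! h
  let U : Submodule ℂ V := ⨅ g, LinearMap.ker (α ∘ₗ ρ g)
  have hmem (u : V) : u ∈ U ↔ ∀ g, α (ρ g u) = 0 := by simp [U]
  rcases hi.2 U fun g u hu => (hmem _).2 fun k => by
    rw [← Module.End.mul_apply, ← map_mul]; exact (hmem u).1 hu _ with hU | hU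
  · exact ha ((Submodule.mem_bot ℂ).1 (hU ▸ (hmem a).2 h))
  · refine hα (LinearMap.ext fun v => ?_)
    simpa using (hmem v).1 (hU ▸ Submodule.mem_top) 1

variable {ρ : Representation ℂ G V}

omit [Finite G] [FiniteDimensional ℂ V] in
lemma mem_pointStab_ker {f : Module.End ℂ V} {p : G} :
    p ∈ pointStab ρ (LinearMap.ker (1 - f) : Set V) ↔
      LinearMap.ker (1 - f) ≤ LinearMap.ker (1 - ρ p) :=
  ⟨fun h u hu => mem_ker_one_sub.2 (h u hu), fun h _ hu => mem_ker_one_sub.1 (h hu)⟩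

/-- On the pointwise stabilizer of a hyperplane, the determinant is injective. -/
lemma eq_of_det_eq_of_mem_pointStab (hinj : Function.Injective ρ) {f : Module.End ℂ V}
    (hf : codimFix f = 1) {p q : G} (hp : p ∈ pointStab ρ (LinearMap.ker (1 - f) : Set V))
    (hq : q ∈ pointStab ρ (LinearMap.ker (1 - f) : Set V))
    (h : LinearMap.det (ρ p) = LinearMap.det (ρ q)) : p = q := by
  by_contra hne
  have h1 : ρ (p * q⁻¹) ≠ 1 := fun h0 => hne <| by
    rw [← map_one ρ] at h0
    exact mul_inv_eq_one.1 (hinj h0)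
  have hc := (ker_eq_of_le_of_ne_one hf h1 (mem_pointStab_ker.1 (mul_mem hp (inv_mem hq)))).2
  obtain ⟨α, a, ha, hr⟩ := exists_root_of_pow_eq_one Nat.card_pos.ne' (rho_pow_card ρ _) hc
  have h2 := det_of_root hr
  rw [map_mul, map_mul, h, ← map_mul, ← map_mul, mul_inv_cancel, map_one, map_one] at h2
  exact ha (by linear_combination h2)

lemma isPrimitiveRoot_det_of_mem_pointStab (hinj : Function.Injective ρ) {f : Module.End ℂ V}
    (hf : codimFix f = 1) {p : G} (hp : p ∈ pointStab ρ (LinearMap.ker (1 - f) : Set V)) :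
    IsPrimitiveRoot (LinearMap.det (ρ p)) (orderOf p) where
  pow_eq_one := by rw [← map_pow, ← map_pow, pow_orderOf_eq_one, map_one, map_one]
  dvd_of_pow_eq_one l hl := by
    refine orderOf_dvd_of_pow_eq_one (eq_of_det_eq_of_mem_pointStab hinj hf (pow_mem hp l)
      (one_mem _) ?_)
    rw [map_pow, map_pow, hl, map_one, map_one]

lemma commute_of_mem_pointStab (hinj : Function.Injective ρ) {f : Module.End ℂ V}
    (hf : codimFix f = 1) {p q : G} (hp : p ∈ pointStab ρ (LinearMap.ker (1 - f) : Set V))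
    (hq : q ∈ pointStab ρ (LinearMap.ker (1 - f) : Set V)) : Commute p q :=
  eq_of_det_eq_of_mem_pointStab hinj hf (mul_mem hp hq) (mul_mem hq hp) (by
    rw [map_mul, map_mul, map_mul, map_mul, mul_comm])

lemma exists_common_pow_of_not_coprime (hinj : Function.Injective ρ) {f : Module.End ℂ V}
    (hf : codimFix f = 1) {p q : G} (hp : p ∈ pointStab ρ (LinearMap.ker (1 - f) : Set V))
    (hq : q ∈ pointStab ρ (LinearMap.ker (1 - f) : Set V))
    (hpq : ¬ (orderOf p).Coprime (orderOf q)) : ∃ i j : ℕ, p ^ i = q ^ j ∧ p ^ i ≠ 1 := by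
  obtain ⟨l, hl, ⟨i, hi⟩, ⟨j, hj⟩⟩ := Nat.Prime.not_coprime_iff_dvd.1 hpq
  have hp0 := orderOf_pos p
  have hq0 := orderOf_pos q
  have hpi : IsPrimitiveRoot (LinearMap.det (ρ p) ^ i) l :=
    (isPrimitiveRoot_det_of_mem_pointStab hinj hf hp).pow hp0 (hi.trans (mul_comm _ _))
  have hqj : IsPrimitiveRoot (LinearMap.det (ρ q) ^ j) l :=
    (isPrimitiveRoot_det_of_mem_pointStab hinj hf hq).pow hq0 (hj.trans (mul_comm _ _))
  have : NeZero l := ⟨hl.ne_zero⟩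
  obtain ⟨k, -, hk⟩ := hqj.eq_pow_of_pow_eq_one hpi.pow_eq_one
  have heq : p ^ i = q ^ (j * k) := eq_of_det_eq_of_mem_pointStab hinj hf (pow_mem hp _)
    (pow_mem hq _) (by simp only [map_pow, pow_mul, hk])
  refine ⟨i, j * k, heq, fun h1 => ?_⟩
  have h2 := orderOf_dvd_of_pow_eq_one h1
  rw [hi] at h2 hp0
  have h3 := Nat.le_of_dvd (Nat.pos_of_mul_pos_left hp0) h2
  have h4 := hl.two_le
  have h5 : 0 < i := Nat.pos_of_mul_pos_left hp0
  nlinarith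

/-- Nontrivial elements of coprime orders in the pointwise stabilizer of a hyperplane commute
with each other's conjugates. -/
lemma commute_conj_of_coprime (hinj : Function.Injective ρ) {f : Module.End ℂ V}
    (hf : codimFix f = 1) {p q : G} (hp : p ∈ pointStab ρ (LinearMap.ker (1 - f) : Set V))
    (hq : q ∈ pointStab ρ (LinearMap.ker (1 - f) : Set V)) (hp1 : p ≠ 1) (hq1 : q ≠ 1)
    (hpq : (orderOf p).Coprime (orderOf q)) (g : G) : Commute p (g * q * g⁻¹) := by
  have ho := (commute_of_mem_pointStab hinj hf hp hq).orderOf_mul_eq_mul_orderOf_of_coprime hpq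
  have hprim := isPrimitiveRoot_det_of_mem_pointStab hinj hf (mul_mem hp hq)
  set m := orderOf (p * q) with hm
  have hm6 : 6 ≤ m := by
    have h1 := orderOf_pos p
    have h2 := orderOf_pos q
    have h3 := mt orderOf_eq_one_iff.1 hp1
    have h4 := mt orderOf_eq_one_iff.1 hq1
    have h5 : orderOf p ≠ orderOf q := fun h => by rw [h, Nat.coprime_self] at hpq; exact h4 hpq
    rw [ho]
    rcases lt_or_gt_of_ne h5 with h | h
    · have : 2 ≤ orderOf p := by omega
      have : 3 ≤ orderOf q := by omega
      nlinarith
    · have : 2 ≤ orderOf q := by omega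
      have : 3 ≤ orderOf p := by omega
      nlinarith
  have : NeZero m := ⟨by omega⟩
  have hexp := Complex.isPrimitiveRoot_exp m (by omega)
  obtain ⟨k, -, hk⟩ := hprim.eq_pow_of_pow_eq_one hexp.pow_eq_one
  set t := (p * q) ^ k with ht
  have htP := pow_mem (mul_mem hp hq) k
  have hdt : LinearMap.det (ρ t) = Complex.exp (2 * Real.pi * Complex.I / m) := by
    rw [ht, map_pow, map_pow, hk]
  have hpow {u : G} (hu : u ∈ pointStab ρ (LinearMap.ker (1 - f) : Set V)) (hum : u ^ m = 1) :
      ∃ i, t ^ i = u := by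
    obtain ⟨i, -, hi⟩ := hexp.eq_pow_of_pow_eq_one (ξ := LinearMap.det (ρ u))
      (by rw [← map_pow, ← map_pow, hum, map_one, map_one])
    exact ⟨i, eq_of_det_eq_of_mem_pointStab hinj hf (pow_mem htP i) hu (by
      rw [map_pow, map_pow, hdt, hi])⟩
  obtain ⟨i, hi⟩ := hpow hp (by rw [ho, pow_mul, pow_orderOf_eq_one, one_pow])
  obtain ⟨j, hj⟩ := hpow hq (by rw [ho, mul_comm, pow_mul, pow_orderOf_eq_one, one_pow])
  have ht1 : ρ t ≠ 1 := fun h0 => hp1 (by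
    rw [← map_one ρ] at h0
    rw [← hi, hinj h0, one_pow])
  have hc := (ker_eq_of_le_of_ne_one hf ht1 (mem_pointStab_ker.1 htP)).2
  obtain ⟨α, a, ha, hr⟩ := exists_root_of_pow_eq_one Nat.card_pos.ne' (rho_pow_card ρ _) hc
  have hα : α a = 1 - Complex.exp (2 * Real.pi * Complex.I / m) := by
    rw [← hdt, det_of_root hr]; ring
  have hcomm := commute_conj_of_small_angle hr ha (hα ▸ normSq_one_sub_exp_le hm6) g
  rw [← map_mul, ← map_mul] at hcomm
  rw [← hi, ← hj, ← conj_pow]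
  exact Commute.pow_pow (hinj hcomm) i j

omit [Finite G] in
lemma ne_one_of_codimFix_eq_one {t : G} (ht : codimFix (ρ t) = 1) :
    t ≠ 1 := by
  rintro rfl
  rw [map_one, codimFix_eq_zero.2 rfl] at ht
  exact zero_ne_one ht

variable {ρ' : Representation ℂ G W}

/-- Let `ρ` be a faithful irreducible representation of a finite group generated by its elements
acting as reflections in `ρ`. If these elements act as reflections in another faithful
representation, then no other elements do. -/
theorem codimFix_eq_one_of_codimFix_eq_one (hinj : Function.Injective ρ)
    (hinj' : Function.Injective ρ') (hi : IsIrred ρ)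
    (hgen : Subgroup.closure {s | codimFix (ρ s) = 1} = ⊤)
    (h : ∀ s, codimFix (ρ s) = 1 → codimFix (ρ' s) = 1) {s : G} (hs : codimFix (ρ' s) = 1) :
    codimFix (ρ s) = 1 := by
  set U := LinearMap.ker (1 - ρ' s) with hU
  set P := pointStab ρ' (U : Set W) with hP
  have hsP : s ∈ P := mem_pointStab_ker.2 le_rfl
  have hρ1 {t : G} (ht : t ≠ 1) : ρ t ≠ 1 := fun h0 => ht (hinj (h0.trans (map_one ρ).symm))
  have hcl : Subgroup.closure ({t | codimFix (ρ t) = 1} ∩ P) = P :=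
    pointStab_eq_closure hinj' (fun t ht => h t ht)
      (fun g t ht => (codimFix_conj ρ g t).trans ht) hgen U
  have hsame {t₁ t₂ : G} (h₁ : codimFix (ρ t₁) = 1) (h₁P : t₁ ∈ P) (h₂ : codimFix (ρ t₂) = 1)
      (h₂P : t₂ ∈ P) : LinearMap.ker (1 - ρ t₁) = LinearMap.ker (1 - ρ t₂) := by
    by_contra hne
    have hcop : (orderOf t₁).Coprime (orderOf t₂) := by
      by_contra hcop
      obtain ⟨i, j, hij, hi1⟩ := exists_common_pow_of_not_coprime hinj' hs h₁P h₂P hcop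
      have hle (t : G) (k : ℕ) : LinearMap.ker (1 - ρ t) ≤ LinearMap.ker (1 - ρ (t ^ k)) := by
        rw [map_pow, ← geom_sum_mul_neg]
        exact LinearMap.ker_le_ker_comp _ _
      have e1 := (ker_eq_of_le_of_ne_one h₁ (hρ1 hi1) (hle _ _)).1
      have e2 := (ker_eq_of_le_of_ne_one h₂ (hρ1 (hij ▸ hi1)) (hle _ _)).1
      rw [hij] at e1
      exact hne (e1.trans e2.symm)
    obtain ⟨α, a, ha, hα⟩ := exists_root_of_pow_eq_one Nat.card_pos.ne' (rho_pow_card ρ _) h₁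
    obtain ⟨β, b, hb, hβ⟩ := exists_root_of_pow_eq_one Nat.card_pos.ne' (rho_pow_card ρ _) h₂
    have hα0 : α ≠ 0 := fun h0 => ha (by simp [h0])
    have hb0 : b ≠ 0 := fun h0 => hb (by simp [h0])
    obtain ⟨g, hg⟩ := hi.exists_apply_ne_zero hα0 hb0
    set u := g * t₂ * g⁻¹ with hu
    have hcomm : Commute t₁ u :=
      commute_conj_of_coprime hinj' hs h₁P h₂P (ne_one_of_codimFix_eq_one h₁) (ne_one_of_codimFix_eq_one h₂) hcop g
    have hρu (v : V) : ρ u v = v - (β ∘ₗ ρ g⁻¹) v • ρ g b := by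
      rw [hu, map_mul, map_mul, Module.End.mul_apply, Module.End.mul_apply, hβ, map_sub, map_smul]
      simp
    have hub : (β ∘ₗ ρ g⁻¹) (ρ g b) ≠ 0 := by simpa using hb
    have hcomm₁ : ρ t₁ * ρ u = ρ u * ρ t₁ := by rw [← map_mul, hcomm.eq, map_mul]
    obtain ⟨r, c, -, hc0, hr, hc⟩ := parallel_of_commute hα hρu ha hub hcomm₁ hg
    have hkeru : LinearMap.ker (1 - ρ u) = LinearMap.ker (1 - ρ t₁) := by
      ext v
      rw [mem_ker_of_root hub hρu, mem_ker_of_root ha hα, hc, mul_eq_zero, or_iff_right hc0]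
    have hprod : t₁ * u ≠ 1 := fun h0 => by
      have h1 : orderOf t₁ = orderOf t₂ := by
        rw [eq_inv_of_mul_eq_one_left h0, orderOf_inv, hu]
        exact (MulAut.conj g).orderOf_eq t₂
      rw [h1, Nat.coprime_self, orderOf_eq_one_iff] at hcop
      exact ne_one_of_codimFix_eq_one h₂ hcop
    have hcprod : codimFix (ρ (t₁ * u)) = 1 := by
      refine (ker_eq_of_le_of_ne_one h₁ (hρ1 hprod) fun v hv => ?_).2
      have hv' := hv
      rw [← hkeru] at hv'
      rw [mem_ker_one_sub, map_mul, Module.End.mul_apply,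
        mem_ker_one_sub.1 hv', mem_ker_one_sub.1 hv]
    have h₁' := h _ h₁
    have hu' := h u ((codimFix_conj ρ g t₂).trans h₂)
    obtain ⟨α', a', ha', hα'⟩ := exists_root_of_pow_eq_one Nat.card_pos.ne' (rho_pow_card ρ' _) h₁'
    obtain ⟨β', b', hb', hβ'⟩ := exists_root_of_pow_eq_one Nat.card_pos.ne' (rho_pow_card ρ' _) hu'
    have hcomm₂ : ρ' t₁ * ρ' u = ρ' u * ρ' t₁ := by rw [← map_mul, hcomm.eq, map_mul]
    have hab' := apply_root_ne_zero_of_mul hα' hβ' ha' hb' hcomm₂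
      (by rw [← map_mul]; exact h _ hcprod)
    obtain ⟨-, c', -, hc0', -, hc'⟩ := parallel_of_commute hα' hβ' ha' hb' hcomm₂ hab'
    have hkeru' : LinearMap.ker (1 - ρ' u) = LinearMap.ker (1 - ρ' t₁) := by
      ext v
      rw [mem_ker_of_root hb' hβ', mem_ker_of_root ha' hα', hc', mul_eq_zero, or_iff_right hc0']
    have huP : u ∈ P := by
      refine mem_pointStab_ker.2 ?_
      rw [hkeru']
      exact mem_pointStab_ker.1 h₁P
    have hut : u = t₂ := eq_of_det_eq_of_mem_pointStab hinj' hs huP h₂P (by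
      rw [hu, map_mul, map_mul, map_mul, map_mul, mul_right_comm, ← map_mul LinearMap.det,
        ← map_mul ρ', mul_inv_cancel, map_one, map_one, one_mul])
    exact hne (hut ▸ hkeru).symm
  obtain ⟨t, ht, htP⟩ : ({t | codimFix (ρ t) = 1} ∩ P : Set G).Nonempty := by
    rw [Set.nonempty_iff_ne_empty]
    intro h0
    rw [h0, Subgroup.closure_empty] at hcl
    exact ne_one_of_codimFix_eq_one hs (Subgroup.mem_bot.1 (hcl ▸ hsP))
  have hle : P ≤ pointStab ρ (LinearMap.ker (1 - ρ t) : Set V) := by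
    rw [← hcl, Subgroup.closure_le]
    rintro x ⟨hx, hxP⟩
    exact mem_pointStab_ker.2 (hsame ht htP hx hxP).le
  exact (ker_eq_of_le_of_ne_one ht (hρ1 (ne_one_of_codimFix_eq_one hs)) (mem_pointStab_ker.1 (hle hsP))).2

end ReflectionsAgree

section GaloisTwist

variable {n : ℕ}

/-- The transform of an endomorphism of `ℂⁿ` by an automorphism of `ℂ`, applied to all entries of
its matrix. -/
def twistEnd (σ : ℂ ≃+* ℂ) : Module.End ℂ (Fin n → ℂ) →* Module.End ℂ (Fin n → ℂ) where
  toFun f :=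
    { toFun := fun v i => σ (f (fun j => σ.symm (v j)) i)
      map_add' := fun v w => by
        have : (fun j => σ.symm ((v + w) j)) = (fun j => σ.symm (v j)) + fun j => σ.symm (w j) := by
          ext j; simp
        ext i
        rw [this, map_add, Pi.add_apply, map_add, Pi.add_apply]
      map_smul' := fun c v => by
        have : (fun j => σ.symm ((c • v) j)) = σ.symm c • fun j => σ.symm (v j) := by
          ext j; simp
        ext i
        rw [this, map_smul]
        simp }
  map_one' := by ext; simp
  map_mul' f g := by ext; simp

lemma twistEnd_apply (σ : ℂ ≃+* ℂ) (f : Module.End ℂ (Fin n → ℂ)) (v : Fin n → ℂ) (i : Fin n) :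
    twistEnd σ f v i = σ (f (fun j => σ.symm (v j)) i) := rfl

lemma twistEnd_apply_comp (σ : ℂ ≃+* ℂ) (f : Module.End ℂ (Fin n → ℂ)) (v : Fin n → ℂ) :
    twistEnd σ f (σ ∘ v) = σ ∘ f v := by
  ext i; simp [twistEnd_apply]

lemma twistEnd_injective (σ : ℂ ≃+* ℂ) : Function.Injective (twistEnd (n := n) σ) := by
  intro f g h
  refine LinearMap.ext fun v => ?_
  have := LinearMap.congr_fun h (σ ∘ v)
  rw [twistEnd_apply_comp, twistEnd_apply_comp] at this
  exact σ.injective.comp_left this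

lemma trace_twistEnd (σ : ℂ ≃+* ℂ) (f : Module.End ℂ (Fin n → ℂ)) :
    LinearMap.trace ℂ _ (twistEnd σ f) = σ (LinearMap.trace ℂ _ f) := by
  rw [LinearMap.trace_eq_matrix_trace ℂ (Pi.basisFun ℂ (Fin n)),
    LinearMap.trace_eq_matrix_trace ℂ (Pi.basisFun ℂ (Fin n)), Matrix.trace, Matrix.trace, map_sum]
  refine Finset.sum_congr rfl fun i _ => ?_
  have : (fun j => σ.symm ((Pi.single i 1 : Fin n → ℂ) j)) = Pi.single i 1 := by
    ext j
    rcases eq_or_ne j i with rfl | h <;> simp [*]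
  simp [twistEnd_apply, this]

lemma codimFix_twistEnd (σ : ℂ ≃+* ℂ) (f : Module.End ℂ (Fin n → ℂ)) :
    codimFix (twistEnd σ f) = codimFix f := by
  have key (v : Fin n → ℂ) : (1 - twistEnd σ f) (σ ∘ v) = σ ∘ ((1 - f) v) := by
    rw [LinearMap.sub_apply, twistEnd_apply_comp]
    ext i; simp
  have hs (v : Fin n → ℂ) : σ ∘ (σ.symm ∘ v) = v := by ext; simp
  have hs' (v : Fin n → ℂ) : σ.symm ∘ (σ ∘ v) = v := by ext; simp
  let e : LinearMap.range (1 - f) ≃+ LinearMap.range (1 - twistEnd σ f) :=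
    { toFun := fun v => ⟨σ ∘ v, by
        obtain ⟨_, w, rfl⟩ := v
        exact ⟨σ ∘ w, key w⟩⟩
      invFun := fun v => ⟨σ.symm ∘ v, by
        obtain ⟨_, w, rfl⟩ := v
        refine ⟨σ.symm ∘ w, ?_⟩
        have := key (σ.symm ∘ w)
        rw [hs] at this
        exact (hs' _).symm.trans (congrArg (σ.symm ∘ ·) this.symm)⟩
      left_inv := fun v => Subtype.ext (hs' _)
      right_inv := fun v => Subtype.ext (hs _)
      map_add' := fun v w => by ext; simp }
  rw [codimFix, codimFix, finrank, finrank,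
    rank_eq_of_equiv_equiv σ e σ.bijective fun r v => by ext; simp [e]]

variable {G : Type*} [Group G]

/-- The transform of a representation on `ℂⁿ` by an automorphism of `ℂ`. -/
def galoisTwist (σ : ℂ ≃+* ℂ) (ρ : Representation ℂ G (Fin n → ℂ)) :
    Representation ℂ G (Fin n → ℂ) :=
  (twistEnd σ).comp ρ

lemma IsIrred.galoisTwist {ρ : Representation ℂ G (Fin n → ℂ)} (h : IsIrred ρ) (σ : ℂ ≃+* ℂ) :
    IsIrred (galoisTwist σ ρ) := by
  refine ⟨h.1, fun U hU => ?_⟩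
  let U' : Submodule ℂ (Fin n → ℂ) :=
    { carrier := {v | σ ∘ v ∈ U}
      add_mem' := fun {v w} hv hw => by
        have : σ ∘ (v + w) = σ ∘ v + σ ∘ w := by ext; simp
        exact (congrArg (· ∈ U) this).mpr (add_mem hv hw)
      zero_mem' := by
        have : σ ∘ (0 : Fin n → ℂ) = 0 := by ext; simp
        simp [this]
      smul_mem' := fun c v hv => by
        have : σ ∘ (c • v) = σ c • (σ ∘ v) := by ext; simp
        exact (congrArg (· ∈ U) this).mpr (U.smul_mem _ hv) }
  have hmem (v : Fin n → ℂ) : σ.symm ∘ v ∈ U' ↔ v ∈ U := by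
    have : σ ∘ (σ.symm ∘ v) = v := by ext; simp
    exact iff_of_eq (congrArg (· ∈ U) this)
  rcases h.2 U' fun g u hu => by
    have := hU g _ hu
    rwa [_root_.galoisTwist, MonoidHom.comp_apply, twistEnd_apply_comp] at this with h0 | h0
  · refine Or.inl ((Submodule.eq_bot_iff _).2 fun v hv => ?_)
    rw [← hmem, h0, Submodule.mem_bot] at hv
    ext i
    simpa using congrFun hv i
  · refine Or.inr (Submodule.eq_top_iff'.2 fun v => ?_)
    rw [← hmem, h0]
    exact Submodule.mem_top

end GaloisTwist

section CoprimePowers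

variable {G : Type*} [Group G] {V W : Type*} [AddCommGroup V] [Module ℂ V]
  [FiniteDimensional ℂ V] [AddCommGroup W] [Module ℂ W] [FiniteDimensional ℂ W]

/-- The residues coprime to `m`. -/
def coprimeRange (m : ℕ) : Finset ℕ := {k ∈ Finset.range m | k.Coprime m}

lemma mem_coprimeRange {m k : ℕ} : k ∈ coprimeRange m ↔ k < m ∧ k.Coprime m := by
  simp [coprimeRange]

/-- The sum of the characters `g ↦ χ (g ^ k)`, for `k` prime to the order of the group. -/
noncomputable def coprimeTrace (ρ : Representation ℂ G V) (g : G) : ℂ :=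
  ∑ k ∈ coprimeRange (Nat.card G), LinearMap.trace ℂ V (ρ (g ^ k))

omit [FiniteDimensional ℂ V] in
lemma coprimeTrace_pow [Finite G] (ρ : Representation ℂ G V) (g : G) {j : ℕ}
    (hj : j.Coprime (Nat.card G)) : coprimeTrace ρ (g ^ j) = coprimeTrace ρ g := by
  have hm : 0 < Nat.card G := Nat.card_pos
  have hmaps : Set.MapsTo (fun k => j * k % Nat.card G) (coprimeRange (Nat.card G))
      (coprimeRange (Nat.card G)) := fun k hk => by
    rw [Finset.mem_coe, mem_coprimeRange] at hk ⊢
    refine ⟨Nat.mod_lt _ hm, ?_⟩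
    rw [Nat.coprime_iff_gcd_eq_one, ← Nat.gcd_rec, Nat.gcd_comm]
    exact hj.mul_left hk.2
  have hinj : Set.InjOn (fun k => j * k % Nat.card G) (coprimeRange (Nat.card G)) := by
    intro k hk l hl hkl
    rw [Finset.mem_coe, mem_coprimeRange] at hk hl
    have h : j * k ≡ j * l [MOD Nat.card G] := hkl
    exact (Nat.ModEq.cancel_left_of_coprime hj.symm h).eq_of_lt_of_lt hk.1 hl.1
  refine Finset.sum_nbij _ hmaps hinj (Finset.surjOn_of_injOn_of_card_le _ hmaps hinj le_rfl)
    fun k _ => ?_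
  rw [← pow_mul, pow_mod_natCard]

omit [FiniteDimensional ℂ V] [FiniteDimensional ℂ W] in
lemma sum_coprimeTrace_mul_coprimeTrace_inv [Fintype G] (ρ : Representation ℂ G V)
    (ρ' : Representation ℂ G W) :
    ∑ g, coprimeTrace ρ g * coprimeTrace ρ' g⁻¹ = (coprimeRange (Nat.card G)).card •
      ∑ g, coprimeTrace ρ g * LinearMap.trace ℂ W (ρ' g⁻¹) := by
  simp only [coprimeTrace.eq_def ρ', Finset.mul_sum]
  rw [Finset.sum_comm, ← Finset.sum_const]
  refine Finset.sum_congr rfl fun k hk => ?_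
  have hk' := (mem_coprimeRange.1 hk).2
  refine Fintype.sum_equiv (powCoprime hk'.symm) _ _ fun g => ?_
  rw [powCoprime_apply, coprimeTrace_pow ρ g hk', inv_pow]

/-- Two irreducible representations with the same `coprimeTrace` have characters related by a
power map on the group. -/
lemma exists_coprime_trace_eq [Finite G] {n : ℕ} {ρ : Representation ℂ G (Fin n → ℂ)}
    {ρ' : Representation ℂ G W} (hi : IsIrred ρ) (hi' : IsIrred ρ')
    (h : ∀ g, coprimeTrace ρ g = coprimeTrace ρ' g) :
    ∃ k : ℕ, k.Coprime (Nat.card G) ∧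
      ∀ g, LinearMap.trace ℂ W (ρ' g) = LinearMap.trace ℂ _ (ρ (g ^ k)) := by
  classical
  by_contra! hcon
  have : Fintype G := Fintype.ofFinite G
  set m := Nat.card G with hm
  have hm0 : m ≠ 0 := Nat.card_pos.ne'
  have hmC : (m : ℂ) ≠ 0 := by exact_mod_cast hm0
  have : Invertible (m : ℂ) := invertibleOfNonzero hmC
  have := hi.isIrreducible
  have := hi'.isIrreducible
  have hchar {k : ℕ} (hk : k.Coprime m) : ∃ τ : Representation ℂ G (Fin n → ℂ),
      τ.IsIrreducible ∧ ∀ g, τ.character g = LinearMap.trace ℂ _ (ρ (g ^ k)) := by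
    obtain ⟨σ, hσ⟩ := exists_ringEquiv_pow hm0 hk
    refine ⟨galoisTwist σ ρ, (hi.galoisTwist σ).isIrreducible, fun g => ?_⟩
    refine (trace_twistEnd σ (ρ g)).trans ?_
    rw [map_pow]
    exact ringHom_trace (σ := (σ : ℂ →+* ℂ)) hm0 hσ (rho_pow_card ρ g)
  have hI (k : ℕ) (hk : k ∈ coprimeRange m) :
      ∑ g, LinearMap.trace ℂ _ (ρ (g ^ k)) * LinearMap.trace ℂ W (ρ' g⁻¹) = 0 := by
    obtain ⟨τ, hτ, hτc⟩ := hchar (mem_coprimeRange.1 hk).2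
    have h1 := Representation.char_orthonormal τ ρ'
    rw [if_neg] at h1
    · refine (mul_eq_zero.1 (Eq.trans ?_ h1)).resolve_left (inv_ne_zero hmC)
      simp only [← hτc]
      rfl
    · rintro ⟨e⟩
      obtain ⟨g, hg⟩ := hcon k (mem_coprimeRange.1 hk).2
      refine hg ?_
      rw [← hτc]
      exact congrFun (Representation.char_iso e) g
  have hJ (k : ℕ) (hk : k ∈ coprimeRange m) : ∃ c : ℕ, (k = 1 % m → c ≠ 0) ∧
      ∑ g, LinearMap.trace ℂ _ (ρ (g ^ k)) * LinearMap.trace ℂ _ (ρ g⁻¹) = c := by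
    by_cases hk1 : k = 1 % m
    · have h1 := Representation.char_orthonormal ρ ρ
      rw [if_pos ⟨Representation.Equiv.refl ρ⟩, inv_mul_eq_one₀ hmC] at h1
      refine ⟨m, fun _ => hm0, Eq.trans ?_ h1.symm⟩
      refine Finset.sum_congr rfl fun g _ => ?_
      rw [hk1, hm, pow_mod_natCard, pow_one]
      rfl
    · obtain ⟨τ, hτ, hτc⟩ := hchar (mem_coprimeRange.1 hk).2
      have h1 := Representation.char_orthonormal τ ρ
      rw [inv_mul_eq_iff_eq_mul₀ hmC] at h1
      refine ⟨m * if Nonempty (Representation.Equiv ρ τ) then 1 else 0, fun h => absurd h hk1,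
        Eq.trans ?_ (h1.trans (by push_cast; rfl))⟩
      simp only [← hτc]
      rfl
  have h1 : ∑ g, coprimeTrace ρ g * LinearMap.trace ℂ W (ρ' g⁻¹) = 0 := by
    simp only [coprimeTrace, Finset.sum_mul]
    rw [Finset.sum_comm]
    exact Finset.sum_eq_zero hI
  choose! c hc hcJ using hJ
  have h2 : ∑ g, coprimeTrace ρ g * LinearMap.trace ℂ _ (ρ g⁻¹) =
      (∑ k ∈ coprimeRange m, c k : ℕ) := by
    simp only [coprimeTrace, Finset.sum_mul]
    rw [Finset.sum_comm, Nat.cast_sum]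
    exact Finset.sum_congr rfl hcJ
  have hmem : 1 % m ∈ coprimeRange m := mem_coprimeRange.2 ⟨Nat.mod_lt _ (by omega), by
    rw [Nat.coprime_iff_gcd_eq_one, ← Nat.gcd_rec, Nat.gcd_one_right]⟩
  have h3 := sum_coprimeTrace_mul_coprimeTrace_inv ρ ρ
  rw [h2] at h3
  have h4 := sum_coprimeTrace_mul_coprimeTrace_inv ρ ρ'
  rw [h1, smul_zero] at h4
  simp only [← h] at h4
  rw [h4, eq_comm, smul_eq_zero, Finset.card_eq_zero, Nat.cast_eq_zero, Finset.sum_eq_zero_iff] at h3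
  rcases h3 with h3 | h3
  · exact absurd (h3 ▸ hmem) (Finset.notMem_empty _)
  · exact hc _ hmem rfl (h3 _ hmem)

end CoprimePowers

section LinearGroups

variable {H : Type*} [Group H] {V W : Type*} [AddCommGroup V] [Module ℂ V] [AddCommGroup W]
  [Module ℂ W]

/-- The representation given by a homomorphism to the group of linear automorphisms. -/
def toRepresentation (φ : H →* (W ≃ₗ[ℂ] W)) : Representation ℂ H W :=
  LinearEquiv.automorphismGroup.toLinearMapMonoidHom.comp φ

lemma toRepresentation_apply (φ : H →* (W ≃ₗ[ℂ] W)) (h : H) :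
    toRepresentation φ h = ((φ h : W ≃ₗ[ℂ] W) : W →ₗ[ℂ] W) := rfl

lemma toRepresentation_injective {φ : H →* (W ≃ₗ[ℂ] W)} :
    Function.Injective (toRepresentation φ) ↔ Function.Injective φ :=
  LinearEquiv.toLinearMap_injective.of_comp_iff φ

lemma isIrred_toRepresentation {φ : H →* (W ≃ₗ[ℂ] W)} :
    IsIrred (toRepresentation φ) ↔ IsIrreducibleRep φ := by
  simp only [IsIrred, IsIrreducibleRep, Submodule.map_le_iff_le_comap]
  rfl

lemma exists_toRepresentation_eq (ρ : Representation ℂ H W) :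
    ∃ φ : H →* (W ≃ₗ[ℂ] W), toRepresentation φ = ρ :=
  ⟨(LinearMap.GeneralLinearGroup.generalLinearEquiv ℂ W).toMonoidHom.comp ρ.toHomUnits, rfl⟩

lemma isPseudoReflection_iff_codimFix [Finite H] [FiniteDimensional ℂ W]
    {φ : H →* (W ≃ₗ[ℂ] W)} {h : H} :
    IsPseudoReflection (φ h) ↔ codimFix (toRepresentation φ h) = 1 := by
  have h1 := codimFix_add_finrank_ker (toRepresentation φ h)
  have h2 : LinearMap.ker (1 - toRepresentation φ h) =
      LinearMap.ker (((φ h : W ≃ₗ[ℂ] W) : W →ₗ[ℂ] W) - LinearMap.id) := by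
    rw [← LinearMap.ker_neg, neg_sub]; rfl
  rw [h2] at h1
  refine ⟨fun ⟨_, _, h3⟩ => by omega, fun h3 => ⟨?_, fun h4 => ?_, by omega⟩⟩
  · exact φ.isOfFinOrder (isOfFinOrder_of_finite h)
  · have : toRepresentation φ h = 1 := by rw [toRepresentation_apply, h4]; rfl
    rw [codimFix_eq_zero.2 this] at h3
    exact zero_ne_one h3

/-- Transport of a representation along a linear equivalence. -/
def conjRepresentation (e : V ≃ₗ[ℂ] W) (ρ : Representation ℂ H V) : Representation ℂ H W :=
  (e.conjAlgEquiv ℂ : Module.End ℂ V →* Module.End ℂ W).comp ρ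

lemma conjRepresentation_apply (e : V ≃ₗ[ℂ] W) (ρ : Representation ℂ H V) (h : H) (w : W) :
    conjRepresentation e ρ h w = e (ρ h (e.symm w)) := rfl

lemma conjRepresentation_injective {e : V ≃ₗ[ℂ] W} {ρ : Representation ℂ H V}
    (hinj : Function.Injective ρ) : Function.Injective (conjRepresentation e ρ) :=
  (e.conjAlgEquiv ℂ).injective.comp hinj

lemma trace_conjRepresentation (e : V ≃ₗ[ℂ] W) (ρ : Representation ℂ H V) (h : H) :
    LinearMap.trace ℂ W (conjRepresentation e ρ h) = LinearMap.trace ℂ V (ρ h) :=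
  LinearMap.trace_conj' (ρ h) e

lemma codimFix_conjRepresentation (e : V ≃ₗ[ℂ] W) (ρ : Representation ℂ H V) (h : H) :
    codimFix (conjRepresentation e ρ h) = codimFix (ρ h) := by
  have : 1 - conjRepresentation e ρ h = e.toLinearMap ∘ₗ (1 - ρ h) ∘ₗ e.symm.toLinearMap := by
    ext w; simp [conjRepresentation_apply]
  rw [codimFix, codimFix, this, LinearMap.range_comp, LinearMap.range_comp, LinearEquiv.range,
    Submodule.map_top]
  exact LinearEquiv.finrank_map_eq e _

lemma IsIrred.conjRepresentation {ρ : Representation ℂ H V} (h : IsIrred ρ) (e : V ≃ₗ[ℂ] W) :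
    IsIrred (conjRepresentation e ρ) := by
  have := h.1
  refine ⟨e.symm.toEquiv.nontrivial, fun U hU => ?_⟩
  refine (h.2 (U.comap e.toLinearMap) fun g u hu => ?_).imp (fun h0 => ?_) fun h0 => ?_
  · have := hU g _ hu
    rwa [conjRepresentation_apply, LinearEquiv.coe_coe, e.symm_apply_apply] at this
  · exact Submodule.comap_injective_of_surjective e.surjective (h0.trans (by simp))
  · exact Submodule.comap_injective_of_surjective e.surjective (h0.trans (by simp))

end LinearGroups

section Characters

variable {G : Type*} [Group G] [Finite G] {n : ℕ} {W : Type*} [AddCommGroup W] [Module ℂ W]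
  [FiniteDimensional ℂ W]

/-- A faithful irreducible representation in which the reflections of an irreducible reflection
group act as reflections has as its character a power transform of the reflection character. -/
theorem exists_trace_eq_trace_pow {ρ : Representation ℂ G (Fin n → ℂ)} {ρ' : Representation ℂ G W}
    (hinj : Function.Injective ρ) (hinj' : Function.Injective ρ') (hi : IsIrred ρ)
    (hi' : IsIrred ρ') (hgen : Subgroup.closure {s | codimFix (ρ s) = 1} = ⊤)
    (h : ∀ s, codimFix (ρ s) = 1 → codimFix (ρ' s) = 1) :
    ∃ k : ℕ, k.Coprime (Nat.card G) ∧
      ∀ g, LinearMap.trace ℂ W (ρ' g) = LinearMap.trace ℂ _ (ρ (g ^ k)) := by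
  have hR (s : G) : codimFix (ρ s) = 1 ↔ s ∈ {s | codimFix (ρ s) = 1} := Iff.rfl
  have hR' (s : G) : codimFix (ρ' s) = 1 ↔ s ∈ {s | codimFix (ρ s) = 1} :=
    ⟨codimFix_eq_one_of_codimFix_eq_one hinj hinj' hi hgen h, h s⟩
  have hdim := finrank_eq_of_reflections_eq hinj hinj' hi hi' hR hR' hgen
  refine exists_coprime_trace_eq hi hi' fun g => ?_
  have h1 := sum_coprime_trace_eq Nat.card_pos.ne' (rho_pow_card ρ g) (rho_pow_card ρ' g) fun d => by
    rw [← map_pow, ← map_pow]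
    exact codimFix_eq_of_reflections_eq hinj hinj' hR hR' hgen (g ^ d)
  rw [Finset.sum_sub_distrib, Finset.sum_sub_distrib, LinearMap.trace_one, LinearMap.trace_one,
    hdim, sub_right_inj] at h1
  simpa only [coprimeTrace, coprimeRange, map_pow] using h1

end Characters

section FieldOfDefinition

variable {V : Type*} [AddCommGroup V] [Module ℂ V] {G : Subgroup (V ≃ₗ[ℂ] V)}

/-- An automorphism of `ℂ` permuting the traces of `G` restricts to the field of definition. -/
lemma exists_algEquiv_restrict {σ : ℂ ≃+* ℂ} {e : G ≃ G}
    (h : ∀ g, σ (reflChar G g) = reflChar G (e g)) :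
    ∃ γ : fieldOfDefinition G ≃ₐ[ℚ] fieldOfDefinition G, ∀ x, (γ x : ℂ) = σ x := by
  have h1 : fieldOfDefinition G ≤ (fieldOfDefinition G).comap (σ : ℂ →+* ℂ) := by
    refine Subfield.closure_le.2 ?_
    rintro _ ⟨g, rfl⟩
    exact (congrArg (· ∈ fieldOfDefinition G) (h g)).mpr (reflChar G (e g)).2
  have h2 : fieldOfDefinition G ≤ (fieldOfDefinition G).comap (σ.symm : ℂ →+* ℂ) := by
    refine Subfield.closure_le.2 ?_
    rintro _ ⟨g, rfl⟩
    have h3 : σ.symm (reflChar G g) = reflChar G (e.symm g) := by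
      rw [RingEquiv.symm_apply_eq, h, e.apply_symm_apply]
    exact (congrArg (· ∈ fieldOfDefinition G) h3).mpr (reflChar G (e.symm g)).2
  let γ : fieldOfDefinition G ≃+* fieldOfDefinition G :=
    { toFun := fun x => ⟨σ x, h1 x.2⟩
      invFun := fun x => ⟨σ.symm x, h2 x.2⟩
      left_inv := fun x => by ext; simp
      right_inv := fun x => by ext; simp
      map_mul' := fun x y => by ext; simp
      map_add' := fun x y => by ext; simp }
  exact ⟨AlgEquiv.ofRingEquiv (f := γ) fun q => by simp, fun x => rfl⟩

end FieldOfDefinition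

/-- **Theorem 2 (Marin–Michel).** For an irreducible complex reflection group `G ⊂ GL(V)`,
the characters of the faithful irreducible representations of `G` in which all reflections
of `G` act by reflections are exactly the transforms `γ ∘ χ_V` of the character `χ_V` of `V`
by the elements `γ` of `Gal(K/ℚ)`, where `K` is the field of definition of `G`. -/
theorem reflection_characters_are_galois_transforms
    {V : Type} [AddCommGroup V] [Module ℂ V] [FiniteDimensional ℂ V]
    (G : Subgroup (V ≃ₗ[ℂ] V)) (hG : IsReflectionGroup G) (hirr : ActsIrreducibly G)
    (χ : ↥G → ℂ) :
    (∃ (n : ℕ) (ρ : ↥G →* ((Fin n → ℂ) ≃ₗ[ℂ] (Fin n → ℂ))),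
        Function.Injective ρ ∧ IsIrreducibleRep ρ ∧
        (∀ g : ↥G, IsPseudoReflection ((g : V ≃ₗ[ℂ] V)) → IsPseudoReflection (ρ g)) ∧
        (∀ g : ↥G, χ g = LinearMap.trace ℂ (Fin n → ℂ) ((ρ g : (Fin n → ℂ) ≃ₗ[ℂ] (Fin n → ℂ)) : (Fin n → ℂ) →ₗ[ℂ] (Fin n → ℂ))))
    ↔
    (∃ γ : ↥(fieldOfDefinition G) ≃ₐ[ℚ] ↥(fieldOfDefinition G),
        ∀ g : ↥G, χ g = (γ (reflChar G g) : ℂ)) := by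
  obtain ⟨hfin, hcl⟩ := hG
  set e := (Module.finBasis ℂ V).equivFun
  set ρ₀ : Representation ℂ G (Fin (finrank ℂ V) → ℂ) :=
    conjRepresentation e (toRepresentation G.subtype) with hρ₀
  have hinj₀ : Function.Injective ρ₀ :=
    conjRepresentation_injective (toRepresentation_injective.2 G.subtype_injective)
  have hirr₀ : IsIrred ρ₀ := by
    refine (isIrred_toRepresentation.2 ⟨hirr.1, fun U hU => ?_⟩).conjRepresentation e
    exact hirr.2 U fun g hg => hU ⟨g, hg⟩
  have hrefl₀ (g : G) : IsPseudoReflection (g : V ≃ₗ[ℂ] V) ↔ codimFix (ρ₀ g) = 1 := by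
    rw [hρ₀, codimFix_conjRepresentation]
    exact isPseudoReflection_iff_codimFix (φ := G.subtype)
  have hgen₀ : Subgroup.closure {s | codimFix (ρ₀ s) = 1} = ⊤ := by
    apply Subgroup.map_injective G.subtype_injective
    rw [MonoidHom.map_closure, ← MonoidHom.range_eq_map, Subgroup.range_subtype]
    refine Eq.trans (congrArg Subgroup.closure ?_) hcl
    ext s
    simp only [← hrefl₀, reflectionsOf, Set.mem_image, Set.mem_ofPred_eq]
    exact ⟨fun ⟨t, ht, hts⟩ => hts ▸ ⟨t.2, ht⟩, fun ⟨hs, h⟩ => ⟨⟨s, hs⟩, h, rfl⟩⟩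
  have htr (g : G) : LinearMap.trace ℂ _ (ρ₀ g) = reflChar G g := trace_conjRepresentation e _ g
  constructor
  · rintro ⟨n, φ, hinj, hirr', hrefl, hχ⟩
    obtain ⟨k, hk, h⟩ := exists_trace_eq_trace_pow hinj₀ (toRepresentation_injective.2 hinj) hirr₀
      (isIrred_toRepresentation.2 hirr') hgen₀ fun s hs =>
        isPseudoReflection_iff_codimFix.1 (hrefl s ((hrefl₀ s).2 hs))
    obtain ⟨σ, hσ⟩ := exists_ringEquiv_pow (Nat.card_pos (α := G)).ne' hk
    have hσ' (g : G) : σ (reflChar G g) = reflChar G (g ^ k) := by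
      rw [← htr, ← htr, map_pow]
      exact ringHom_trace (σ := (σ : ℂ →+* ℂ)) Nat.card_pos.ne' hσ (rho_pow_card ρ₀ g)
    obtain ⟨γ, hγ⟩ := exists_algEquiv_restrict (σ := σ) (e := powCoprime hk.symm) hσ'
    refine ⟨γ, fun g => ?_⟩
    rw [hχ, hγ, hσ', ← htr, ← h]
    rfl
  · rintro ⟨γ, hγ⟩
    obtain ⟨σ, hσ⟩ := exists_ringEquiv_extending (L := ℂ) (γ : fieldOfDefinition G ≃+* _)
    obtain ⟨φ, hφ⟩ := exists_toRepresentation_eq (galoisTwist σ ρ₀)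
    refine ⟨_, φ, ?_, ?_, fun g hg => ?_, fun g => ?_⟩
    · rw [← toRepresentation_injective, hφ]
      exact (twistEnd_injective σ).comp hinj₀
    · rw [← isIrred_toRepresentation, hφ]
      exact hirr₀.galoisTwist σ
    · rw [isPseudoReflection_iff_codimFix, hφ]
      exact (codimFix_twistEnd σ _).trans ((hrefl₀ g).1 hg)
    · rw [hγ, ← toRepresentation_apply, hφ]
      refine Eq.trans ?_ (trace_twistEnd σ (ρ₀ g)).symm
      rw [htr]
      exact (hσ _).symm
end

section
/- Let G ⊂ GL(V) be an irreducible complex reflection group, where V is a vector space over K″ (K″ = K′ as in the equivariance theorem, except K″ = ℚ(ζ_20) when G = G_22). Then there is a ℚ-form V = V_0 ⊗_ℚ K″ such that the fundamental invariants of G can be taken rational: there exist algebraically independent homogeneous polynomials f_1, …, f_r ∈ S(V_0^*) (the symmetric algebra of the dual of the ℚ-vector space V_0, r = dim V) with S(V^*)^G = K″[f_1, …, f_r]. -/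
open Module LinearMap

namespace MvPolynomial

section Graded

attribute [local instance] MvPolynomial.gradedAlgebra

variable {σ R : Type*} [CommRing R]

theorem isHomogeneous_span_of_isHomogeneous {T : Set (MvPolynomial σ R)}
    (hT : ∀ t ∈ T, ∃ d : ℕ, t.IsHomogeneous d) :
    (Ideal.span T).IsHomogeneous (homogeneousSubmodule σ R) :=
  Ideal.homogeneous_span _ _ fun t ht => hT t ht

theorem homogeneousComponent_mul_of_isHomogeneous {f : MvPolynomial σ R} {m : ℕ}
    (hf : f.IsHomogeneous m) (p : MvPolynomial σ R) (n : ℕ) :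
    homogeneousComponent n (f * p) =
      if m ≤ n then f * homogeneousComponent (n - m) p else 0 := by
  have key (q : MvPolynomial σ R) (i : ℕ) :
      (DirectSum.decompose (homogeneousSubmodule σ R) q i : MvPolynomial σ R) =
        homogeneousComponent i q := decomposition.decompose'_apply q i
  rw [← key, ← key, DirectSum.coe_decompose_mul_of_left_mem _ n hf]

theorem mul_homogeneousComponent_mem {T : Set (MvPolynomial σ R)}
    (hT : ∀ t ∈ T, ∃ d : ℕ, t.IsHomogeneous d) {f p : MvPolynomial σ R} {m : ℕ}
    (hf : f.IsHomogeneous m) (h : f * p ∈ Ideal.span T) (n : ℕ) :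
    f * homogeneousComponent n p ∈ Ideal.span T := by
  have := homogeneousComponent_mem_of_mem (isHomogeneous_span_of_isHomogeneous hT) h (m + n)
  rwa [homogeneousComponent_mul_of_isHomogeneous hf, if_pos (Nat.le_add_right m n),
    Nat.add_sub_cancel_left] at this

/-- A factor of a homogeneous polynomial by a nonzero linear form is homogeneous. -/
theorem IsHomogeneous.of_linear_mul [IsDomain R] {l q : MvPolynomial σ R} {d : ℕ}
    (hl : l.IsHomogeneous 1) (hl0 : l ≠ 0) (h : (l * q).IsHomogeneous (d + 1)) :
    q.IsHomogeneous d := by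
  have := homogeneousComponent_mul_of_isHomogeneous hl q (d + 1)
  rw [homogeneousComponent_eq_self h, if_pos (Nat.le_add_left 1 d), Nat.add_sub_cancel] at this
  rw [mul_left_cancel₀ hl0 this]
  exact homogeneousComponent_isHomogeneous d q

end Graded

section Reynolds

variable {σ K Γ : Type*} [Field K] [Group Γ] [Fintype Γ]
  [MulSemiringAction Γ (MvPolynomial σ K)]

/-- The average of a polynomial over a finite group. -/
noncomputable def reynolds (Γ : Type*) [Group Γ] [Fintype Γ]
    [MulSemiringAction Γ (MvPolynomial σ K)] (p : MvPolynomial σ K) : MvPolynomial σ K :=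
  C ((Fintype.card Γ : K)⁻¹) * ∑ g : Γ, g • p

theorem smul_reynolds [SMulCommClass Γ K (MvPolynomial σ K)] (g : Γ) (p : MvPolynomial σ K) :
    g • reynolds Γ p = reynolds Γ p := by
  rw [reynolds, smul_mul', ← algebraMap_eq, smul_algebraMap, Finset.smul_sum]
  simp_rw [smul_smul]
  rw [Fintype.sum_equiv (Equiv.mulLeft g) (fun x => (g * x) • p) (fun x => x • p) fun _ => rfl]

theorem reynolds_mul {f : MvPolynomial σ K} (hf : ∀ g : Γ, g • f = f) (p : MvPolynomial σ K) :
    reynolds Γ (f * p) = f * reynolds Γ p := by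
  simp_rw [reynolds, smul_mul', hf, ← Finset.mul_sum]
  ring

theorem reynolds_sum {ι : Type*} (s : Finset ι) (p : ι → MvPolynomial σ K) :
    reynolds Γ (∑ i ∈ s, p i) = ∑ i ∈ s, reynolds Γ (p i) := by
  simp_rw [reynolds, Finset.smul_sum, ← Finset.mul_sum]
  rw [Finset.sum_comm]

theorem sub_reynolds_mem [CharZero K] {I : Ideal (MvPolynomial σ K)} {p : MvPolynomial σ K}
    (h : ∀ g : Γ, g • p - p ∈ I) : p - reynolds Γ p ∈ I := by
  have h2 : p - reynolds Γ p = -(C ((Fintype.card Γ : K)⁻¹) * ∑ g : Γ, (g • p - p)) := by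
    rw [reynolds, Finset.sum_sub_distrib, mul_sub, Finset.sum_const, nsmul_eq_mul, ← mul_assoc,
      Finset.card_univ, ← map_natCast (C : K →+* MvPolynomial σ K), ← C_mul,
      inv_mul_cancel₀ (by simp [Fintype.card_ne_zero])]
    simp
  rw [h2]
  exact neg_mem (Ideal.mul_mem_left _ _ (sum_mem fun g _ => h g))

theorem reynolds_eq_self [CharZero K] {p : MvPolynomial σ K} (h : ∀ g : Γ, g • p = p) :
    reynolds Γ p = p := by
  have := sub_reynolds_mem (Γ := Γ) (I := ⊥) (p := p) (by simp [h])
  exact (sub_eq_zero.mp (by simpa using this)).symm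

theorem IsHomogeneous.reynolds
    (hdeg : ∀ (g : Γ) (p : MvPolynomial σ K) (d : ℕ), p.IsHomogeneous d → (g • p).IsHomogeneous d)
    {p : MvPolynomial σ K} {d : ℕ} (hp : p.IsHomogeneous d) : (reynolds Γ p).IsHomogeneous d :=
  (IsHomogeneous.sum _ _ _ fun g _ => hdeg g p d hp).C_mul _

end Reynolds

section Chevalley

variable {σ K Γ : Type*} [Field K] [CharZero K] [Group Γ] [Finite Γ]
  [MulSemiringAction Γ (MvPolynomial σ K)] [SMulCommClass Γ K (MvPolynomial σ K)]

/-- An element of a group acting on a polynomial ring acts as a reflection if it moves every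
polynomial by a multiple of a fixed nonzero linear form. -/
def ActsAsReflection (s : Γ) : Prop :=
  ∃ l : MvPolynomial σ K, l.IsHomogeneous 1 ∧ l ≠ 0 ∧ ∀ p : MvPolynomial σ K, l ∣ s • p - p

omit [CharZero K] [Finite Γ] [SMulCommClass Γ K (MvPolynomial σ K)] in
theorem exists_smul_sub_eq_mul_of_mem_span {T : Set (MvPolynomial σ K)}
    (hT : ∀ t ∈ T, ∀ g : Γ, g • t = t) {s : Γ} {l : MvPolynomial σ K}
    (hl : ∀ p : MvPolynomial σ K, l ∣ s • p - p) {x : MvPolynomial σ K} (hx : x ∈ Ideal.span T) :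
    ∃ y ∈ Ideal.span T, s • x - x = l * y := by
  induction hx using Submodule.span_induction with
  | mem t ht => exact ⟨0, zero_mem _, by simp [hT t ht]⟩
  | zero => exact ⟨0, zero_mem _, by simp⟩
  | add x y _ _ hx hy =>
    obtain ⟨a, ha, hxa⟩ := hx
    obtain ⟨b, hb, hyb⟩ := hy
    exact ⟨a + b, add_mem ha hb, by rw [smul_add, mul_add, ← hxa, ← hyb]; ring⟩
  | smul r x hxT hx =>
    obtain ⟨a, ha, hxa⟩ := hx
    obtain ⟨q, hq⟩ := hl r
    refine ⟨q * x + s • r * a, add_mem (Ideal.mul_mem_left _ _ hxT) (Ideal.mul_mem_left _ _ ha), ?_⟩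
    have h1 : s • x = x + l * a := by rw [← hxa]; ring
    have h2 : s • r = r + l * q := by rw [← hq]; ring
    rw [smul_eq_mul, smul_mul', h1, h2]
    ring

omit [Finite Γ] [CharZero K] [SMulCommClass Γ K (MvPolynomial σ K)] in
theorem smul_sub_mem_of_closure_eq_top {I : Ideal (MvPolynomial σ K)}
    (hI : ∀ g : Γ, ∀ p ∈ I, g • p ∈ I) {S : Set Γ} (hS : Subgroup.closure S = ⊤)
    {p : MvPolynomial σ K} (hp : ∀ s ∈ S, s • p - p ∈ I) (g : Γ) : g • p - p ∈ I := by
  have hg : g ∈ Subgroup.closure S := hS ▸ Subgroup.mem_top g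
  induction hg using Subgroup.closure_induction with
  | mem s hs => exact hp s hs
  | one => simp
  | mul g h _ _ hg hh =>
    have := add_mem (hI g _ hh) hg
    rwa [smul_sub, smul_smul, sub_add_sub_cancel] at this
  | inv g _ hg =>
    have := neg_mem (hI g⁻¹ _ hg)
    rwa [smul_sub, inv_smul_smul, neg_sub] at this

/-- Chevalley's lemma on relations with invariant coefficients. -/
theorem mem_of_mul_mem_span
    (hdeg : ∀ (g : Γ) (p : MvPolynomial σ K) (d : ℕ), p.IsHomogeneous d → (g • p).IsHomogeneous d)
    (hrefl : Subgroup.closure {s : Γ | ActsAsReflection (σ := σ) (K := K) s} = ⊤)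
    {I : Ideal (MvPolynomial σ K)} (hI : ∀ g : Γ, ∀ p ∈ I, g • p ∈ I)
    (hpos : ∀ p d, 0 < d → p.IsHomogeneous d → (∀ g : Γ, g • p = p) → p ∈ I)
    {T : Set (MvPolynomial σ K)} (hT : ∀ t ∈ T, ∀ g : Γ, g • t = t)
    {f : MvPolynomial σ K} (hf : ∀ g : Γ, g • f = f) (hfT : f ∉ Ideal.span T)
    {d : ℕ} {p : MvPolynomial σ K} (hp : p.IsHomogeneous d) (h : f * p ∈ Ideal.span T) :
    p ∈ I := by
  have := Fintype.ofFinite Γ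
  induction d generalizing p with
  | zero =>
    rw [← totalDegree_zero_iff_isHomogeneous, totalDegree_eq_zero_iff_eq_C] at hp
    obtain ⟨c, rfl⟩ : ∃ c, p = C c := ⟨_, hp⟩
    by_cases hc : c = 0
    · simp [hc]
    · refine absurd ?_ hfT
      have h2 := Ideal.mul_mem_right (C c⁻¹) _ h
      rwa [mul_assoc, ← C_mul, mul_inv_cancel₀ hc, C_1, mul_one] at h2
  | succ d ih =>
    have hmove : ∀ g : Γ, g • p - p ∈ I := by
      refine smul_sub_mem_of_closure_eq_top hI hrefl ?_
      rintro s ⟨l, hl1, hl0, hl⟩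
      obtain ⟨q, hq⟩ := hl p
      obtain ⟨y, hy, hxy⟩ := exists_smul_sub_eq_mul_of_mem_span hT hl h
      have hfq : f * q = y := by
        apply mul_left_cancel₀ hl0
        rw [← hxy, smul_mul', hf, ← mul_sub, hq]
        ring
      rw [hq]
      refine Ideal.mul_mem_left _ _ (ih ?_ (hfq ▸ hy))
      exact IsHomogeneous.of_linear_mul hl1 hl0 (hq ▸ (hdeg s p _ hp).sub hp)
    have := add_mem (sub_reynolds_mem hmove)
      (hpos _ _ d.succ_pos (hp.reynolds hdeg) fun g => smul_reynolds g p)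
    rwa [sub_add_cancel] at this

theorem mem_of_forall_homogeneousComponent_mem {R : Type*} [CommRing R]
    {I : Ideal (MvPolynomial σ R)} {p : MvPolynomial σ R}
    (h : ∀ n, homogeneousComponent n p ∈ I) : p ∈ I := by
  rw [← sum_homogeneousComponent p]
  exact sum_mem fun n _ => h n

omit [CharZero K] [Finite Γ] [SMulCommClass Γ K (MvPolynomial σ K)] in
theorem smul_homogeneousComponent
    (hdeg : ∀ (g : Γ) (p : MvPolynomial σ K) (d : ℕ), p.IsHomogeneous d → (g • p).IsHomogeneous d)
    (g : Γ) (n : ℕ) (p : MvPolynomial σ K) :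
    g • homogeneousComponent n p = homogeneousComponent n (g • p) := by
  conv_rhs => rw [← sum_homogeneousComponent p, Finset.smul_sum, map_sum]
  have h (i : ℕ) : homogeneousComponent n (g • homogeneousComponent i p) =
      if n = i then g • homogeneousComponent i p else 0 :=
    homogeneousComponent_of_mem (hdeg g _ i (homogeneousComponent_isHomogeneous i p))
  simp_rw [h]
  rw [Finset.sum_ite_eq]
  split_ifs with hn
  · rfl
  · rw [homogeneousComponent_eq_zero, smul_zero]
    simpa using hn

/-- A finite family contains a minimal subfamily generating the same ideal. -/
theorem _root_.Ideal.exists_minimal_span_image {ι A : Type*} [CommRing A] (h : ι → A)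
    (s : Finset ι) : ∃ S ⊆ s, Ideal.span (h '' S) = Ideal.span (h '' s) ∧
      ∀ i ∈ S, h i ∉ Ideal.span (h '' (S \ {i})) := by
  classical
  obtain ⟨S, hSs, hS⟩ := exists_minimal_le_of_wellFoundedLT
    (fun S : Finset ι => Ideal.span (h '' S) = Ideal.span (h '' s)) s rfl
  refine ⟨S, hSs, hS.prop, fun i hi hmem => ?_⟩
  have hcoe : (S : Set ι) = insert i ((S.erase i : Finset ι) : Set ι) := by
    rw [← Finset.coe_insert, Finset.insert_erase hi]
  have h1 : Ideal.span (h '' (S.erase i : Finset ι)) = Ideal.span (h '' s) := by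
    rw [← hS.prop, hcoe, Set.image_insert_eq]
    rw [← Finset.coe_erase] at hmem
    exact (Submodule.span_insert_eq_span hmem).symm
  exact Finset.notMem_erase i S (hS.le_of_le h1 (Finset.erase_subset i S) hi)

omit [CharZero K] in
theorem notMem_vars_of_isWeightedHomogeneous {ι : Type*} {w : ι → ℕ} {h : MvPolynomial ι K}
    {N : ℕ} (hh : h.IsWeightedHomogeneous w N) {i : ι} (hi : N < w i) : i ∉ h.vars := by
  rw [mem_vars_iff_mem_support]
  rintro ⟨m, hm, him⟩
  have h1 := hh (mem_support_iff.mp hm)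
  have h2 : w i ≤ Finsupp.weight w m :=
    Finsupp.le_weight_of_ne_zero' w (Finsupp.mem_support_iff.mp him)
  omega

omit [CharZero K] in
theorem IsWeightedHomogeneous.aeval_isHomogeneous {ι : Type*} {w : ι → ℕ} {h : MvPolynomial ι K}
    {N : ℕ} (hh : h.IsWeightedHomogeneous w N) {F : ι → MvPolynomial σ K}
    (hF : ∀ i, (F i).IsHomogeneous (w i)) : (aeval F h).IsHomogeneous N := by
  rw [aeval_def, eval₂]
  refine IsHomogeneous.sum _ _ _ fun m hm => ?_
  rw [← zero_add N, ← hh (mem_support_iff.mp hm), Finsupp.weight_apply]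
  refine (isHomogeneous_C _ _).mul (IsHomogeneous.prod _ _ _ fun i _ => ?_)
  simpa [mul_comm] using (hF i).pow (m i)

omit [CharZero K] in
theorem pderiv_aeval {ι : Type*} [Fintype ι] (F : ι → MvPolynomial σ K) (h : MvPolynomial ι K)
    (k : σ) : pderiv k (aeval F h) = ∑ i, aeval F (pderiv i h) * pderiv k (F i) := by
  classical
  induction h using MvPolynomial.induction_on with
  | C a => simp [← algebraMap_eq]
  | add p q hp hq => simp only [map_add, hp, hq, add_mul, Finset.sum_add_distrib]
  | mul_X p j hp =>
    simp only [map_mul, aeval_X, Derivation.leibniz, hp, smul_eq_mul, map_add, pderiv_X, add_mul,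
      Finset.sum_add_distrib, Finset.mul_sum]
    congr 1
    · rw [Finset.sum_eq_single j]
      · simp
      · intro b _ hb
        simp [hb.symm]
      · simp
    · exact Finset.sum_congr rfl fun i _ => by ring

theorem mul_sum_eq_neg_sum_of_sum_eq_zero {ι A : Type*} [Fintype ι] [CommRing A] {u y : ι → A}
    (a : ι → A) (i : ι) (h : ∑ j, u j * y j = 0) :
    u i * ∑ j, a j * y j = -∑ j, y j * (u j - a j * u i) := by
  have h1 : ∑ j, y j * (u j - a j * u i) = ∑ j, u j * y j - u i * ∑ j, a j * y j := by
    rw [Finset.mul_sum, ← Finset.sum_sub_distrib]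
    exact Finset.sum_congr rfl fun j _ => by ring
  rw [h1, h]
  ring

section Generators

variable {ι : Type*} [Fintype ι] {F : ι → MvPolynomial σ K} {w : ι → ℕ}

theorem mem_adjoin_of_forall_smul_eq
    (hdeg : ∀ (g : Γ) (p : MvPolynomial σ K) (d : ℕ), p.IsHomogeneous d → (g • p).IsHomogeneous d)
    (hF : ∀ i, (F i).IsHomogeneous (w i)) (hw : ∀ i, 0 < w i) (hinv : ∀ i, ∀ g : Γ, g • F i = F i)
    (hpos : ∀ p d, 0 < d → p.IsHomogeneous d → (∀ g : Γ, g • p = p) →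
      p ∈ Ideal.span (Set.range F))
    {p : MvPolynomial σ K} (hp : ∀ g : Γ, g • p = p) : p ∈ Algebra.adjoin K (Set.range F) := by
  have := Fintype.ofFinite Γ
  suffices H : ∀ d (q : MvPolynomial σ K), q.IsHomogeneous d → (∀ g : Γ, g • q = q) →
      q ∈ Algebra.adjoin K (Set.range F) by
    rw [← sum_homogeneousComponent p]
    refine sum_mem fun n _ => H n _ (homogeneousComponent_isHomogeneous n p) fun g => ?_
    rw [smul_homogeneousComponent hdeg, hp]
  intro d
  induction d using Nat.strong_induction_on with
  | _ d ih =>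
    intro q hq hqinv
    obtain rfl | hd := Nat.eq_zero_or_pos d
    · rw [← totalDegree_zero_iff_isHomogeneous, totalDegree_eq_zero_iff_eq_C] at hq
      rw [hq]
      exact Subalgebra.algebraMap_mem _ _
    obtain ⟨a, ha⟩ := Ideal.mem_span_range_iff_exists_fun.mp (hpos q d hd hq hqinv)
    have h1 : q = ∑ i, F i * reynolds Γ (a i) := by
      conv_lhs => rw [← reynolds_eq_self hqinv, ← ha, reynolds_sum]
      exact Finset.sum_congr rfl fun i _ => by rw [mul_comm, reynolds_mul (hinv i)]
    rw [← homogeneousComponent_eq_self hq, h1, map_sum]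
    refine sum_mem fun i _ => ?_
    rw [homogeneousComponent_mul_of_isHomogeneous (hF i)]
    split_ifs with hi
    · refine mul_mem (Algebra.subset_adjoin ⟨i, rfl⟩) (ih _ (by have := hw i; omega) _
        (homogeneousComponent_isHomogeneous _ _) fun g => ?_)
      rw [smul_homogeneousComponent hdeg, smul_reynolds]
    · exact zero_mem _

omit [CharZero K] [Finite Γ] [Fintype ι] in
theorem smul_eq_of_mem_adjoin (hinv : ∀ i, ∀ g : Γ, g • F i = F i) {p : MvPolynomial σ K}
    (hp : p ∈ Algebra.adjoin K (Set.range F)) (g : Γ) : g • p = p := by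
  have h : Algebra.adjoin K (Set.range F) ≤ FixedPoints.subalgebra K (MvPolynomial σ K) Γ :=
    Algebra.adjoin_le (by rintro _ ⟨i, rfl⟩; exact hinv i)
  exact h hp g

omit [Group Γ] [Finite Γ] [MulSemiringAction Γ (MvPolynomial σ K)]
  [SMulCommClass Γ K (MvPolynomial σ K)] in
theorem mem_span_image_compl_of_sum_mul_pderiv_mem [Fintype σ]
    (hF : ∀ i, (F i).IsHomogeneous (w i)) {i : ι} (hi : 0 < w i) {a : ι → MvPolynomial σ K}
    (ha : a i = 1) (h : ∀ k, ∑ j, a j * pderiv k (F j) ∈ Ideal.span (Set.range F)) :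
    F i ∈ Ideal.span (F '' {i}ᶜ) := by
  classical
  set J := Ideal.span (F '' {i}ᶜ) with hJ
  have hb (k) : ∃ b : MvPolynomial σ K, ∑ j, a j * pderiv k (F j) + b * F i ∈ J := by
    have hins : Set.range F = insert (F i) (F '' {i}ᶜ) := by
      rw [← Set.image_insert_eq, ← Set.image_univ]
      congr 1
      ext j
      simp [em]
    rw [hJ, ← Ideal.mem_span_insert', ← hins]
    exact h k
  choose b hb using hb
  have hEuler (j) : ∑ k, X k * pderiv k (F j) = w j • F j := (hF j).sum_X_mul_pderiv
  have hsum : ∑ k, X k * (∑ j, a j * pderiv k (F j) + b k * F i) ∈ J :=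
    sum_mem fun k _ => Ideal.mul_mem_left _ _ (hb k)
  have heq : ∑ k, X k * (∑ j, a j * pderiv k (F j) + b k * F i) =
      F i * (C (w i : K) + ∑ k, X k * b k) + ∑ j ∈ Finset.univ.erase i, a j * (w j • F j) := by
    have h1 : ∑ k, X k * ∑ j, a j * pderiv k (F j) = ∑ j, a j * (w j • F j) := by
      simp_rw [← hEuler, Finset.mul_sum]
      rw [Finset.sum_comm]
      exact Finset.sum_congr rfl fun j _ => Finset.sum_congr rfl fun k _ => by ring
    simp_rw [mul_add, Finset.sum_add_distrib]
    rw [h1, ← Finset.add_sum_erase _ _ (Finset.mem_univ i), ha, one_mul, Finset.mul_sum]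
    simp only [nsmul_eq_mul, map_natCast]
    rw [Finset.sum_congr rfl fun k _ => show X k * (b k * F i) = F i * (X k * b k) by ring]
    ring
  have herase : ∑ j ∈ Finset.univ.erase i, a j * (w j • F j) ∈ J :=
    sum_mem fun j hj => Ideal.mul_mem_left _ _ (nsmul_mem (Ideal.subset_span
      (Set.mem_image_of_mem F (Set.mem_compl_singleton_iff.mpr (Finset.ne_of_mem_erase hj)))) _)
  rw [heq, add_mem_cancel_right herase] at hsum
  have h2 := mul_homogeneousComponent_mem
    (by rintro _ ⟨j, -, rfl⟩; exact ⟨w j, hF j⟩) (hF i) hsum 0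
  rw [homogeneousComponent_zero] at h2
  have hc : coeff 0 (C (w i : K) + ∑ k, X k * b k : MvPolynomial σ K) = (w i : K) := by
    rw [← constantCoeff_eq]
    simp
  rw [hc] at h2
  have h3 := Ideal.mul_mem_right (C (w i : K)⁻¹) _ h2
  rwa [mul_assoc, ← C_mul, mul_inv_cancel₀ (by exact_mod_cast hi.ne'), C_1, mul_one] at h3

omit [CharZero K] [Finite Γ] [SMulCommClass Γ K (MvPolynomial σ K)] in
theorem smul_mem_span_range (hinv : ∀ i, ∀ g : Γ, g • F i = F i) (g : Γ) (p : MvPolynomial σ K)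
    (hp : p ∈ Ideal.span (Set.range F)) : g • p ∈ Ideal.span (Set.range F) := by
  obtain ⟨c, rfl⟩ := Ideal.mem_span_range_iff_exists_fun.mp hp
  rw [Finset.smul_sum]
  refine sum_mem fun j _ => ?_
  rw [smul_mul', hinv]
  exact Ideal.mul_mem_left _ _ (Ideal.subset_span ⟨j, rfl⟩)

/-- The relations between minimal homogeneous generators of the ideal of positive degree
invariants of a reflection group that are homogeneous are trivial. -/
theorem eq_zero_of_aeval_eq_zero_of_isWeightedHomogeneous [Fintype σ]
    (hdeg : ∀ (g : Γ) (p : MvPolynomial σ K) (d : ℕ), p.IsHomogeneous d → (g • p).IsHomogeneous d)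
    (hrefl : Subgroup.closure {s : Γ | ActsAsReflection (σ := σ) (K := K) s} = ⊤)
    (hF : ∀ i, (F i).IsHomogeneous (w i)) (hw : ∀ i, 0 < w i) (hinv : ∀ i, ∀ g : Γ, g • F i = F i)
    (hpos : ∀ p d, 0 < d → p.IsHomogeneous d → (∀ g : Γ, g • p = p) →
      p ∈ Ideal.span (Set.range F))
    (hmin : ∀ i, F i ∉ Ideal.span (F '' {i}ᶜ)) {N : ℕ} {h : MvPolynomial ι K}
    (hh : h.IsWeightedHomogeneous w N) (h0 : aeval F h = 0) : h = 0 := by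
  classical
  induction N using Nat.strong_induction_on generalizing h with
  | _ N ih =>
  by_contra hne
  set u : ι → MvPolynomial σ K := fun i => aeval F (pderiv i h) with hu
  have hhom (i) : ∃ d : ℕ, (u i).IsHomogeneous d := by
    by_cases hi : w i ≤ N
    · exact ⟨N - w i, (hh.pderiv (Nat.sub_add_cancel hi)).aeval_isHomogeneous hF⟩
    · refine ⟨0, ?_⟩
      rw [hu]
      dsimp only
      rw [pderiv_eq_zero_of_notMem_vars
        (notMem_vars_of_isWeightedHomogeneous hh (not_le.mp hi)), map_zero]
      exact isHomogeneous_zero _ _ _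
  have huinv (i) (g : Γ) : g • u i = u i :=
    smul_eq_of_mem_adjoin hinv (by rw [Algebra.adjoin_range_eq_range_aeval]; exact ⟨_, rfl⟩) g
  obtain ⟨S, -, hspan, hSmin⟩ := Ideal.exists_minimal_span_image u Finset.univ
  have hmemS (j) : u j ∈ Ideal.span (u '' S) := hspan ▸ Ideal.subset_span ⟨j, by simp⟩
  obtain rfl | ⟨i, hiS⟩ := S.eq_empty_or_nonempty
  · have hz (i) : pderiv i h = 0 := by
      by_cases hi : w i ≤ N
      · refine ih (N - w i) (by have := hw i; omega) (hh.pderiv (Nat.sub_add_cancel hi)) ?_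
        have := hmemS i
        rwa [Finset.coe_empty, Set.image_empty, Ideal.span_empty, Ideal.mem_bot] at this
      · exact pderiv_eq_zero_of_notMem_vars
          (notMem_vars_of_isWeightedHomogeneous hh (not_le.mp hi))
    have hE := hh.sum_weight_X_mul_pderiv
    simp only [hz, mul_zero, smul_zero, Finset.sum_const_zero] at hE
    obtain rfl : N = 0 := by simpa [hne] using hE.symm
    have hv : h.vars = ∅ := Finset.eq_empty_of_forall_notMem fun i =>
      notMem_vars_of_isWeightedHomogeneous hh (hw i)
    rw [vars_eq_empty_iff_eq_C] at hv
    rw [hv, aeval_C, algebraMap_eq, C_eq_zero] at h0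
    rw [h0, C_0] at hv
    exact hne hv
  · set T := u '' (S \ {i}) with hT
    have hSins : u '' S = insert (u i) T := by
      rw [hT, ← Set.image_insert_eq, Set.insert_sdiff_singleton,
        Set.insert_eq_of_mem (Finset.mem_coe.mpr hiS)]
    have hcoef (j) : ∃ a : MvPolynomial σ K, (j = i → a = 1) ∧ u j - a * u i ∈ Ideal.span T := by
      by_cases hj : j = i
      · exact ⟨1, fun _ => rfl, by simp [hj]⟩
      · have := hmemS j
        rw [hSins, Ideal.mem_span_insert'] at this
        obtain ⟨a, ha⟩ := this
        exact ⟨-a, fun h => absurd h hj, by simpa using ha⟩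
    choose a ha1 ha using hcoef
    have hTinv : ∀ t ∈ T, ∀ g : Γ, g • t = t := by
      rintro _ ⟨j, -, rfl⟩
      exact huinv j
    have hThom : ∀ t ∈ T, ∃ d : ℕ, t.IsHomogeneous d := by
      rintro _ ⟨j, -, rfl⟩
      exact hhom j
    have hIsmul : ∀ g : Γ, ∀ p ∈ Ideal.span (Set.range F), g • p ∈ Ideal.span (Set.range F) :=
      smul_mem_span_range hinv
    have hmemI (k) : ∑ j, a j * pderiv k (F j) ∈ Ideal.span (Set.range F) := by
      have h1 : u i * ∑ j, a j * pderiv k (F j) ∈ Ideal.span T := by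
        have h3 := pderiv_aeval F h k
        rw [h0, map_zero] at h3
        rw [mul_sum_eq_neg_sum_of_sum_eq_zero (u := u) a i h3.symm]
        exact neg_mem (sum_mem fun j _ => Ideal.mul_mem_left _ _ (ha j))
      obtain ⟨m, hm⟩ := hhom i
      exact mem_of_forall_homogeneousComponent_mem fun n =>
        mem_of_mul_mem_span hdeg hrefl hIsmul hpos hTinv (huinv i) (hSmin i hiS)
          (homogeneousComponent_isHomogeneous _ _) (mul_homogeneousComponent_mem hThom hm h1 n)
    exact hmin i (mem_span_image_compl_of_sum_mul_pderiv_mem hF (hw i) (ha1 i rfl) hmemI)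

theorem algebraicIndependent_of_minimal [Fintype σ]
    (hdeg : ∀ (g : Γ) (p : MvPolynomial σ K) (d : ℕ), p.IsHomogeneous d → (g • p).IsHomogeneous d)
    (hrefl : Subgroup.closure {s : Γ | ActsAsReflection (σ := σ) (K := K) s} = ⊤)
    (hF : ∀ i, (F i).IsHomogeneous (w i)) (hw : ∀ i, 0 < w i) (hinv : ∀ i, ∀ g : Γ, g • F i = F i)
    (hpos : ∀ p d, 0 < d → p.IsHomogeneous d → (∀ g : Γ, g • p = p) →
      p ∈ Ideal.span (Set.range F))
    (hmin : ∀ i, F i ∉ Ideal.span (F '' {i}ᶜ)) : AlgebraicIndependent K F := by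
  rw [algebraicIndependent_iff]
  intro h h0
  have hfin := weightedHomogeneousComponent_finsupp (w := w) h
  have hsum := sum_weightedHomogeneousComponent w h
  rw [finsum_eq_sum _ hfin] at hsum
  rw [← hsum]
  refine Finset.sum_eq_zero fun n hn => ?_
  have hwn := weightedHomogeneousComponent_isWeightedHomogeneous (w := w) n h
  refine eq_zero_of_aeval_eq_zero_of_isWeightedHomogeneous hdeg hrefl hF hw hinv hpos hmin hwn ?_
  have h1 := congrArg (homogeneousComponent n) h0
  rw [← hsum, map_sum, map_sum, map_zero] at h1
  have h2 (m : ℕ) : homogeneousComponent n (aeval F (weightedHomogeneousComponent w m h)) =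
      if n = m then aeval F (weightedHomogeneousComponent w m h) else 0 :=
    homogeneousComponent_of_mem
      ((weightedHomogeneousComponent_isWeightedHomogeneous m h).aeval_isHomogeneous hF)
  simp_rw [h2] at h1
  rwa [Finset.sum_ite_eq, if_pos hn] at h1

omit [CharZero K] [SMulCommClass Γ K (MvPolynomial σ K)] in
theorem card_eq_of_algebraicIndependent [Fintype σ] (hind : AlgebraicIndependent K F)
    (hadj : ∀ p : MvPolynomial σ K, (∀ g : Γ, g • p = p) → p ∈ Algebra.adjoin K (Set.range F)) :
    Fintype.card ι = Fintype.card σ := by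
  have : Algebra.IsInvariant (Algebra.adjoin K (Set.range F)) (MvPolynomial σ K) Γ :=
    ⟨fun p hp => ⟨⟨p, hadj p hp⟩, rfl⟩⟩
  have := Algebra.IsInvariant.isIntegral (Algebra.adjoin K (Set.range F)) (MvPolynomial σ K) Γ
  have hb : IsTranscendenceBasis K F := hind.isTranscendenceBasis_iff_isAlgebraic.mpr inferInstance
  have := hb.lift_cardinalMk_eq (IsTranscendenceBasis.mvPolynomial σ K)
  simpa using this

end Generators

end Chevalley

section GaloisDescent

variable {σ k K : Type*} [Field k] [Field K] [Algebra k K] [FiniteDimensional k K] [IsGalois k K]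

/-- Galois descent for spaces of polynomials: a homogeneous element of a Galois stable subspace
is a linear combination of elements of the subspace with coefficients in the base field. -/
theorem mem_span_map_of_forall_map_mem {N : Submodule K (MvPolynomial σ K)}
    (hN : ∀ τ : K ≃ₐ[k] K, ∀ p ∈ N, map (τ : K →+* K) p ∈ N) {p : MvPolynomial σ K} (hp : p ∈ N)
    {d : ℕ} (hd : p.IsHomogeneous d) :
    p ∈ Submodule.span K
      {x | x ∈ N ∧ ∃ q : MvPolynomial σ k, q.IsHomogeneous d ∧ map (algebraMap k K) q = x} := by
  classical
  let e := Module.finBasis k K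
  let q (i) : MvPolynomial σ k :=
    ∑ m ∈ p.support, monomial m (Algebra.trace k K (e i * coeff m p))
  have hq (i m) : coeff m (q i) = Algebra.trace k K (e i * coeff m p) := by
    simp only [q, coeff_sum, coeff_monomial, Finset.sum_ite_eq', mem_support_iff]
    split_ifs with h
    · rfl
    · rw [not_not.mp h, mul_zero, map_zero]
  have hmap (i) : map (algebraMap k K) (q i) = ∑ τ : K ≃ₐ[k] K, map (τ : K →+* K) (e i • p) := by
    ext m
    simp [hq, coeff_sum, coeff_map, trace_eq_sum_automorphisms]
  have hsum : p = ∑ i, e.traceDual i • map (algebraMap k K) (q i) := by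
    ext m
    conv_lhs => rw [← e.traceDual.sum_repr (coeff m p)]
    rw [coeff_sum]
    refine Finset.sum_congr rfl fun i _ => ?_
    rw [coeff_smul, coeff_map, hq, Basis.traceDual_repr_apply, Algebra.traceForm_apply,
      Algebra.smul_def, smul_eq_mul, mul_comm, mul_comm (e i)]
  rw [hsum]
  refine sum_mem fun i _ => Submodule.smul_mem _ _ (Submodule.subset_span ⟨?_, q i, ?_, rfl⟩)
  · rw [hmap]
    exact sum_mem fun τ _ => hN τ _ (N.smul_mem _ hp)
  · refine IsHomogeneous.sum _ _ _ fun m hm => isHomogeneous_monomial _ ?_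
    have := hd (mem_support_iff.mp hm)
    rwa [Finsupp.degree_eq_weight_one]

end GaloisDescent

section Rational

variable {σ k K Γ : Type*} [Fintype σ] [Field k] [Field K] [Algebra k K] [FiniteDimensional k K]
  [IsGalois k K] [CharZero K] [Group Γ] [Finite Γ] [MulSemiringAction Γ (MvPolynomial σ K)]
  [SMulCommClass Γ K (MvPolynomial σ K)]

/-- **Chevalley's theorem** over a Galois extension: if the invariants of a finite group generated
by reflections are stable under the Galois group, then they form a polynomial algebra on
homogeneous generators with coefficients in the base field. -/
theorem exists_fundamental_invariants
    (hdeg : ∀ (g : Γ) (p : MvPolynomial σ K) (d : ℕ), p.IsHomogeneous d → (g • p).IsHomogeneous d)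
    (hrefl : Subgroup.closure {s : Γ | ActsAsReflection (σ := σ) (K := K) s} = ⊤)
    (hgal : ∀ (τ : K ≃ₐ[k] K) (p : MvPolynomial σ K), (∀ g : Γ, g • p = p) →
      ∀ g : Γ, g • map (τ : K →+* K) p = map (τ : K →+* K) p) :
    ∃ f : σ → MvPolynomial σ k, (∀ i, ∃ d, (f i).IsHomogeneous d) ∧
      AlgebraicIndependent K (fun i => map (algebraMap k K) (f i)) ∧
      ∀ p : MvPolynomial σ K, (∀ g : Γ, g • p = p) ↔
        p ∈ Algebra.adjoin K (Set.range fun i => map (algebraMap k K) (f i)) := by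
  classical
  let N : Submodule K (MvPolynomial σ K) :=
    { carrier := {p | ∀ g : Γ, g • p = p}
      zero_mem' := fun g => smul_zero g
      add_mem' := fun hp hq g => by rw [smul_add, hp g, hq g]
      smul_mem' := fun c p hp g => by rw [smul_comm, hp g] }
  let T : Set (MvPolynomial σ K) := {x | x ∈ N ∧ ∃ d, 0 < d ∧
    ∃ q : MvPolynomial σ k, q.IsHomogeneous d ∧ map (algebraMap k K) q = x}
  obtain ⟨t, htT, ht⟩ := (Submodule.fg_span_iff_fg_span_finset_subset T).mp
    (IsNoetherian.noetherian (Ideal.span T))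
  obtain ⟨S, hSt, hS, hmin⟩ := Ideal.exists_minimal_span_image id t
  have hST (x : S) : (x : MvPolynomial σ K) ∈ T := htT (hSt x.2)
  choose hN w hw f hf hfF using hST
  have hspan : Ideal.span (Set.range ((↑) : S → MvPolynomial σ K)) = Ideal.span T := by
    rw [Subtype.range_coe_subtype]
    simpa using hS.trans (by simpa using ht.symm)
  have hF (x : S) : (x : MvPolynomial σ K).IsHomogeneous (w x) := hfF x ▸ (hf x).map _
  have hmin' (x : S) : (x : MvPolynomial σ K) ∉
      Ideal.span (((↑) : S → MvPolynomial σ K) '' {x}ᶜ) := by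
    have : ((↑) : S → MvPolynomial σ K) '' {x}ᶜ = _root_.id '' (↑S \ {↑x}) := by
      rw [Set.image_id, Set.compl_eq_univ_sdiff, Set.image_sdiff Subtype.val_injective,
        Set.image_univ, Subtype.range_coe_subtype, Set.image_singleton]
      rfl
    rw [this]
    exact hmin x x.2
  have hpos (p : MvPolynomial σ K) (d : ℕ) (hd : 0 < d) (hp : p.IsHomogeneous d)
      (hinv : ∀ g : Γ, g • p = p) :
      p ∈ Ideal.span (Set.range ((↑) : S → MvPolynomial σ K)) := by
    rw [hspan]
    refine Submodule.span_le_restrictScalars K _ T (Submodule.span_mono ?_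
      (mem_span_map_of_forall_map_mem (N := N) hgal hinv hp))
    rintro x ⟨hx, q, hq, rfl⟩
    exact ⟨hx, d, hd, q, hq, rfl⟩
  have hind := algebraicIndependent_of_minimal hdeg hrefl hF hw hN hpos hmin'
  have hadj (p : MvPolynomial σ K) (hp : ∀ g : Γ, g • p = p) :=
    mem_adjoin_of_forall_smul_eq hdeg hF hw hN hpos hp
  let e : σ ≃ S := Fintype.equivOfCardEq (card_eq_of_algebraicIndependent hind hadj).symm
  have he : (fun i => map (algebraMap k K) (f (e i))) = ((↑) : S → MvPolynomial σ K) ∘ e :=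
    _root_.funext fun i => hfF (e i)
  refine ⟨fun i => f (e i), fun i => ⟨_, hf (e i)⟩, ?_, fun p => ?_⟩
  · rw [he]
    exact hind.comp _ e.injective
  · rw [he, e.surjective.range_comp]
    exact ⟨hadj p, fun hp g => smul_eq_of_mem_adjoin hN hp g⟩

end Rational

section LinearAction

variable {ι K V : Type*} [Fintype ι] [DecidableEq ι] [Field K] [AddCommGroup V] [Module K V]
  (b : Basis ι K V)

/-- The polynomial function `p ∘ f` in the coordinates given by `b`. -/
noncomputable def compLinear (f : V →ₗ[K] V) : MvPolynomial ι K →ₐ[K] MvPolynomial ι K :=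
  aeval fun i => ∑ j, C (LinearMap.toMatrix b b f i j) * X j

theorem compLinear_X (f : V →ₗ[K] V) (i : ι) :
    compLinear b f (X i) = ∑ j, C (LinearMap.toMatrix b b f i j) * X j := aeval_X _ _

theorem eval_compLinear (f : V →ₗ[K] V) (p : MvPolynomial ι K) (v : V) :
    eval (fun i => b.repr v i) (compLinear b f p) = eval (fun i => b.repr (f v) i) p := by
  rw [← LinearMap.toMatrix_mulVec_repr b b f v]
  induction p using MvPolynomial.induction_on with
  | C a => simp [compLinear]
  | add p q hp hq => simp [hp, hq]
  | mul_X p i hp => simp [hp, compLinear_X, Matrix.mulVec, dotProduct]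

theorem isHomogeneous_compLinear (f : V →ₗ[K] V) {p : MvPolynomial ι K} {d : ℕ}
    (hp : p.IsHomogeneous d) : (compLinear b f p).IsHomogeneous d := by
  have h := hp.aeval (fun i => ∑ j, C (LinearMap.toMatrix b b f i j) * X j) (n := 1) fun i =>
    IsHomogeneous.sum _ _ _ fun j _ => by
      simpa using (isHomogeneous_C ι _).mul (isHomogeneous_X K j)
  rwa [one_mul] at h

theorem compLinear_id (p : MvPolynomial ι K) : compLinear b LinearMap.id p = p := by
  have : compLinear b LinearMap.id = AlgHom.id K _ :=
    algHom_ext fun i => by simp [compLinear_X, Matrix.one_apply, apply_ite C, ite_mul]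
  rw [this, AlgHom.id_apply]

theorem compLinear_comp (f g : V →ₗ[K] V) (p : MvPolynomial ι K) :
    compLinear b (f ∘ₗ g) p = compLinear b g (compLinear b f p) := by
  have : compLinear b (f ∘ₗ g) = (compLinear b g).comp (compLinear b f) :=
    algHom_ext fun i => by
      simp only [AlgHom.comp_apply, compLinear_X, LinearMap.toMatrix_comp b b b, Matrix.mul_apply,
        map_sum, map_mul, Finset.sum_mul, Finset.mul_sum, mul_assoc, algHom_C, algebraMap_eq]
      exact Finset.sum_comm
  rw [this, AlgHom.comp_apply]

variable {b} in
theorem compLinear_eq_self_iff [Infinite K] {f : V →ₗ[K] V} {p : MvPolynomial ι K} :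
    compLinear b f p = p ↔
      ∀ v, eval (fun i => b.repr (f v) i) p = eval (fun i => b.repr v i) p := by
  refine ⟨fun h v => by rw [← eval_compLinear, h], fun h => MvPolynomial.funext fun x => ?_⟩
  have hx : x = fun i => b.repr (b.equivFun.symm x) i := by
    ext i
    rw [← b.equivFun_apply, LinearEquiv.apply_symm_apply]
  rw [hx, eval_compLinear, h]

theorem map_compLinear {f g : V →ₗ[K] V} (τ : K →+* K)
    (h : ∀ i j, LinearMap.toMatrix b b g i j = τ (LinearMap.toMatrix b b f i j))
    (p : MvPolynomial ι K) : map τ (compLinear b f p) = compLinear b g (map τ p) := by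
  induction p using MvPolynomial.induction_on with
  | C a => simp [compLinear]
  | add p q hp hq => simp [hp, hq]
  | mul_X p i hp => simp [hp, compLinear_X, h]

/-- The action of a linear group on the polynomial functions on `V`. -/
@[reducible]
noncomputable def linearGroupAction (G : Subgroup (V ≃ₗ[K] V)) :
    MulSemiringAction G (MvPolynomial ι K) where
  smul g p := compLinear b ((g⁻¹ : G) : V ≃ₗ[K] V) p
  one_smul p := compLinear_id b p
  mul_smul g h p := by
    change compLinear b _ p = compLinear b _ (compLinear b _ p)
    rw [← compLinear_comp, mul_inv_rev]
    rfl
  smul_zero g := map_zero _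
  smul_add g p q := map_add _ _ _
  smul_one g := map_one _
  smul_mul g p q := map_mul _ _ _

/-- A linear form vanishing on the hyperplane of a reflection divides all differences
`p ∘ s - p`. -/
theorem exists_dvd_compLinear_sub_self {s : V →ₗ[K] V} (hs : s ≠ LinearMap.id)
    (hr : finrank K (LinearMap.ker (s - LinearMap.id)) + 1 = finrank K V) :
    ∃ l : MvPolynomial ι K, l.IsHomogeneous 1 ∧ l ≠ 0 ∧ ∀ p, l ∣ compLinear b s p - p := by
  have := Module.Finite.of_basis b
  have hrank : finrank K (LinearMap.range (s - LinearMap.id)) = 1 := by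
    have := (s - LinearMap.id).finrank_range_add_finrank_ker
    omega
  obtain ⟨a, -, ha⟩ := finrank_eq_one_iff'.mp hrank
  choose c hc using fun j => ha ⟨(s - LinearMap.id : V →ₗ[K] V) (b j), LinearMap.mem_range_self _ _⟩
  have hc (j) : c j • (a : V) = s (b j) - b j := congrArg Subtype.val (hc j)
  have hM (i j) : LinearMap.toMatrix b b s i j = b.repr a i * c j + if j = i then 1 else 0 := by
    have hj : s (b j) = c j • (a : V) + b j := by rw [hc, sub_add_cancel]
    rw [LinearMap.toMatrix_apply, hj]
    simp [Finsupp.single_apply, mul_comm]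
  set l : MvPolynomial ι K := ∑ j, C (c j) * X j with hl
  have hX (i) : compLinear b s (X i) - X i = C (b.repr a i) * l := by
    simp [compLinear_X, hM, add_mul, Finset.sum_add_distrib, hl, Finset.mul_sum, mul_assoc,
      apply_ite C, ite_mul]
  refine ⟨l, ?_, fun h0 => hs (b.ext fun j => ?_), fun p => ?_⟩
  · exact IsHomogeneous.sum _ _ _ fun j _ => by
      simpa using (isHomogeneous_C ι _).mul (isHomogeneous_X K j)
  · have : c j = 0 := by
      have := congrArg (coeff (Finsupp.single j 1)) h0
      simpa [hl, coeff_sum, coeff_C_mul, coeff_X, Finsupp.single_left_inj] using this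
    rw [LinearMap.id_apply, ← sub_eq_zero, ← hc, this, zero_smul]
  · rw [← Ideal.mem_span_singleton, ← Ideal.Quotient.mk_eq_mk_iff_sub_mem]
    have : (Ideal.Quotient.mkₐ K (Ideal.span {l})).comp (compLinear b s) =
        Ideal.Quotient.mkₐ K (Ideal.span {l}) := algHom_ext fun i => by
      rw [AlgHom.comp_apply, Ideal.Quotient.mkₐ_eq_mk, Ideal.Quotient.mk_eq_mk_iff_sub_mem, hX]
      exact Ideal.mul_mem_left _ _ (Ideal.mem_span_singleton_self l)
    exact DFunLike.congr_fun this p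

end LinearAction

section ReflectionGroup

variable {ι K V : Type*} [Fintype ι] [DecidableEq ι] [Field K] [AddCommGroup V] [Module K V]
  (b : Basis ι K V) {G : Subgroup (V ≃ₗ[K] V)}

theorem actsAsReflection_of_isPseudoReflection (g : G)
    (hg : IsPseudoReflection (g : V ≃ₗ[K] V)) :
    letI := linearGroupAction b G
    ActsAsReflection (σ := ι) (K := K) g := by
  let := linearGroupAction b G
  obtain ⟨-, hne, hrank⟩ := hg
  obtain ⟨l, hl, hl0, hdvd⟩ := exists_dvd_compLinear_sub_self b
    (s := ((g : V ≃ₗ[K] V) : V →ₗ[K] V)) (fun h => hne (LinearEquiv.toLinearMap_injective h)) hrank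
  refine ⟨l, hl, hl0, fun p => (dvd_sub_comm).mp ?_⟩
  have h : compLinear b ((g : V ≃ₗ[K] V) : V →ₗ[K] V) (g • p) = p := by
    have h := inv_smul_smul g p
    change compLinear b (((g⁻¹)⁻¹ : G) : V ≃ₗ[K] V) (g • p) = p at h
    rwa [inv_inv] at h
  simpa only [h] using hdvd (g • p)

theorem closure_actsAsReflection (hG : Subgroup.closure (reflectionsOf G) = G) :
    letI := linearGroupAction b G
    Subgroup.closure {g : G | ActsAsReflection (σ := ι) (K := K) g} = ⊤ := by
  let := linearGroupAction b G
  apply Subgroup.map_injective G.subtype_injective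
  rw [MonoidHom.map_closure, ← MonoidHom.range_eq_map, G.range_subtype]
  refine le_antisymm ((Subgroup.closure_le G).mpr (by rintro _ ⟨g, -, rfl⟩; exact g.2)) ?_
  conv_lhs => rw [← hG]
  refine Subgroup.closure_mono ?_
  rintro g ⟨hg, hr⟩
  exact ⟨⟨g, hg⟩, actsAsReflection_of_isPseudoReflection b ⟨g, hg⟩ hr, rfl⟩

theorem forall_smul_eq_iff [Infinite K] {p : MvPolynomial ι K} :
    letI := linearGroupAction b G
    (∀ g : G, g • p = p) ↔ ∀ g ∈ G, ∀ v : V,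
      eval (fun i => b.repr ((g : V ≃ₗ[K] V) v) i) p = eval (fun i => b.repr v i) p := by
  let := linearGroupAction b G
  rw [inv_surjective.forall, Subtype.forall]
  refine forall₂_congr fun g hg => ?_
  change compLinear b (((⟨g, hg⟩⁻¹)⁻¹ : G) : V ≃ₗ[K] V) p = p ↔ _
  rw [inv_inv]
  exact compLinear_eq_self_iff

end ReflectionGroup

end MvPolynomial

open MvPolynomial in
/-- **Corollary 7 (Marin–Michel).** Let `G ⊂ GL(V)` be an irreducible complex reflection
group, where `V` is a vector space over the field `K″` (realized as a subfield of `ℂ`,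
Galois and abelian over `ℚ`, over which `G` admits a model globally stable under
`Gal(K″/ℚ)`, as provided by the equivariance theorem).  Then there is a ℚ-form
`V = V₀ ⊗_ℚ K″` — i.e. a basis of `V` — such that the fundamental invariants of `G` can be
taken rational: there exist algebraically independent homogeneous polynomials
`f₁, …, f_r ∈ S(V₀^*) = ℚ[x₁,…,x_r]` (`r = dim V`) with `S(V^*)^G = K″[f₁,…,f_r]`. -/
theorem rational_fundamental_invariants
    (K'' : Subfield ℂ) [IsGalois ℚ ↥K''] [FiniteDimensional ℚ ↥K'']
    (habelian : ∀ σ τ : ↥K'' ≃ₐ[ℚ] ↥K'', σ * τ = τ * σ)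
    {V : Type} [AddCommGroup V] [Module ↥K'' V] [FiniteDimensional ↥K'' V]
    (G : Subgroup (V ≃ₗ[↥K''] V)) (hG : IsReflectionGroup G) (hirr : ActsIrreducibly G)
    -- `G` has a model globally invariant under `Gal(K″/ℚ)`:
    (b₀ : Basis (Fin (Module.finrank ↥K'' V)) ↥K'' V)
    (hstable : ∀ σ : ↥K'' ≃ₐ[ℚ] ↥K'', ∀ g ∈ G, ∃ g' ∈ G,
      ∀ i j, LinearMap.toMatrix b₀ b₀ ((g' : V ≃ₗ[↥K''] V) : V →ₗ[↥K''] V) i j =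
        σ (LinearMap.toMatrix b₀ b₀ ((g : V ≃ₗ[↥K''] V) : V →ₗ[↥K''] V) i j)) :
    ∃ (b : Basis (Fin (Module.finrank ↥K'' V)) ↥K'' V)
      (f : Fin (Module.finrank ↥K'' V) → MvPolynomial (Fin (Module.finrank ↥K'' V)) ℚ),
      -- the `fᵢ` are homogeneous,
      (∀ i, ∃ d : ℕ, (f i).IsHomogeneous d) ∧
      -- algebraically independent over `K″`,
      AlgebraicIndependent ↥K''
        (fun i => MvPolynomial.map (algebraMap ℚ ↥K'') (f i)) ∧
      -- and generate the invariant algebra `S(V^*)^G` over `K″`: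
      (∀ p : MvPolynomial (Fin (Module.finrank ↥K'' V)) ↥K'',
        (∀ g ∈ G, ∀ v : V,
            MvPolynomial.eval (fun i => b.repr ((g : V ≃ₗ[↥K''] V) v) i) p =
              MvPolynomial.eval (fun i => b.repr v i) p)
          ↔ p ∈ Algebra.adjoin ↥K''
              (Set.range fun i => MvPolynomial.map (algebraMap ℚ ↥K'') (f i))) := by
  let := MvPolynomial.linearGroupAction b₀ G
  have := hG.1
  have : SMulCommClass G K'' (MvPolynomial (Fin (Module.finrank K'' V)) K'') :=
    ⟨fun g c p => map_smul (compLinear b₀ _) c p⟩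
  obtain ⟨f, hf, hind, hgen⟩ := exists_fundamental_invariants (k := ℚ) (Γ := G)
    (fun g p d hp => isHomogeneous_compLinear b₀ _ hp) (closure_actsAsReflection b₀ hG.2)
    fun τ p hp g => by
      obtain ⟨g', hg', h⟩ := hstable τ.symm _ (g⁻¹).2
      have h' := hp ⟨g', hg'⟩⁻¹
      change compLinear b₀ _ p = p at h'
      change compLinear b₀ _ (map _ p) = _
      rw [← map_compLinear b₀ (f := (g' : V →ₗ[K''] V)) (τ : K'' →+* K'') fun i j => by
        rw [h]; exact (τ.apply_symm_apply _).symm]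
      rw [inv_inv] at h'
      rw [h']
  exact ⟨b₀, f, hf, hind, fun p => (forall_smul_eq_iff b₀).symm.trans (hgen p)⟩
end
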